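/- Let A₁,…,A_N be 2 × 2 complex matrices. If the linear switched system on ℂ² defined by (A₁,…,A_N) is periodically asymptotically stable, then it is globally uniformly exponentially stable. -/

import Mathlib

open scoped NNReal
open Filter Topology MeasureTheory

/-- A switching law: measurable functions `u₁,…,u_N : [0,∞) → [0,1]` with `Σᵢ uᵢ(s) = 1`
for a.e. `s ≥ 0` (the `uᵢ` are extended measurably to all of `ℝ`). -/
def IsSwitchingLaw {N : ℕ} (u : Fin N → ℝ → ℝ) : Prop :=
  (∀ i, Measurable (u i)) ∧
  (∀ᵐ s ∂(volume.restrict (Set.Ici (0 : ℝ))),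
    (∀ i, u i s ∈ Set.Icc (0 : ℝ) 1) ∧ ∑ i, u i s = 1)

/-- `x : [0,∞) → ℂ²` is the trajectory of the complex linear switched system defined by
`A₁,…,A_N` generated by the switching law `u`. -/
def IsCLinTrajectoryWith {N : ℕ}
    (A : Fin N → EuclideanSpace ℂ (Fin 2) →L[ℂ] EuclideanSpace ℂ (Fin 2))
    (u : Fin N → ℝ → ℝ) (x : ℝ≥0 → EuclideanSpace ℂ (Fin 2)) : Prop :=
  Continuous x ∧ IsSwitchingLaw u ∧
  ∀ t : ℝ≥0, x t = x 0 + ∫ s in Set.Ioc (0 : ℝ) (t : ℝ), ∑ i, u i s • A i (x (Real.toNNReal s))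

/-- The switching law `u` is constant (almost everywhere on `[0,∞)`). -/
def IsConstantLaw {N : ℕ} (u : Fin N → ℝ → ℝ) : Prop :=
  ∃ c : Fin N → ℝ, ∀ i, ∀ᵐ s ∂(volume.restrict (Set.Ici (0 : ℝ))), u i s = c i

/-- The switching law `u` is periodic: for some `p > 0`, `uᵢ(t + p) = uᵢ(t)` a.e. -/
def IsPeriodicLaw {N : ℕ} (u : Fin N → ℝ → ℝ) : Prop :=
  ∃ p : ℝ, 0 < p ∧ ∀ i, ∀ᵐ s ∂(volume.restrict (Set.Ici (0 : ℝ))), u i (s + p) = u i s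

theorem eq_of_continuousOn_of_exp_eq {f g : ℝ → ℂ} {a b : ℝ} (hab : a ≤ b)
    (hf : ContinuousOn f (Set.Icc a b)) (hg : ContinuousOn g (Set.Icc a b))
    (h : ∀ t ∈ Set.Icc a b, Complex.exp (f t) = Complex.exp (g t)) :
    f b - g b = f a - g a := by
  have hint : ∀ t ∈ Set.Icc a b, ∃ n : ℤ, f t - g t = n * (2 * Real.pi * Complex.I) := by
    intro t ht
    obtain ⟨n, hn⟩ := Complex.exp_eq_exp_iff_exists_int.1 (h t ht)
    exact ⟨n, by rw [hn]; ring⟩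
  obtain ⟨m, hm⟩ := hint a ⟨le_rfl, hab⟩
  obtain ⟨n, hn⟩ := hint b ⟨hab, le_rfl⟩
  set G : ℝ → ℝ := fun t => (f t - g t).im / (2 * Real.pi) with hG
  have hGc : ContinuousOn G (Set.Icc a b) :=
    (Complex.continuous_im.comp_continuousOn (hf.sub hg)).div_const _
  have hval : ∀ t, ∀ k : ℤ, f t - g t = k * (2 * Real.pi * Complex.I) → G t = k := by
    intro t k hk
    have : (2 * Real.pi) ≠ 0 := by positivity
    simp only [hG, hk]
    simp
  have key : m = n := by
    by_contra hne
    rcases lt_or_gt_of_ne hne with hlt | hlt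
    · have hmem : (m : ℝ) + 1 / 2 ∈ Set.Icc (G a) (G b) := by
        rw [hval a m hm, hval b n hn]
        have : (m : ℝ) + 1 ≤ n := by exact_mod_cast hlt
        constructor <;> linarith
      obtain ⟨t, ht, hte⟩ := intermediate_value_Icc hab hGc hmem
      obtain ⟨k, hk⟩ := hint t ht
      rw [hval t k hk] at hte
      have : (2 * k : ℤ) = 2 * m + 1 := by
        have : (2 * k : ℝ) = 2 * m + 1 := by linarith
        exact_mod_cast this
      omega
    · have hmem : (n : ℝ) + 1 / 2 ∈ Set.Icc (G b) (G a) := by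
        rw [hval a m hm, hval b n hn]
        have : (n : ℝ) + 1 ≤ m := by exact_mod_cast hlt
        constructor <;> linarith
      obtain ⟨t, ht, hte⟩ := intermediate_value_Icc' hab hGc hmem
      obtain ⟨k, hk⟩ := hint t ht
      rw [hval t k hk] at hte
      have : (2 * k : ℤ) = 2 * n + 1 := by
        have : (2 * k : ℝ) = 2 * n + 1 := by linarith
        exact_mod_cast this
      omega
  rw [hn, hm, key]

theorem exists_continuous_log {D : ℝ × ℝ → ℂ} (hD : Continuous D) (h0 : ∀ p, D p ≠ 0) :
    ∃ L : ℝ × ℝ → ℂ, Continuous L ∧ ∀ p, Complex.exp (L p) = D p := by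
  obtain ⟨F, ⟨-, hF⟩, -⟩ := Complex.isCoveringMapOn_exp.existsUnique_continuousMap_lifts
    (f := ⟨D, hD⟩) (a₀ := (0, 0)) (e₀ := Complex.log (D (0, 0)))
    (by simpa using Complex.exp_log (h0 _)) (by simpa using h0)
  exact ⟨F, F.continuous, fun p => congrFun hF p⟩

theorem abs_arg_lt_pi_div_two_of_re_pos {z : ℂ} (hz : 0 < z.re) : |z.arg| < Real.pi / 2 :=
  Complex.abs_arg_lt_pi_div_two_iff.2 (Or.inl hz)

theorem abs_im_sub_lt_pi {f : ℝ → ℂ} {a b : ℝ} (hab : a ≤ b) (hf : ContinuousOn f (Set.Icc a b))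
    (h : ∀ t ∈ Set.Icc a b, 0 < (Complex.exp (f t)).re) : |(f b).im - (f a).im| < Real.pi := by
  have hg : ContinuousOn (fun t => Complex.log (Complex.exp (f t))) (Set.Icc a b) := by
    refine ContinuousOn.clog (Complex.continuous_exp.comp_continuousOn hf) fun t ht => ?_
    exact Or.inl (h t ht)
  have := eq_of_continuousOn_of_exp_eq hab hf hg
    (fun t _ => (Complex.exp_log (Complex.exp_ne_zero _)).symm)
  have him := congrArg Complex.im this
  simp only [Complex.sub_im, Complex.log_im] at him
  have h1 := abs_lt.1 (abs_arg_lt_pi_div_two_of_re_pos (h a ⟨le_rfl, hab⟩))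
  have h2 := abs_lt.1 (abs_arg_lt_pi_div_two_of_re_pos (h b ⟨hab, le_rfl⟩))
  rw [abs_lt]
  constructor <;> linarith [h1.1, h1.2, h2.1, h2.2]

theorem arg_sub_sub_arg_eq_arg_div {z P : ℂ} (hPz : ‖P‖ < ‖z‖)
    (h : ∀ k ∈ Set.Icc (0 : ℝ) 1, z - k * P ∈ Complex.slitPlane) :
    (z - P).arg - z.arg = ((z - P) / z).arg := by
  have hz0 : z ≠ 0 := by
    rintro rfl
    simp at hPz
    exact absurd hPz (not_lt.2 (norm_nonneg _))
  have hre : ∀ k ∈ Set.Icc (0 : ℝ) 1, 1 - k * P / z ∈ Complex.slitPlane := by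
    intro k hk
    left
    have h1 : ‖(k * P / z : ℂ)‖ < 1 := by
      rw [norm_div, norm_mul, Complex.norm_real, Real.norm_eq_abs, abs_of_nonneg hk.1,
        div_lt_one (norm_pos_iff.2 hz0)]
      nlinarith [norm_nonneg P, hk.2]
    have := (Complex.abs_re_le_norm (k * P / z : ℂ))
    have := (abs_lt.1 (this.trans_lt h1)).2
    rw [Complex.sub_re, Complex.one_re]
    linarith
  have hslit0 : z ∈ Complex.slitPlane := by simpa using h 0 ⟨le_rfl, zero_le_one⟩
  have hc1 : ContinuousOn (fun k : ℝ => Complex.log (z - k * P)) (Set.Icc 0 1) :=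
    ContinuousOn.clog (by fun_prop) h
  have hc2 : ContinuousOn (fun k : ℝ => Complex.log z + Complex.log (1 - k * P / z))
      (Set.Icc 0 1) :=
    continuousOn_const.add (ContinuousOn.clog (by fun_prop) hre)
  have := eq_of_continuousOn_of_exp_eq zero_le_one hc1 hc2 (by
    intro k hk
    rw [Complex.exp_add, Complex.exp_log (Complex.slitPlane_ne_zero (h k hk)),
      Complex.exp_log hz0, Complex.exp_log (Complex.slitPlane_ne_zero (hre k hk))]
    field_simp)
  have him := congrArg Complex.im this
  simp only [Complex.sub_im, Complex.add_im, Complex.log_im] at him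
  simp at him
  have e : (z - P) / z = 1 - P / z := by field_simp
  rw [e]
  linarith

/-- Data of a planar motion `(c, b)` of constant `V`-norm, whose slope `b / c` crosses a small disc
only along short strands on which `‖c‖` decays. -/
structure StrandBox (c b : ℝ → ℂ) (V : ℂ → ℝ) (r R δ κ κ' ε : ℝ) : Prop where
  continuous_c : Continuous c
  continuous_b : Continuous b
  c_zero : c 0 = 1
  b_zero : b 0 = 0
  det_ne_zero : ∀ s t, s < t → c s * b t - b s * c t ≠ 0
  level : ∀ t, c t ≠ 0 → V (b t / c t) * ‖c t‖ = 1
  level_zero : V 0 = 1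
  segment_le : ∀ P, V P = 1 → ∀ k ∈ Set.Icc (0 : ℝ) 1, V (k * P) ≤ 1
  mono : ∀ (q : ℂ) (k : ℝ), ‖q‖ ≤ r → 0 ≤ k → V q + κ' * k ≤ V (q + k)
  R_pos : 0 < R
  R_le : R ≤ r
  δ_pos : 0 < δ
  δ_le : δ ≤ R / 2
  κ_pos : 0 < κ
  κ'_pos : 0 < κ'
  ε_pos : 0 < ε
  lt_of_le_δ : ∀ q : ℂ, ‖q‖ ≤ δ → 1 - κ' * R / 2 < V q
  le_of_le_R : ∀ q : ℂ, ‖q‖ ≤ R → Real.exp (-(κ * ε / 4)) < V q ∧ V q < Real.exp (κ * ε / 4)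
  strand : ∀ u h, c u ≠ 0 → ‖b u / c u‖ ≤ R → |h| ≤ ε →
    c (u + h) ≠ 0 ∧ ‖b (u + h) / c (u + h)‖ ≤ r
  decay : ∀ u s t, c u ≠ 0 → ‖b u / c u‖ ≤ R → u - ε ≤ s → s ≤ t → t ≤ u + ε →
    ‖c t‖ ≤ Real.exp (-κ * (t - s)) * ‖c s‖
  equicontinuous : ∀ η > 0, ∃ ε' > 0, ∀ u h, c u ≠ 0 → ‖b u / c u‖ ≤ R → |h| ≤ ε' →
    ‖b (u + h) / c (u + h) - b u / c u‖ ≤ η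

namespace StrandBox

variable {c b : ℝ → ℂ} {V : ℂ → ℝ} {r R δ κ κ' ε : ℝ}

theorem eq_of_level_of_im_eq (S : StrandBox c b V r R δ κ κ' ε) {p q : ℂ} (hp : ‖p‖ ≤ r)
    (hq : ‖q‖ ≤ r) (hVp : V p = 1) (hVq : V q = 1) (him : p.im = q.im) : p = q := by
  have h1 : ∀ p q : ℂ, ‖p‖ ≤ r → V p = 1 → V q = 1 → p.im = q.im → q.re ≤ p.re := by
    intro p q hp hVp hVq him
    by_contra! hlt
    have h := S.mono p (q.re - p.re) hp (by linarith)
    have e : p + ((q.re - p.re : ℝ) : ℂ) = q := by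
      apply Complex.ext <;> simp [him]
    rw [e, hVp, hVq] at h
    nlinarith [S.κ'_pos]
  exact Complex.ext (le_antisymm (h1 q p hq hVq hVp him.symm) (h1 p q hp hVp hVq him)) him

theorem b_ne_zero (S : StrandBox c b V r R δ κ κ' ε) {t : ℝ} (ht : 0 < t) : b t ≠ 0 := by
  have := S.det_ne_zero 0 t ht
  simpa [S.c_zero, S.b_zero] using this

theorem near_of_not_far (S : StrandBox c b V r R δ κ κ' ε) {t : ℝ} (ht : 0 < t)
    (h : ¬ R * ‖c t‖ < ‖b t‖) : c t ≠ 0 ∧ ‖b t / c t‖ ≤ R := by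
  have hb := norm_pos_iff.2 (S.b_ne_zero ht)
  have hc : c t ≠ 0 := by
    intro h0
    rw [h0] at h
    simp at h
    exact S.b_ne_zero ht h
  refine ⟨hc, ?_⟩
  rw [norm_div, div_le_iff₀ (norm_pos_iff.2 hc)]
  exact not_lt.1 h

theorem not_far_of_near {t : ℝ} (h : c t ≠ 0) (h2 : ‖b t / c t‖ ≤ R) : ¬ R * ‖c t‖ < ‖b t‖ := by
  rw [norm_div, div_le_iff₀ (norm_pos_iff.2 h)] at h2
  exact not_lt.2 h2

theorem norm_c_bounds (S : StrandBox c b V r R δ κ κ' ε) {t : ℝ} (hc : c t ≠ 0)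
    (hz : ‖b t / c t‖ ≤ R) :
    Real.exp (-(κ * ε / 4)) < ‖c t‖ ∧ ‖c t‖ < Real.exp (κ * ε / 4) := by
  obtain ⟨h1, h2⟩ := S.le_of_le_R _ hz
  have h := S.level t hc
  have hcp := norm_pos_iff.2 hc
  have e : Real.exp (-(κ * ε / 4)) * Real.exp (κ * ε / 4) = 1 := by
    rw [← Real.exp_add]; simp
  have p1 := Real.exp_pos (-(κ * ε / 4))
  have p2 := Real.exp_pos (κ * ε / 4)
  constructor
  · by_contra! hle
    nlinarith [mul_lt_mul h2 hle hcp p2.le]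
  · by_contra! hle
    nlinarith [mul_lt_mul h1 hle p2 (p1.trans h1).le]

/-- Half an `ε` before or after a visit of the small disc, the slope is outside of it. -/
theorem far_of_near (S : StrandBox c b V r R δ κ κ' ε) {s t : ℝ} (h1 : s + ε / 2 ≤ t)
    (h2 : t ≤ s + ε) (ht : 0 < t) (hs : 0 < s) :
    R * ‖c s‖ < ‖b s‖ ∨ R * ‖c t‖ < ‖b t‖ := by
  by_contra! h
  obtain ⟨hcs, hzs⟩ := S.near_of_not_far hs (not_lt.2 h.1)
  obtain ⟨hct, hzt⟩ := S.near_of_not_far ht (not_lt.2 h.2)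
  have hε := S.ε_pos
  have hd := S.decay s s t hcs hzs (by linarith) (by linarith) h2
  have b1 := (S.norm_c_bounds hcs hzs).2
  have b2 := (S.norm_c_bounds hct hzt).1
  have e1 : Real.exp (-κ * (t - s)) ≤ Real.exp (-(κ * ε / 2)) :=
    Real.exp_le_exp.2 (by nlinarith [S.κ_pos])
  have e2 : Real.exp (-(κ * ε / 2)) * Real.exp (κ * ε / 4) = Real.exp (-(κ * ε / 4)) := by
    rw [← Real.exp_add]; congr 1; ring
  have := mul_lt_mul' e1 b1 (norm_nonneg _) (Real.exp_pos (-(κ * ε / 2)))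
  linarith

/-- The slope just outside of the disc, relative to a marked point `P` of the level set. -/
structure Marked (S : StrandBox c b V r R δ κ κ' ε) (P : ℂ) (t₀ : ℝ) (E : ℝ → ℂ) : Prop where
  pos : 0 < t₀
  norm_le : ‖P‖ ≤ δ
  level : V P = 1
  ne : ∀ t, t₀ ≤ t → b t - P * c t ≠ 0
  cont : ContinuousOn E (Set.Ici t₀)
  exp_eq : ∀ t, t₀ ≤ t → Complex.exp (E t) = (b t - P * c t) / b t

variable {S : StrandBox c b V r R δ κ κ' ε} {P : ℂ} {t₀ : ℝ} {E : ℝ → ℂ}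

theorem Marked.re_pos (m : S.Marked P t₀ E) {t : ℝ} (ht : t₀ ≤ t) (hfar : R * ‖c t‖ < ‖b t‖) :
    0 < (Complex.exp (E t)).re := by
  have hb := S.b_ne_zero (m.pos.trans_le ht)
  rw [m.exp_eq t ht]
  have e : (b t - P * c t) / b t = 1 - P * c t / b t := by field_simp
  have hn : ‖P * c t / b t‖ < 1 := by
    rw [norm_div, norm_mul, div_lt_one (norm_pos_iff.2 hb)]
    have := S.δ_le
    have := S.R_pos
    nlinarith [m.norm_le, norm_nonneg (c t)]
  have := (abs_lt.1 ((Complex.abs_re_le_norm _).trans_lt hn)).2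
  rw [e, Complex.sub_re, Complex.one_re]
  linarith

/-- The winding defect at a time when the slope is far. -/
noncomputable def defect (E : ℝ → ℂ) (t : ℝ) : ℝ := (E t).im - (Complex.exp (E t)).arg

theorem Marked.abs_arg_lt (m : S.Marked P t₀ E) {t : ℝ} (ht : t₀ ≤ t)
    (hfar : R * ‖c t‖ < ‖b t‖) : |(Complex.exp (E t)).arg| < Real.pi / 2 :=
  abs_arg_lt_pi_div_two_of_re_pos (m.re_pos ht hfar)

theorem Marked.defect_eq_of_far (m : S.Marked P t₀ E) {t₁ t₂ : ℝ} (h1 : t₀ ≤ t₁) (h12 : t₁ ≤ t₂)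
    (hfar : ∀ t ∈ Set.Icc t₁ t₂, R * ‖c t‖ < ‖b t‖) : defect E t₁ = defect E t₂ := by
  have hsub : Set.Icc t₁ t₂ ⊆ Set.Ici t₀ := fun t ht => h1.trans ht.1
  have hf := m.cont.mono hsub
  have hg : ContinuousOn (fun t => Complex.log (Complex.exp (E t))) (Set.Icc t₁ t₂) :=
    ContinuousOn.clog (Complex.continuous_exp.comp_continuousOn hf) fun t ht =>
      Or.inl (m.re_pos (hsub ht) (hfar t ht))
  have := eq_of_continuousOn_of_exp_eq h12 hf hg
    (fun t _ => (Complex.exp_log (Complex.exp_ne_zero _)).symm)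
  have him := congrArg Complex.im this
  simp only [Complex.sub_im, Complex.log_im] at him
  exact him.symm

theorem Marked.exp_eq' (m : S.Marked P t₀ E) {t : ℝ} (ht : t₀ ≤ t) (hc : c t ≠ 0) :
    Complex.exp (E t) = (b t / c t - P) / (b t / c t) := by
  have hb := S.b_ne_zero (m.pos.trans_le ht)
  rw [m.exp_eq t ht]
  field_simp

theorem Marked.slope_ne (m : S.Marked P t₀ E) {t : ℝ} (ht : t₀ ≤ t) (hc : c t ≠ 0) :
    b t / c t ≠ 0 ∧ b t / c t - P ≠ 0 := by
  have hb := S.b_ne_zero (m.pos.trans_le ht)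
  refine ⟨div_ne_zero hb hc, ?_⟩
  have := m.ne t ht
  intro h
  apply this
  have e : b t = P * c t := by
    rw [← sub_eq_zero.1 h]; field_simp
  rw [e, sub_self]

/-- Above the level set, `z - k P` avoids the negative axis. -/
theorem Marked.upper_slitPlane (m : S.Marked P t₀ E) {z : ℂ} {k : ℝ} (hz : ‖z‖ ≤ r) (hV : 1 ≤ V z)
    (hk : k ∈ Set.Icc (0 : ℝ) 1) (hne : z - k * P ≠ 0) : z - k * P ∈ Complex.slitPlane := by
  rw [Complex.mem_slitPlane_iff_not_le_zero]
  intro hle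
  rw [Complex.le_def] at hle
  simp only [Complex.zero_re, Complex.zero_im] at hle
  set p : ℝ := -(z - k * P).re with hp
  have e : z + (p : ℂ) = k * P := by
    have : z - k * P = -(p : ℂ) := by
      apply Complex.ext
      · simp [hp]
      · simpa using hle.2
    linear_combination this
  have hp0 : 0 < p := by
    rcases (by linarith [hle.1] : 0 ≤ p).eq_or_lt with h | h
    · exfalso
      apply hne
      rw [← e, ← h]; simp
    · exact h
  have h1 := S.mono z p hz hp0.le
  rw [e] at h1
  have h2 := S.segment_le P m.level k hk
  nlinarith [S.κ'_pos]

theorem Marked.lower_slitPlane (_m : S.Marked P t₀ E) {z Q : ℂ} (hQ : ‖Q‖ ≤ r) (hVz : V z ≤ 1)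
    (h : ∀ p : ℝ, 0 ≤ p → z = Q + p → 1 < V Q + κ' * p) : Q - z ∈ Complex.slitPlane := by
  rw [Complex.mem_slitPlane_iff_not_le_zero]
  intro hle
  rw [Complex.le_def] at hle
  simp only [Complex.zero_re, Complex.zero_im] at hle
  set p : ℝ := -(Q - z).re with hp
  have e : z = Q + (p : ℂ) := by
    have : Q - z = -(p : ℂ) := by
      apply Complex.ext
      · simp [hp]
      · simpa using hle.2
    linear_combination -this
  have hp0 : 0 ≤ p := by linarith [hle.1]
  have h1 := S.mono Q p hQ hp0
  rw [← e] at h1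
  linarith [h p hp0 e]

theorem δ_le_r (S : StrandBox c b V r R δ κ κ' ε) : δ ≤ r := by
  linarith [S.δ_le, S.R_le, S.R_pos]

theorem Marked.lower_slitPlane_zero (m : S.Marked P t₀ E) {z : ℂ} (hVz : V z ≤ 1) (hz : z ≠ 0) :
    -z ∈ Complex.slitPlane := by
  have := m.lower_slitPlane (z := z) (Q := 0) (by simpa using S.δ_pos.le.trans S.δ_le_r) hVz
    (by
      intro p hp e
      rw [S.level_zero]
      have : p ≠ 0 := by rintro rfl; exact hz (by simpa using e)
      have := S.κ'_pos
      have : 0 < p := lt_of_le_of_ne hp (Ne.symm ‹_›)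
      nlinarith)
  simpa using this

theorem Marked.lower_slitPlane_P (m : S.Marked P t₀ E) {z : ℂ} (hVz : V z ≤ 1) (hz : z - P ≠ 0) :
    P - z ∈ Complex.slitPlane := by
  refine m.lower_slitPlane (m.norm_le.trans S.δ_le_r) hVz ?_
  intro p hp e
  rw [m.level]
  have : p ≠ 0 := by rintro rfl; exact hz (by rw [e]; simp)
  have := S.κ'_pos
  have : 0 < p := lt_of_le_of_ne hp (Ne.symm ‹_›)
  nlinarith

theorem level_ge_of_le (S : StrandBox c b V r R δ κ κ' ε) {t : ℝ} (hc : c t ≠ 0)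
    (h : ‖c t‖ ≤ 1) : 1 ≤ V (b t / c t) := by
  have := S.level t hc
  have hp := norm_pos_iff.2 hc
  by_contra! hlt
  nlinarith

theorem level_le_of_ge (S : StrandBox c b V r R δ κ κ' ε) {t : ℝ} (hc : c t ≠ 0)
    (h : 1 ≤ ‖c t‖) : V (b t / c t) ≤ 1 := by
  have := S.level t hc
  by_contra! hlt
  nlinarith

theorem Marked.arg_upper (m : S.Marked P t₀ E) {t : ℝ} (ht : t₀ ≤ t) (hc : c t ≠ 0)
    (hr : ‖b t / c t‖ ≤ r) (hfar : R * ‖c t‖ < ‖b t‖) (h1 : ‖c t‖ ≤ 1) :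
    (b t / c t - P).arg - (b t / c t).arg = (Complex.exp (E t)).arg := by
  rw [m.exp_eq' ht hc]
  have hR : R < ‖b t / c t‖ := by rwa [norm_div, lt_div_iff₀ (norm_pos_iff.2 hc)]
  have hPz : ‖P‖ < ‖b t / c t‖ := by linarith [m.norm_le, S.δ_le, S.R_pos]
  refine arg_sub_sub_arg_eq_arg_div hPz fun k hk => ?_
  refine m.upper_slitPlane hr (S.level_ge_of_le hc h1) hk ?_
  intro h0
  have := congrArg norm (sub_eq_zero.1 h0)
  rw [norm_mul, Complex.norm_real, Real.norm_eq_abs, abs_of_nonneg hk.1] at this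
  nlinarith [hk.2, norm_nonneg P]

theorem Marked.arg_lower (m : S.Marked P t₀ E) {t : ℝ} (ht : t₀ ≤ t) (hc : c t ≠ 0)
    (hfar : R * ‖c t‖ < ‖b t‖) (h1 : 1 ≤ ‖c t‖) :
    (P - b t / c t).arg - (-(b t / c t)).arg = (Complex.exp (E t)).arg := by
  rw [m.exp_eq' ht hc]
  have hR : R < ‖b t / c t‖ := by rwa [norm_div, lt_div_iff₀ (norm_pos_iff.2 hc)]
  have hPz : ‖-P‖ < ‖-(b t / c t)‖ := by
    rw [norm_neg, norm_neg]; linarith [m.norm_le, S.δ_le, S.R_pos]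
  have key := arg_sub_sub_arg_eq_arg_div hPz fun k hk => ?_
  · rw [show -(b t / c t) - -P = P - b t / c t by ring,
      show (P - b t / c t) / -(b t / c t) = (b t / c t - P) / (b t / c t) by
        rw [div_neg, ← neg_div]; ring] at key
    exact key
  · have hkP : ‖(k * P : ℂ)‖ ≤ δ := by
      rw [norm_mul, Complex.norm_real, Real.norm_eq_abs, abs_of_nonneg hk.1]
      nlinarith [hk.2, norm_nonneg P, m.norm_le]
    have := m.lower_slitPlane (z := b t / c t) (Q := k * P) (hkP.trans S.δ_le_r)
      (S.level_le_of_ge hc h1) (by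
        intro p hp e
        have h2 := S.lt_of_le_δ _ hkP
        have h3 : R - δ ≤ p := by
          have := norm_add_le (k * P : ℂ) p
          rw [← e, Complex.norm_real, Real.norm_eq_abs, abs_of_nonneg hp] at this
          linarith
        have := S.δ_le
        have : R / 2 ≤ p := by linarith
        nlinarith [S.κ'_pos])
    rw [show -(b t / c t) - (k : ℂ) * -P = k * P - b t / c t by ring]
    exact this

theorem Marked.transport_upper (m : S.Marked P t₀ E) {t₁ t₂ : ℝ} (h1 : t₀ ≤ t₁) (h12 : t₁ ≤ t₂)
    (hc : ∀ t ∈ Set.Icc t₁ t₂, c t ≠ 0 ∧ ‖b t / c t‖ ≤ r ∧ ‖c t‖ ≤ 1) :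
    (E t₂).im - ((b t₂ / c t₂ - P).arg - (b t₂ / c t₂).arg) =
      (E t₁).im - ((b t₁ / c t₁ - P).arg - (b t₁ / c t₁).arg) := by
  have hsub : Set.Icc t₁ t₂ ⊆ Set.Ici t₀ := fun t ht => h1.trans ht.1
  have hz : ContinuousOn (fun t => b t / c t) (Set.Icc t₁ t₂) :=
    S.continuous_b.continuousOn.div S.continuous_c.continuousOn fun t ht => (hc t ht).1
  have hs0 : ∀ t ∈ Set.Icc t₁ t₂, b t / c t ∈ Complex.slitPlane := fun t ht => by
    simpa using m.upper_slitPlane (k := 0) (hc t ht).2.1 (S.level_ge_of_le (hc t ht).1 (hc t ht).2.2)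
      ⟨le_rfl, zero_le_one⟩ (by simpa using m.slope_ne (hsub ht) (hc t ht).1 |>.1)
  have hs1 : ∀ t ∈ Set.Icc t₁ t₂, b t / c t - P ∈ Complex.slitPlane := fun t ht => by
    simpa using m.upper_slitPlane (k := 1) (hc t ht).2.1 (S.level_ge_of_le (hc t ht).1 (hc t ht).2.2)
      ⟨zero_le_one, le_rfl⟩ (by simpa using m.slope_ne (hsub ht) (hc t ht).1 |>.2)
  have := eq_of_continuousOn_of_exp_eq h12 (m.cont.mono hsub)
    (g := fun t => Complex.log (b t / c t - P) - Complex.log (b t / c t))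
    (((hz.sub continuousOn_const).clog hs1).sub (hz.clog hs0)) (by
      intro t ht
      rw [Complex.exp_sub, Complex.exp_log (Complex.slitPlane_ne_zero (hs1 t ht)),
        Complex.exp_log (Complex.slitPlane_ne_zero (hs0 t ht)), m.exp_eq' (hsub ht) (hc t ht).1])
  have him := congrArg Complex.im this
  simpa only [Complex.sub_im, Complex.log_im] using him

theorem Marked.transport_lower (m : S.Marked P t₀ E) {t₁ t₂ : ℝ} (h1 : t₀ ≤ t₁) (h12 : t₁ ≤ t₂)
    (hc : ∀ t ∈ Set.Icc t₁ t₂, c t ≠ 0 ∧ 1 ≤ ‖c t‖) :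
    (E t₂).im - ((P - b t₂ / c t₂).arg - (-(b t₂ / c t₂)).arg) =
      (E t₁).im - ((P - b t₁ / c t₁).arg - (-(b t₁ / c t₁)).arg) := by
  have hsub : Set.Icc t₁ t₂ ⊆ Set.Ici t₀ := fun t ht => h1.trans ht.1
  have hz : ContinuousOn (fun t => b t / c t) (Set.Icc t₁ t₂) :=
    S.continuous_b.continuousOn.div S.continuous_c.continuousOn fun t ht => (hc t ht).1
  have hs0 : ∀ t ∈ Set.Icc t₁ t₂, -(b t / c t) ∈ Complex.slitPlane := fun t ht =>
    m.lower_slitPlane_zero (S.level_le_of_ge (hc t ht).1 (hc t ht).2)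
      (m.slope_ne (hsub ht) (hc t ht).1).1
  have hs1 : ∀ t ∈ Set.Icc t₁ t₂, P - b t / c t ∈ Complex.slitPlane := fun t ht =>
    m.lower_slitPlane_P (S.level_le_of_ge (hc t ht).1 (hc t ht).2)
      (m.slope_ne (hsub ht) (hc t ht).1).2
  have := eq_of_continuousOn_of_exp_eq h12 (m.cont.mono hsub)
    (g := fun t => Complex.log (P - b t / c t) - Complex.log (-(b t / c t)))
    (((continuousOn_const.sub hz).clog hs1).sub (hz.neg.clog hs0)) (by
      intro t ht
      rw [Complex.exp_sub, Complex.exp_log (Complex.slitPlane_ne_zero (hs1 t ht)),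
        Complex.exp_log (Complex.slitPlane_ne_zero (hs0 t ht)), m.exp_eq' (hsub ht) (hc t ht).1, div_neg, ← neg_div]
      ring)
  have him := congrArg Complex.im this
  simpa only [Complex.sub_im, Complex.log_im] using him

theorem arg_sub_arg_neg_of_im_pos {z : ℂ} (h : 0 < z.im) : z.arg - (-z).arg = Real.pi := by
  rw [Complex.arg_neg_eq_arg_sub_pi_of_im_pos h]; ring

theorem arg_sub_arg_neg_of_im_neg {z : ℂ} (h : z.im < 0) : z.arg - (-z).arg = -Real.pi := by
  rw [Complex.arg_neg_eq_arg_add_pi_of_im_neg h]; ring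

/-- The defect does not change along a strand, except that it increases by `2π` when the strand
crosses the level set between `0` and `P`. -/
theorem Marked.defect_crossing (m : S.Marked P t₀ E) (hP : 0 < P.im) {t₁ tc t₂ : ℝ} (h1 : t₀ ≤ t₁)
    (h1c : t₁ ≤ tc) (hc2 : tc ≤ t₂) (hc : ∀ t ∈ Set.Icc t₁ t₂, c t ≠ 0 ∧ ‖b t / c t‖ ≤ r)
    (hanti : AntitoneOn (fun t => ‖c t‖) (Set.Icc t₁ t₂)) (hcross : ‖c tc‖ = 1)
    (hf1 : R * ‖c t₁‖ < ‖b t₁‖) (hf2 : R * ‖c t₂‖ < ‖b t₂‖) :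
    defect E t₂ = defect E t₁ + 2 * Real.pi ∧ 0 < (b tc / c tc).im ∧ (b tc / c tc).im < P.im ∨
    defect E t₂ = defect E t₁ ∧ ((b tc / c tc).im < 0 ∨ P.im < (b tc / c tc).im) := by
  have hmem : tc ∈ Set.Icc t₁ t₂ := ⟨h1c, hc2⟩
  have hm1 : t₁ ∈ Set.Icc t₁ t₂ := ⟨le_rfl, h1c.trans hc2⟩
  have hm2 : t₂ ∈ Set.Icc t₁ t₂ := ⟨h1c.trans hc2, le_rfl⟩
  have hup := m.transport_upper (h1.trans h1c) hc2 fun t ht =>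
    ⟨(hc t ⟨h1c.trans ht.1, ht.2⟩).1, (hc t ⟨h1c.trans ht.1, ht.2⟩).2,
      hcross ▸ hanti hmem ⟨h1c.trans ht.1, ht.2⟩ ht.1⟩
  have hlow := m.transport_lower h1 h1c fun t ht =>
    ⟨(hc t ⟨ht.1, ht.2.trans hc2⟩).1, hcross ▸ hanti ⟨ht.1, ht.2.trans hc2⟩ hmem ht.2⟩
  rw [m.arg_upper (h1.trans hm2.1) (hc t₂ hm2).1 (hc t₂ hm2).2 hf2 (hcross ▸ hanti hmem hm2 hc2)]
    at hup
  rw [m.arg_lower h1 (hc t₁ hm1).1 hf1 (hcross ▸ hanti hm1 hmem h1c)] at hlow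
  have hctc := (hc tc hmem).1
  have hV : V (b tc / c tc) = 1 := by simpa [hcross] using S.level tc hctc
  have hne := m.slope_ne (h1.trans h1c) hctc
  have hPr : ‖P‖ ≤ r := m.norm_le.trans S.δ_le_r
  have hr0 : ‖(0 : ℂ)‖ ≤ r := by simpa using S.δ_pos.le.trans S.δ_le_r
  have hzr := (hc tc hmem).2
  generalize b tc / c tc = z at *
  have him0 : z.im ≠ 0 := fun h => hne.1
    (S.eq_of_level_of_im_eq hzr hr0 hV S.level_zero (by simpa using h))
  have himP : z.im ≠ P.im := fun h => hne.2
    (sub_eq_zero.2 (S.eq_of_level_of_im_eq hzr hPr hV m.level h))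
  unfold defect
  have eneg : P - z = -(z - P) := by ring
  rw [eneg] at hlow
  rcases lt_or_gt_of_ne him0 with h0 | h0
  · right
    have a1 := arg_sub_arg_neg_of_im_neg h0
    have a2 := arg_sub_arg_neg_of_im_neg (z := z - P) (by rw [Complex.sub_im]; linarith)
    exact ⟨by linarith, Or.inl h0⟩
  · have a1 := arg_sub_arg_neg_of_im_pos h0
    rcases lt_or_gt_of_ne himP with hp | hp
    · left
      have a2 := arg_sub_arg_neg_of_im_neg (z := z - P) (by rw [Complex.sub_im]; linarith)
      exact ⟨by linarith, h0, hp⟩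
    · right
      have a2 := arg_sub_arg_neg_of_im_pos (z := z - P) (by rw [Complex.sub_im]; linarith)
      exact ⟨by linarith, Or.inr hp⟩

theorem strand_antitoneOn (S : StrandBox c b V r R δ κ κ' ε) {u t₁ t₂ : ℝ} (hu : c u ≠ 0)
    (hz : ‖b u / c u‖ ≤ R) (h1 : u - ε ≤ t₁) (h2 : t₂ ≤ u + ε) :
    AntitoneOn (fun t => ‖c t‖) (Set.Icc t₁ t₂) := by
  intro s hs t ht hst
  have := S.decay u s t hu hz (h1.trans hs.1) hst (ht.2.trans h2)
  refine this.trans (mul_le_of_le_one_left (norm_nonneg _) (Real.exp_le_one_iff.2 ?_))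
  nlinarith [S.κ_pos]

theorem strand_near (S : StrandBox c b V r R δ κ κ' ε) {u t : ℝ} (hu : c u ≠ 0)
    (hz : ‖b u / c u‖ ≤ R) (h1 : u - ε ≤ t) (h2 : t ≤ u + ε) :
    c t ≠ 0 ∧ ‖b t / c t‖ ≤ r := by
  have := S.strand u (t - u) hu hz (abs_le.2 ⟨by linarith, by linarith⟩)
  simpa using this

theorem Marked.defect_strand_le (m : S.Marked P t₀ E) (hP : 0 < P.im) {u t₁ t₂ : ℝ} (hu : c u ≠ 0)
    (hz : ‖b u / c u‖ ≤ R) (h0 : t₀ ≤ t₁) (h1 : u - ε ≤ t₁) (h12 : t₁ ≤ t₂) (h2 : t₂ ≤ u + ε)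
    (hf1 : R * ‖c t₁‖ < ‖b t₁‖) (hf2 : R * ‖c t₂‖ < ‖b t₂‖) : defect E t₁ ≤ defect E t₂ := by
  have hanti := S.strand_antitoneOn hu hz h1 h2
  have hc : ∀ t ∈ Set.Icc t₁ t₂, c t ≠ 0 ∧ ‖b t / c t‖ ≤ r := fun t ht =>
    S.strand_near hu hz (h1.trans ht.1) (ht.2.trans h2)
  have hm1 : t₁ ∈ Set.Icc t₁ t₂ := ⟨le_rfl, h12⟩
  have hm2 : t₂ ∈ Set.Icc t₁ t₂ := ⟨h12, le_rfl⟩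
  rcases le_total ‖c t₁‖ 1 with hle | hge
  · have hle' : ∀ t ∈ Set.Icc t₁ t₂, ‖c t‖ ≤ 1 := fun t ht => (hanti hm1 ht ht.1).trans hle
    have := m.transport_upper h0 h12 fun t ht => ⟨(hc t ht).1, (hc t ht).2, hle' t ht⟩
    rw [m.arg_upper h0 (hc _ hm1).1 (hc _ hm1).2 hf1 (hle' _ hm1),
      m.arg_upper (h0.trans h12) (hc _ hm2).1 (hc _ hm2).2 hf2 (hle' _ hm2)] at this
    exact this.ge
  rcases le_total 1 ‖c t₂‖ with hge2 | hle2
  · have hge' : ∀ t ∈ Set.Icc t₁ t₂, 1 ≤ ‖c t‖ := fun t ht => hge2.trans (hanti ht hm2 ht.2)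
    have := m.transport_lower h0 h12 fun t ht => ⟨(hc t ht).1, hge' t ht⟩
    rw [m.arg_lower h0 (hc _ hm1).1 hf1 (hge' _ hm1),
      m.arg_lower (h0.trans h12) (hc _ hm2).1 hf2 (hge' _ hm2)] at this
    exact this.ge
  obtain ⟨tc, htc, hcross⟩ := intermediate_value_Icc' h12
    (S.continuous_c.norm.continuousOn (s := Set.Icc t₁ t₂)) ⟨hle2, hge⟩
  rcases m.defect_crossing hP h0 htc.1 htc.2 hc hanti hcross hf1 hf2 with h | h
  · linarith [h.1, Real.pi_pos]
  · exact h.1.ge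

theorem Marked.defect_mono (m : S.Marked P t₀ E) (hP : 0 < P.im) (n : ℕ) {t₁ t₂ : ℝ} (h0 : t₀ ≤ t₁)
    (h12 : t₁ ≤ t₂) (h2 : t₂ ≤ t₁ + ε + n * (ε / 2)) (hf1 : R * ‖c t₁‖ < ‖b t₁‖)
    (hf2 : R * ‖c t₂‖ < ‖b t₂‖) : defect E t₁ ≤ defect E t₂ := by
  have hε := S.ε_pos
  have hshort : ∀ {t₁ t₂ : ℝ}, t₀ ≤ t₁ → t₁ ≤ t₂ → t₂ ≤ t₁ + ε → R * ‖c t₁‖ < ‖b t₁‖ →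
      R * ‖c t₂‖ < ‖b t₂‖ → defect E t₁ ≤ defect E t₂ := by
    intro t₁ t₂ h0 h12 h2 hf1 hf2
    by_cases hfar : ∀ t ∈ Set.Icc t₁ t₂, R * ‖c t‖ < ‖b t‖
    · exact (m.defect_eq_of_far h0 h12 hfar).le
    · push Not at hfar
      obtain ⟨u, hu, hnf⟩ := hfar
      obtain ⟨hcu, hzu⟩ := S.near_of_not_far (m.pos.trans_le (h0.trans hu.1)) (not_lt.2 hnf)
      exact m.defect_strand_le hP hcu hzu h0 (by linarith [hu.2]) h12 (by linarith [hu.1]) hf1 hf2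
  induction n generalizing t₁ with
  | zero => exact hshort h0 h12 (by simpa using h2) hf1 hf2
  | succ n ih =>
    push_cast at h2
    rcases le_total t₂ (t₁ + ε) with hle | hge
    · exact hshort h0 h12 hle hf1 hf2
    · have hpos := m.pos
      rcases S.far_of_near (s := t₁ + ε / 2) (t := t₁ + ε) (by linarith) (by linarith)
        (by linarith) (by linarith) with hs | hs
      · exact (hshort h0 (by linarith) (by linarith) hf1 hs).trans
          (ih (by linarith) (by linarith) (by linarith) hs)
      · exact (hshort h0 (by linarith) (by linarith) hf1 hs).trans
          (ih (by linarith) (by linarith) (by linarith) hs)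

end StrandBox

namespace StrandBox

variable {c b : ℝ → ℂ} {V : ℂ → ℝ} {r R δ κ κ' ε : ℝ}

theorem exists_near_return (S : StrandBox c b V r R δ κ κ' ε) {ρ : ℝ} (hρ : 0 < ρ) :
    ∃ η > 0, ∀ τ, ‖c τ - 1‖ ≤ η → ‖b τ‖ ≤ η →
      (c τ ≠ 0 ∧ ‖b τ / c τ‖ ≤ R) ∧ (∃ t, |t - τ| ≤ ε ∧ ‖c t‖ = 1) ∧
      ∀ t, |t - τ| ≤ ε → ‖c t‖ = 1 → ‖b t / c t‖ ≤ ρ := by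
  obtain ⟨ε₁, hε₁, huc⟩ := S.equicontinuous (ρ / 2) (by positivity)
  have hε := S.ε_pos
  have hκ := S.κ_pos
  have hR := S.R_pos
  set ε₂ := min ε ε₁ with hε₂
  have hε₂p : 0 < ε₂ := lt_min hε hε₁
  set g := Real.exp (-κ * ε₂) with hg
  have hg1 : g < 1 := Real.exp_lt_one_iff.2 (by nlinarith) 
  have hg0 : 0 < g := Real.exp_pos _
  set η := min (min (1 / 2) (R / 2)) (min (ρ / 4) ((1 - g) / 2)) with hη
  have η1 : η ≤ 1 / 2 := (min_le_left _ _).trans (min_le_left _ _)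
  have η2 : η ≤ R / 2 := (min_le_left _ _).trans (min_le_right _ _)
  have η3 : η ≤ ρ / 4 := (min_le_right _ _).trans (min_le_left _ _)
  have η4 : η ≤ (1 - g) / 2 := (min_le_right _ _).trans (min_le_right _ _)
  have η0 : 0 < η := lt_min (lt_min (by norm_num) (by linarith)) (lt_min (by linarith) (by linarith))
  clear_value η
  refine ⟨η, η0, fun τ hc hb => ?_⟩
  have hcl : 1 - η ≤ ‖c τ‖ := by
    have := norm_sub_norm_le (1 : ℂ) (c τ)
    rw [norm_one, norm_sub_rev] at this
    linarith
  have hcu : ‖c τ‖ ≤ 1 + η := by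
    have := norm_sub_norm_le (c τ) (1 : ℂ)
    rw [norm_one] at this
    linarith
  have hc0 : 0 < ‖c τ‖ := by linarith
  have hcne := norm_pos_iff.1 hc0
  have hz : ‖b τ / c τ‖ ≤ 2 * η := by
    rw [norm_div, div_le_iff₀ hc0]
    nlinarith
  have hzR : ‖b τ / c τ‖ ≤ R := by linarith
  have hdec : ∀ s t, τ - ε ≤ s → t ≤ τ + ε → s + ε₂ ≤ t → ‖c t‖ ≤ g * ‖c s‖ := by
    intro s t hs ht hst
    refine (S.decay τ s t hcne hzR hs (by linarith) ht).trans ?_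
    refine mul_le_mul_of_nonneg_right (Real.exp_le_exp.2 ?_) (norm_nonneg _)
    nlinarith
  have hε2ε : ε₂ ≤ ε := min_le_left _ _
  have hε2ε1 : ε₂ ≤ ε₁ := min_le_right _ _
  refine ⟨⟨hcne, hzR⟩, ?_, ?_⟩
  · have hl : 1 ≤ ‖c (τ - ε)‖ := by
      by_contra! hlt
      have := hdec (τ - ε) τ le_rfl (by linarith) (by linarith)
      nlinarith
    have hr : ‖c (τ + ε)‖ ≤ 1 := by
      have := hdec τ (τ + ε) (by linarith) le_rfl (by linarith)
      nlinarith
    obtain ⟨t, ht, h⟩ := intermediate_value_Icc' (by linarith : τ - ε ≤ τ + ε)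
      S.continuous_c.norm.continuousOn ⟨hr, hl⟩
    exact ⟨t, abs_le.2 ⟨by linarith [ht.1], by linarith [ht.2]⟩, h⟩
  · intro t ht hct
    have h2 := abs_le.1 ht
    have : |t - τ| ≤ ε₁ := by
      rw [abs_le]
      constructor
      · by_contra! hlt
        have := hdec t τ (by linarith) (by linarith) (by linarith)
        rw [hct] at this
        linarith
      · by_contra! hlt
        have := hdec τ t (by linarith) (by linarith) (by linarith)
        rw [hct] at this
        nlinarith
    have h3 := huc τ (t - τ) hcne hzR this
    rw [add_sub_cancel] at h3
    have := norm_sub_norm_le (b t / c t) (b τ / c τ)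
    linarith

theorem crossing_side (S : StrandBox c b V r R δ κ κ' ε) {T : ℝ} (hT : 0 < T) (hcT : ‖c T‖ = 1)
    (hzT : ‖b T / c T‖ ≤ δ) (him : 0 < (b T / c T).im) :
    ∃ η > 0, ∀ τ, T + 2 * ε ≤ τ → ‖c τ - 1‖ ≤ η → ‖b τ‖ ≤ η →
      ‖c (τ + (T + ε)) - c (T + ε)‖ ≤ η → ‖b (τ + (T + ε)) - b (T + ε)‖ ≤ η →
      ∀ t, |t - τ| ≤ ε → ‖c t‖ = 1 → (b t / c t).im ≤ 0 := by
  have hε := S.ε_pos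
  have hR := S.R_pos
  have hcTne : c T ≠ 0 := norm_pos_iff.1 (by rw [hcT]; exact one_pos)
  have hzTR : ‖b T / c T‖ ≤ R := by linarith [S.δ_le]
  obtain ⟨t₀, ht₀⟩ : ∃ t₀, t₀ = T + ε := ⟨_, rfl⟩
  rw [← ht₀]
  -- lift of the determinant
  set cl : ℝ → ℝ := fun s => max 0 (min s T) with hcl
  have hcl_cont : Continuous cl := by fun_prop
  have hcl_le : ∀ s, cl s ≤ T := fun s => max_le hT.le (min_le_right _ _)
  have hcl_eq : ∀ s ∈ Set.Icc (0 : ℝ) T, cl s = s := fun s hs => by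
    simp only [hcl, min_eq_left hs.2, max_eq_right hs.1]
  have hDc : Continuous fun p : ℝ × ℝ =>
      c (cl p.1) * b (max p.2 t₀) - b (cl p.1) * c (max p.2 t₀) := by
    have := S.continuous_b
    have := S.continuous_c
    fun_prop
  obtain ⟨L, hLc, hL⟩ := exists_continuous_log hDc fun p =>
    S.det_ne_zero _ _ (by linarith [hcl_le p.1, le_max_right p.2 t₀])
  have hL' : ∀ s ∈ Set.Icc (0 : ℝ) T, ∀ t, t₀ ≤ t →
      Complex.exp (L (s, t)) = c s * b t - b s * c t := by
    intro s hs t ht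
    rw [hL]
    simp only [hcl_eq s hs, max_eq_left ht]
  have mem0 : (0 : ℝ) ∈ Set.Icc 0 T := ⟨le_rfl, hT.le⟩
  have memT : T ∈ Set.Icc 0 T := ⟨hT.le, le_rfl⟩
  set P := b T / c T with hP
  have hbT : b T = P * c T := by rw [hP]; field_simp
  set E : ℝ → ℂ := fun t => L (T, t) - L (0, t) - Complex.log (c T) with hE
  have m : S.Marked P t₀ E := by
    refine ⟨by linarith, hzT, by simpa [hcT] using S.level T hcTne, ?_, ?_, ?_⟩
    · intro t ht h0
      apply S.det_ne_zero T t (by linarith)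
      rw [hbT]; linear_combination c T * h0
    · exact Continuous.continuousOn (by fun_prop)
    · intro t ht
      have hb := S.b_ne_zero (by linarith : 0 < t)
      simp only [hE, Complex.exp_sub, hL' T memT t ht, hL' 0 mem0 t ht, Complex.exp_log hcTne,
        S.c_zero, S.b_zero, hbT]
      rw [div_div, div_eq_div_iff (by simpa using ⟨hb, hcTne⟩) hb]
      ring
  -- choice of the tolerance
  obtain ⟨η₁, hη₁, hret⟩ := S.exists_near_return (ρ := P.im / 2) (by positivity)
  have hfar0 : R * ‖c t₀‖ < ‖b t₀‖ := by
    rcases S.far_of_near (s := T) (t := t₀) (by linarith) (by linarith) (by linarith) hT with h | h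
    · exact absurd h (not_far_of_near hcTne hzTR)
    · exact h
  obtain ⟨m₀, hm₀, hmD⟩ : ∃ m₀ > 0, ∀ s ∈ Set.Icc 0 T, m₀ ≤ ‖c s * b t₀ - b s * c t₀‖ := by
    have hcont : Continuous fun s => ‖c s * b t₀ - b s * c t₀‖ := by
      have := S.continuous_b
      have := S.continuous_c
      fun_prop
    obtain ⟨s, hs, hmin⟩ := isCompact_Icc.exists_isMinOn ⟨0, mem0⟩ hcont.continuousOn
    exact ⟨_, norm_pos_iff.2 (S.det_ne_zero s t₀ (by linarith [hs.2])), fun s' hs' => hmin hs'⟩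
  obtain ⟨K, hK⟩ : ∃ K, ∀ s ∈ Set.Icc 0 T, ‖c s‖ + ‖b s‖ ≤ K := by
    obtain ⟨s, hs, hmax⟩ := isCompact_Icc.exists_isMaxOn ⟨0, mem0⟩
      (S.continuous_c.norm.add S.continuous_b.norm).continuousOn
    exact ⟨_, fun s' hs' => hmax hs'⟩
  have hK0 : 0 ≤ K := by
    have := hK 0 mem0
    rw [S.c_zero, norm_one] at this
    linarith [norm_nonneg (b 0)]
  refine ⟨min η₁ (min (m₀ / (2 * (K + 1))) ((‖b t₀‖ - R * ‖c t₀‖) / (2 * (R + 1)))),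
    lt_min hη₁ (lt_min (by positivity) (div_pos (by linarith) (by positivity))), ?_⟩
  intro τ hτ h1 h2 h3 h4 t ht hct
  have h1' := h1.trans (min_le_left _ _)
  have h2' := h2.trans (min_le_left _ _)
  obtain ⟨⟨hcτ, hzτ⟩, -, hsm⟩ := hret τ h1' h2'
  have hK1 : 0 < 2 * (K + 1) := by positivity
  have hR1 : 0 < 2 * (R + 1) := by positivity
  have c1 := (le_div_iff₀ hK1).1 (h3.trans ((min_le_right _ _).trans (min_le_left _ _)))
  have b1 := (le_div_iff₀ hK1).1 (h4.trans ((min_le_right _ _).trans (min_le_left _ _)))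
  have c2 := (le_div_iff₀ hR1).1 (h3.trans ((min_le_right _ _).trans (min_le_right _ _)))
  have b2 := (le_div_iff₀ hR1).1 (h4.trans ((min_le_right _ _).trans (min_le_right _ _)))
  set t₁ := τ + t₀ with ht₁
  have ht01 : t₀ ≤ t₁ := by linarith
  have hfar1 : R * ‖c t₁‖ < ‖b t₁‖ := by
    have e1 := norm_sub_norm_le (c t₁) (c t₀)
    have e2 := norm_sub_norm_le (b t₀) (b t₁)
    rw [norm_sub_rev] at e2
    have e3 := mul_le_mul_of_nonneg_left e1 hR.le
    have e4 : (‖c t₁ - c t₀‖ * (2 * (R + 1))) * R ≤ (‖b t₀‖ - R * ‖c t₀‖) * R :=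
      mul_le_mul_of_nonneg_right c2 hR.le
    by_contra! hle
    have e5 : ‖b t₀‖ - R * ‖c t₀‖ ≤ ‖b t₁ - b t₀‖ + R * ‖c t₁ - c t₀‖ := by linarith
    have e6 := mul_le_mul_of_nonneg_right e5 hR1.le
    nlinarith only [e6, e4, b2, hfar0, hR]
  by_contra! hpos
  have hz := hsm t ht hct
  have hzim : (b t / c t).im < P.im := by
    have := (Complex.abs_im_le_norm (b t / c t))
    have := (abs_le.1 this).2
    linarith
  have ht' := abs_le.1 ht
  have hfl : R * ‖c (τ - ε)‖ < ‖b (τ - ε)‖ :=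
    (S.far_of_near (s := τ - ε) (t := τ) (by linarith) (by linarith) (by linarith)
      (by linarith)).resolve_right (not_far_of_near hcτ hzτ)
  have hfr : R * ‖c (τ + ε)‖ < ‖b (τ + ε)‖ :=
    (S.far_of_near (s := τ) (t := τ + ε) (by linarith) (by linarith) (by linarith)
      (by linarith)).resolve_left (not_far_of_near hcτ hzτ)
  have hcr := m.defect_crossing him (t₁ := τ - ε) (tc := t) (t₂ := τ + ε) (by linarith)
    (by linarith) (by linarith)
    (fun s hs => S.strand_near hcτ hzτ hs.1 hs.2)
    (S.strand_antitoneOn hcτ hzτ le_rfl le_rfl) hct hfl hfr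
  have hjump : defect E (τ + ε) = defect E (τ - ε) + 2 * Real.pi := by
    rcases hcr with h | h
    · exact h.1
    · rcases h.2 with h | h <;> linarith
  obtain ⟨n₁, hn₁⟩ := exists_nat_ge ((τ - ε - t₀) / (ε / 2))
  obtain ⟨n₂, hn₂⟩ := exists_nat_ge ((t₁ - (τ + ε)) / (ε / 2))
  rw [div_le_iff₀ (by positivity)] at hn₁ hn₂
  have hm1 := m.defect_mono him n₁ le_rfl (by linarith) (by linarith) hfar0 hfl
  have hm2 := m.defect_mono him n₂ (by linarith) (by linarith) (by linarith) hfr hfar1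
  have a0 := abs_lt.1 (m.abs_arg_lt le_rfl hfar0)
  have a1 := abs_lt.1 (m.abs_arg_lt ht01 hfar1)
  have hd : |(L (T, t₁) - L (T, t₀)).im - (L (0, t₁) - L (0, t₀)).im| < Real.pi := by
    refine abs_im_sub_lt_pi (f := fun s => L (s, t₁) - L (s, t₀)) hT.le
      (Continuous.continuousOn (by fun_prop)) fun s hs => ?_
    simp only [Complex.exp_sub, hL' s hs t₁ ht01, hL' s hs t₀ le_rfl]
    have hne := S.det_ne_zero s t₀ (by linarith [hs.2])
    have e : (c s * b t₁ - b s * c t₁) / (c s * b t₀ - b s * c t₀) =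
        1 + (c s * (b t₁ - b t₀) - b s * (c t₁ - c t₀)) / (c s * b t₀ - b s * c t₀) := by
      field_simp
      ring
    have hn : ‖(c s * (b t₁ - b t₀) - b s * (c t₁ - c t₀)) / (c s * b t₀ - b s * c t₀)‖ < 1 := by
      rw [norm_div, div_lt_one (norm_pos_iff.2 hne)]
      have hm := hmD s hs
      have hk := hK s hs
      have := norm_sub_le (c s * (b t₁ - b t₀)) (b s * (c t₁ - c t₀))
      rw [norm_mul, norm_mul] at this
      have q1 : ‖b t₁ - b t₀‖ ≤ m₀ / (2 * (K + 1)) := (le_div_iff₀ hK1).2 b1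
      have q2 : ‖c t₁ - c t₀‖ ≤ m₀ / (2 * (K + 1)) := (le_div_iff₀ hK1).2 c1
      have q3 : m₀ / (2 * (K + 1)) * (2 * (K + 1)) = m₀ := by field_simp
      have q4 : 0 < m₀ / (2 * (K + 1)) := by positivity
      generalize m₀ / (2 * (K + 1)) = w at *
      have r1 := mul_le_mul_of_nonneg_left q1 (norm_nonneg (c s))
      have r2 := mul_le_mul_of_nonneg_left q2 (norm_nonneg (b s))
      have r3 := mul_le_mul_of_nonneg_right hk q4.le
      linarith
    have := (abs_lt.1 ((Complex.abs_re_le_norm _).trans_lt hn)).1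
    rw [e, Complex.add_re, Complex.one_re]
    linarith
  have hd' := (abs_lt.1 hd).2
  simp only [Complex.sub_im] at hd'
  simp only [defect, hE, Complex.sub_im] at hjump hm1 hm2 a0 a1
  linarith [a0.1, a0.2, a1.1, a1.2]

open ComplexConjugate in
theorem conjugate (S : StrandBox c b V r R δ κ κ' ε) :
    StrandBox (fun t => conj (c t)) (fun t => conj (b t)) (fun q => V (conj q)) r R δ κ κ' ε where
  continuous_c := Complex.continuous_conj.comp S.continuous_c
  continuous_b := Complex.continuous_conj.comp S.continuous_b
  c_zero := by simp [S.c_zero]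
  b_zero := by simp [S.b_zero]
  det_ne_zero s t h := by
    rw [← map_mul, ← map_mul, ← map_sub, Ne, map_eq_zero]
    exact S.det_ne_zero s t h
  level t h := by
    rw [Ne, map_eq_zero] at h
    simpa using S.level t h
  level_zero := by simpa using S.level_zero
  segment_le P h k hk := by
    simpa using S.segment_le _ h k hk
  mono q k hq hk := by
    simpa using S.mono (conj q) k (by simpa using hq) hk
  R_pos := S.R_pos
  R_le := S.R_le
  δ_pos := S.δ_pos
  δ_le := S.δ_le
  κ_pos := S.κ_pos
  κ'_pos := S.κ'_pos
  ε_pos := S.ε_pos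
  lt_of_le_δ q hq := S.lt_of_le_δ _ (by simpa using hq)
  le_of_le_R q hq := S.le_of_le_R _ (by simpa using hq)
  strand u h h1 h2 h3 := by
    simpa using S.strand u h (by simpa using h1) (by simpa using h2) h3
  decay u s t h1 h2 := by
    simpa using S.decay u s t (by simpa using h1) (by simpa using h2)
  equicontinuous η hη := by
    obtain ⟨ε', h, h'⟩ := S.equicontinuous η hη
    refine ⟨ε', h, fun u h h1 h2 h3 => ?_⟩
    have := h' u h (by simpa using h1) (by simpa using h2) h3
    rwa [← map_div₀, ← map_div₀, ← map_sub, RCLike.norm_conj]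

theorem im_ne_zero_of_crossing (S : StrandBox c b V r R δ κ κ' ε) {t : ℝ} (ht : 0 < t)
    (hct : ‖c t‖ = 1) (hz : ‖b t / c t‖ ≤ δ) : (b t / c t).im ≠ 0 := by
  intro h
  have hc : c t ≠ 0 := norm_pos_iff.1 (by rw [hct]; exact one_pos)
  have := S.eq_of_level_of_im_eq (hz.trans S.δ_le_r) (q := 0)
    (by simpa using S.δ_pos.le.trans S.δ_le_r) (by simpa [hct] using S.level t hc) S.level_zero
    (by simpa using h)
  exact div_ne_zero (S.b_ne_zero ht) hc this

/-- A motion of this kind cannot be recurrent, once a crossing above `0` exists. -/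
theorem false_of_recurrent_of_im_pos (S : StrandBox c b V r R δ κ κ' ε)
    (hrec : ∀ T₁ T₂ η N : ℝ, 0 < η → ∃ τ, N ≤ τ ∧ ∀ s ∈ ({0, T₁, T₂} : Set ℝ),
      ‖c (τ + s) - c s‖ ≤ η ∧ ‖b (τ + s) - b s‖ ≤ η)
    {T : ℝ} (hT : 0 < T) (hcT : ‖c T‖ = 1) (hzT : ‖b T / c T‖ ≤ δ) (him : 0 < (b T / c T).im) :
    False := by
  have hε := S.ε_pos
  obtain ⟨η₀, hη₀, hret⟩ := S.exists_near_return S.δ_pos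
  obtain ⟨η₁, hη₁, hside⟩ := S.crossing_side hT hcT hzT him
  obtain ⟨τ, hτ, hs⟩ := hrec (T + ε) 0 (min η₀ η₁) (T + 2 * ε) (lt_min hη₀ hη₁)
  have hs0 := hs 0 (by simp)
  have hs1 := hs (T + ε) (by simp)
  rw [add_zero, S.c_zero, S.b_zero, sub_zero] at hs0
  obtain ⟨-, ⟨t, ht, hct⟩, hz⟩ := hret τ (hs0.1.trans (min_le_left _ _))
    (hs0.2.trans (min_le_left _ _))
  have ht0 : 0 < t := by linarith [(abs_le.1 ht).1]
  have hneg : (b t / c t).im < 0 := lt_of_le_of_ne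
    (hside τ hτ (hs0.1.trans (min_le_right _ _)) (hs0.2.trans (min_le_right _ _))
      (hs1.1.trans (min_le_right _ _)) (hs1.2.trans (min_le_right _ _)) t ht hct)
    (S.im_ne_zero_of_crossing ht0 hct (hz t ht hct))
  obtain ⟨η₂, hη₂, hside'⟩ := S.conjugate.crossing_side ht0 (by simpa using hct)
    (by simpa using hz t ht hct) (by
      rw [← map_div₀, Complex.conj_im]; linarith)
  obtain ⟨τ', hτ', hs'⟩ := hrec (T + ε) (t + ε) (min (min η₀ η₁) η₂) (max (T + 2 * ε) (t + 2 * ε))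
    (lt_min (lt_min hη₀ hη₁) hη₂)
  have hs0' := hs' 0 (by simp)
  have hs1' := hs' (T + ε) (by simp)
  have hs2' := hs' (t + ε) (by simp)
  rw [add_zero, S.c_zero, S.b_zero, sub_zero] at hs0'
  have l0 : min (min η₀ η₁) η₂ ≤ η₀ := (min_le_left _ _).trans (min_le_left _ _)
  have l1 : min (min η₀ η₁) η₂ ≤ η₁ := (min_le_left _ _).trans (min_le_right _ _)
  have l2 : min (min η₀ η₁) η₂ ≤ η₂ := min_le_right _ _
  obtain ⟨-, ⟨t', ht', hct'⟩, hz'⟩ := hret τ' (hs0'.1.trans l0) (hs0'.2.trans l0)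
  have hτ1 := (le_max_left _ _).trans hτ'
  have hτ2 := (le_max_right _ _).trans hτ'
  have ht0' : 0 < t' := by linarith [(abs_le.1 ht').1]
  have u1 := hside τ' hτ1 (hs0'.1.trans l1) (hs0'.2.trans l1) (hs1'.1.trans l1) (hs1'.2.trans l1)
    t' ht' hct'
  have u2 := hside' τ' hτ2
    (by simpa [← map_sub, RCLike.norm_conj] using (by
      have : (starRingEnd ℂ) (c τ') - 1 = (starRingEnd ℂ) (c τ' - 1) := by simp
      rw [this, RCLike.norm_conj]; exact hs0'.1.trans l2 : ‖(starRingEnd ℂ) (c τ') - 1‖ ≤ η₂))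
    (by simpa using hs0'.2.trans l2)
    (by rw [← map_sub, RCLike.norm_conj]; exact hs2'.1.trans l2)
    (by rw [← map_sub, RCLike.norm_conj]; exact hs2'.2.trans l2) t' ht' (by simpa using hct')
  rw [← map_div₀, Complex.conj_im] at u2
  exact S.im_ne_zero_of_crossing ht0' hct' (hz' t' ht' hct') (by linarith)

theorem false_of_recurrent (S : StrandBox c b V r R δ κ κ' ε)
    (hrec : ∀ T₁ T₂ η N : ℝ, 0 < η → ∃ τ, N ≤ τ ∧ ∀ s ∈ ({0, T₁, T₂} : Set ℝ),
      ‖c (τ + s) - c s‖ ≤ η ∧ ‖b (τ + s) - b s‖ ≤ η) : False := by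
  have hε := S.ε_pos
  obtain ⟨η₀, hη₀, hret⟩ := S.exists_near_return S.δ_pos
  obtain ⟨τ, hτ, hs⟩ := hrec 0 0 η₀ (2 * ε) hη₀
  have hs0 := hs 0 (by simp)
  rw [add_zero, S.c_zero, S.b_zero, sub_zero] at hs0
  obtain ⟨-, ⟨t, ht, hct⟩, hz⟩ := hret τ hs0.1 hs0.2
  have ht0 : 0 < t := by linarith [(abs_le.1 ht).1]
  rcases lt_or_gt_of_ne (S.im_ne_zero_of_crossing ht0 hct (hz t ht hct)) with h | h
  · refine S.conjugate.false_of_recurrent_of_im_pos ?_ ht0 (by simpa using hct)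
      (by simpa using hz t ht hct) (by rw [← map_div₀, Complex.conj_im]; linarith)
    intro T₁ T₂ η N hη
    obtain ⟨τ, h1, h2⟩ := hrec T₁ T₂ η N hη
    refine ⟨τ, h1, fun s hs => ?_⟩
    rw [← map_sub, ← map_sub, RCLike.norm_conj, RCLike.norm_conj]
    exact h2 s hs
  · exact S.false_of_recurrent_of_im_pos hrec ht0 hct (hz t ht hct) h

end StrandBox

/-- The complex plane `ℂ²` with its Hermitian norm. -/
abbrev Plane := EuclideanSpace ℂ (Fin 2)

/-- A measurable family of convex weights on the whole line. -/
structure IsLaw {N : ℕ} (u : Fin N → ℝ → ℝ) : Prop where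
  measurable : ∀ i, Measurable (u i)
  nonneg : ∀ i s, 0 ≤ u i s
  sum_eq_one : ∀ s, ∑ i, u i s = 1

theorem IsLaw.le_one {N : ℕ} {u : Fin N → ℝ → ℝ} (hu : IsLaw u) (i : Fin N) (s : ℝ) :
    u i s ≤ 1 := by
  rw [← hu.sum_eq_one s]
  exact Finset.single_le_sum (f := fun i => u i s) (fun j _ => hu.nonneg j s) (Finset.mem_univ i)

theorem IsLaw.norm_le_one {N : ℕ} {u : Fin N → ℝ → ℝ} (hu : IsLaw u) (i : Fin N) (s : ℝ) :
    ‖u i s‖ ≤ 1 := by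
  rw [Real.norm_eq_abs, abs_of_nonneg (hu.nonneg i s)]
  exact hu.le_one i s

theorem IsLaw.intervalIntegrable {N : ℕ} {u : Fin N → ℝ → ℝ} (hu : IsLaw u) (i : Fin N) (a b : ℝ) :
    IntervalIntegrable (u i) volume a b := by
  refine (intervalIntegrable_const (c := (1 : ℝ))).mono_fun
    (hu.measurable i).aestronglyMeasurable (ae_of_all _ fun s => ?_)
  simpa using hu.norm_le_one i s

theorem IsLaw.comp {N : ℕ} {u : Fin N → ℝ → ℝ} (hu : IsLaw u) {f : ℝ → ℝ} (hf : Measurable f) :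
    IsLaw (fun i s => u i (f s)) :=
  ⟨fun i => (hu.measurable i).comp hf, fun i _ => hu.nonneg i _, fun _ => hu.sum_eq_one _⟩

theorem IsLaw.const {N : ℕ} {p : Fin N → ℝ} (h0 : ∀ i, 0 ≤ p i) (h1 : ∑ i, p i = 1) :
    IsLaw (fun i _ => p i) :=
  ⟨fun _ => measurable_const, fun i _ => h0 i, fun _ => h1⟩

theorem IsLaw.ite {N : ℕ} {u v : Fin N → ℝ → ℝ} (hu : IsLaw u) (hv : IsLaw v) (m : ℝ) :
    IsLaw (fun i s => if s ≤ m then u i s else v i s) := by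
  refine ⟨fun i => Measurable.ite measurableSet_Iic (hu.measurable i) (hv.measurable i),
    fun i s => ?_, fun s => ?_⟩
  · split_ifs
    exacts [hu.nonneg i s, hv.nonneg i s]
  · by_cases h : s ≤ m
    · simpa [h] using hu.sum_eq_one s
    · simpa [h] using hv.sum_eq_one s

theorem IsLaw.integral_nonneg {N : ℕ} {u : Fin N → ℝ → ℝ} (hu : IsLaw u) (i : Fin N) {s t : ℝ}
    (h : s ≤ t) : 0 ≤ ∫ r in s..t, u i r :=
  intervalIntegral.integral_nonneg h fun r _ => hu.nonneg i r

theorem IsLaw.sum_integral {N : ℕ} {u : Fin N → ℝ → ℝ} (hu : IsLaw u) (s t : ℝ) :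
    ∑ i, ∫ r in s..t, u i r = t - s := by
  rw [← intervalIntegral.integral_finsetSum fun i _ => hu.intervalIntegrable i s t]
  simp [hu.sum_eq_one]

/-- `x` is a solution on `[a, b]` of the switched system with law `u`. -/
structure IsArc {N : ℕ} (A : Fin N → Plane →L[ℂ] Plane) (u : Fin N → ℝ → ℝ) (x : ℝ → Plane)
    (a b : ℝ) : Prop where
  law : IsLaw u
  cont : ContinuousOn x (Set.Icc a b)
  eq : ∀ s ∈ Set.Icc a b, ∀ t ∈ Set.Icc a b, x t - x s = ∫ r in s..t, ∑ i, u i r • A i (x r)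

/-- A common bound for the modes. -/
noncomputable def modeBound {N : ℕ} (A : Fin N → Plane →L[ℂ] Plane) : ℝ := ∑ i, ‖A i‖

section Modes

variable {N : ℕ} {A : Fin N → Plane →L[ℂ] Plane} {u : Fin N → ℝ → ℝ} {x : ℝ → Plane} {a b : ℝ}

theorem modeBound_nonneg (A : Fin N → Plane →L[ℂ] Plane) : 0 ≤ modeBound A :=
  Finset.sum_nonneg fun _ _ => norm_nonneg _

theorem norm_le_modeBound (i : Fin N) : ‖A i‖ ≤ modeBound A :=
  Finset.single_le_sum (f := fun i => ‖A i‖) (fun _ _ => norm_nonneg _) (Finset.mem_univ i)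

theorem norm_apply_le_modeBound (i : Fin N) (v : Plane) : ‖A i v‖ ≤ modeBound A * ‖v‖ :=
  ((A i).le_opNorm v).trans (mul_le_mul_of_nonneg_right (norm_le_modeBound i) (norm_nonneg v))

theorem norm_smul_real (r : ℝ) (v : Plane) : ‖r • v‖ = |r| * ‖v‖ := by
  rw [norm_smul, Real.norm_eq_abs]

theorem norm_combination_le {p : Fin N → ℝ} (h0 : ∀ i, 0 ≤ p i) (v : Plane) :
    ‖∑ i, p i • A i v‖ ≤ (∑ i, p i) * (modeBound A * ‖v‖) := by
  refine (norm_sum_le _ _).trans ?_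
  rw [Finset.sum_mul]
  refine Finset.sum_le_sum fun i _ => ?_
  rw [norm_smul_real, abs_of_nonneg (h0 i)]
  exact mul_le_mul_of_nonneg_left (norm_apply_le_modeBound i v) (h0 i)

theorem IsLaw.norm_field_le (hu : IsLaw u) (r : ℝ) (v : Plane) :
    ‖∑ i, u i r • A i v‖ ≤ modeBound A * ‖v‖ := by
  have := norm_combination_le (A := A) (fun i => hu.nonneg i r) v
  rwa [hu.sum_eq_one, one_mul] at this

theorem IsLaw.field_intervalIntegrable (hu : IsLaw u) (hx : ContinuousOn x (Set.Icc a b))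
    {s t : ℝ} (hs : s ∈ Set.Icc a b) (ht : t ∈ Set.Icc a b) :
    IntervalIntegrable (fun r => ∑ i, u i r • A i (x r)) volume s t := by
  have hsub : Set.uIcc s t ⊆ Set.Icc a b := (Set.ordConnected_Icc).uIcc_subset hs ht
  have hx' := hx.mono hsub
  have hg : IntervalIntegrable (fun r => modeBound A * ‖x r‖) volume s t :=
    ContinuousOn.intervalIntegrable (continuousOn_const.mul hx'.norm)
  refine hg.mono_fun ?_ (ae_of_all _ fun r => ?_)
  · refine Finset.aestronglyMeasurable_fun_sum _ fun i _ => ?_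
    refine ((hu.measurable i).aestronglyMeasurable).smul ?_
    exact (((A i).continuous.comp_continuousOn hx').mono Set.uIoc_subset_uIcc).aestronglyMeasurable
      measurableSet_uIoc
  · dsimp only
    rw [Real.norm_eq_abs, abs_of_nonneg (mul_nonneg (modeBound_nonneg A) (norm_nonneg _))]
    exact hu.norm_field_le r _

theorem IsArc.mono (h : IsArc A u x a b) {a' b' : ℝ} (ha : a ≤ a') (hb : b' ≤ b) :
    IsArc A u x a' b' := by
  have hsub : Set.Icc a' b' ⊆ Set.Icc a b := Set.Icc_subset_Icc ha hb
  exact ⟨h.law, h.cont.mono hsub, fun s hs t ht => h.eq s (hsub hs) t (hsub ht)⟩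

theorem IsArc.exists_bound (h : IsArc A u x a b) : ∃ B, 0 ≤ B ∧ ∀ t ∈ Set.Icc a b, ‖x t‖ ≤ B := by
  obtain ⟨B, hB⟩ := isCompact_Icc.exists_bound_of_continuousOn h.cont
  exact ⟨max B 0, le_max_right _ _, fun t ht => (hB t ht).trans (le_max_left _ _)⟩

theorem IsArc.norm_sub_le (h : IsArc A u x a b) {B : ℝ} (hB : ∀ t ∈ Set.Icc a b, ‖x t‖ ≤ B)
    {s t : ℝ} (hs : s ∈ Set.Icc a b) (ht : t ∈ Set.Icc a b) :
    ‖x t - x s‖ ≤ modeBound A * B * |t - s| := by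
  have hsub : Set.uIcc s t ⊆ Set.Icc a b := (Set.ordConnected_Icc).uIcc_subset hs ht
  rw [h.eq s hs t ht]
  refine intervalIntegral.norm_integral_le_of_norm_le_const fun r hr => ?_
  exact (h.law.norm_field_le r _).trans
    (mul_le_mul_of_nonneg_left (hB r (hsub (Set.uIoc_subset_uIcc hr))) (modeBound_nonneg A))

theorem IsArc.norm_sub_sub_le (h : IsArc A u x a b) {B : ℝ} (hB : ∀ t ∈ Set.Icc a b, ‖x t‖ ≤ B)
    {s t : ℝ} (hs : s ∈ Set.Icc a b) (ht : t ∈ Set.Icc a b) :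
    ‖x t - x s - ∑ i, (∫ r in s..t, u i r) • A i (x s)‖ ≤
      modeBound A * (modeBound A * B) * |t - s| ^ 2 := by
  have hsub : Set.uIcc s t ⊆ Set.Icc a b := (Set.ordConnected_Icc).uIcc_subset hs ht
  have hconst : ContinuousOn (fun _ : ℝ => x s) (Set.Icc a b) := continuousOn_const
  have e : ∑ i, (∫ r in s..t, u i r) • A i (x s) = ∫ r in s..t, ∑ i, u i r • A i (x s) := by
    rw [intervalIntegral.integral_finsetSum]
    · simp only [intervalIntegral.integral_smul_const]
    · intro i _
      exact ⟨(h.law.intervalIntegrable i s t).1.smul_const _,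
        (h.law.intervalIntegrable i s t).2.smul_const _⟩
  rw [h.eq s hs t ht, e, ← intervalIntegral.integral_sub
    (h.law.field_intervalIntegrable h.cont hs ht) (h.law.field_intervalIntegrable hconst hs ht)]
  have hbd : ∀ r ∈ Set.uIoc s t, ‖∑ i, u i r • A i (x r) - ∑ i, u i r • A i (x s)‖ ≤
      modeBound A * (modeBound A * B) * |t - s| := by
    intro r hr
    have hr' := hsub (Set.uIoc_subset_uIcc hr)
    rw [← Finset.sum_sub_distrib]
    simp only [← smul_sub, ← map_sub]
    refine (h.law.norm_field_le r _).trans ?_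
    rw [mul_assoc (modeBound A)]
    refine mul_le_mul_of_nonneg_left ((h.norm_sub_le hB hs hr').trans ?_) (modeBound_nonneg A)
    have hB0 : 0 ≤ B := (norm_nonneg _).trans (hB s hs)
    refine mul_le_mul_of_nonneg_left ?_ (mul_nonneg (modeBound_nonneg A) hB0)
    exact Set.abs_sub_left_of_mem_uIcc (Set.uIoc_subset_uIcc hr)
  refine (intervalIntegral.norm_integral_le_of_norm_le_const hbd).trans (le_of_eq ?_)
  ring

theorem IsArc.congr (h : IsArc A u x a b) {v : Fin N → ℝ → ℝ} {y : ℝ → Plane} (hv : IsLaw v)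
    (huv : ∀ i, ∀ r ∈ Set.Ioc a b, v i r = u i r) (hxy : ∀ r ∈ Set.Icc a b, y r = x r) :
    IsArc A v y a b := by
  refine ⟨hv, h.cont.congr hxy, fun s hs t ht => ?_⟩
  rw [hxy s hs, hxy t ht, h.eq s hs t ht]
  refine intervalIntegral.integral_congr_ae (ae_of_all _ fun r hr => ?_)
  have hr' : r ∈ Set.Ioc a b := by
    rw [Set.mem_uIoc] at hr
    rcases hr with hr | hr
    · exact ⟨hs.1.trans_lt hr.1, hr.2.trans ht.2⟩
    · exact ⟨ht.1.trans_lt hr.1, hr.2.trans hs.2⟩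
  refine Finset.sum_congr rfl fun i _ => ?_
  rw [huv i r hr', hxy r ⟨hr'.1.le, hr'.2⟩]

theorem IsArc.union {m : ℝ} (h1 : IsArc A u x a m) (h2 : IsArc A u x m b) (ham : a ≤ m)
    (hmb : m ≤ b) : IsArc A u x a b := by
  have hcont : ContinuousOn x (Set.Icc a b) := by
    rw [← Set.Icc_union_Icc_eq_Icc ham hmb]
    exact h1.cont.union_of_isClosed h2.cont isClosed_Icc isClosed_Icc
  have hmm : m ∈ Set.Icc a b := ⟨ham, hmb⟩
  have key : ∀ t ∈ Set.Icc a b, x t - x m = ∫ r in m..t, ∑ i, u i r • A i (x r) := by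
    intro t ht
    rcases le_total t m with htm | htm
    · exact h1.eq m ⟨ham, le_rfl⟩ t ⟨ht.1, htm⟩
    · exact h2.eq m ⟨le_rfl, hmb⟩ t ⟨htm, ht.2⟩
  refine ⟨h1.law, hcont, fun s hs t ht => ?_⟩
  rw [← intervalIntegral.integral_interval_sub_left (a := m)
    (h1.law.field_intervalIntegrable hcont hmm ht) (h1.law.field_intervalIntegrable hcont hmm hs),
    ← key t ht, ← key s hs]
  abel

theorem IsArc.concat {v : Fin N → ℝ → ℝ} {y : ℝ → Plane} {m : ℝ} (h1 : IsArc A u x a m)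
    (h2 : IsArc A v y m b) (hxy : x m = y m) (ham : a ≤ m) (hmb : m ≤ b) :
    IsArc A (fun i s => if s ≤ m then u i s else v i s) (fun s => if s ≤ m then x s else y s)
      a b := by
  have hl := h1.law.ite h2.law m
  refine IsArc.union (m := m) (h1.congr hl ?_ ?_) (h2.congr hl ?_ ?_) ham hmb
  · intro i r hr
    simp [hr.2]
  · intro r hr
    simp [hr.2]
  · intro i r hr
    simp [hr.1]
  · intro r hr
    rcases hr.1.eq_or_lt with h | h
    · simp [← h, hxy]
    · simp [h]

theorem IsArc.shift (h : IsArc A u x a b) (τ : ℝ) :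
    IsArc A (fun i s => u i (s + τ)) (fun s => x (s + τ)) (a - τ) (b - τ) := by
  have hm : ∀ s ∈ Set.Icc (a - τ) (b - τ), s + τ ∈ Set.Icc a b := fun s hs =>
    ⟨by linarith [hs.1], by linarith [hs.2]⟩
  refine ⟨h.law.comp (measurable_id.add_const τ),
    h.cont.comp (by fun_prop) fun s hs => hm s hs, fun s hs t ht => ?_⟩
  rw [h.eq _ (hm s hs) _ (hm t ht), intervalIntegral.integral_comp_add_right
    (fun r => ∑ i, u i r • A i (x r))]

theorem IsArc.const_smul (h : IsArc A u x a b) (k : ℂ) : IsArc A u (fun s => k • x s) a b := by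
  refine ⟨h.law, h.cont.const_smul k, fun s hs t ht => ?_⟩
  rw [← smul_sub, h.eq s hs t ht, ← intervalIntegral.integral_smul]
  congr 1
  ext1 r
  rw [Finset.smul_sum]
  refine Finset.sum_congr rfl fun i _ => ?_
  rw [map_smul, smul_comm]

theorem isArc_of_hasDerivAt {p : Fin N → ℝ} (h0 : ∀ i, 0 ≤ p i) (h1 : ∑ i, p i = 1)
    (hx : ∀ t, HasDerivAt x (∑ i, p i • A i (x t)) t) (a b : ℝ) :
    IsArc A (fun i _ => p i) x a b := by
  have hc : Continuous x := continuous_iff_continuousAt.2 fun t => (hx t).continuousAt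
  refine ⟨IsLaw.const h0 h1, hc.continuousOn, fun s _ t _ => ?_⟩
  rw [intervalIntegral.integral_eq_sub_of_hasDerivAt (fun r _ => hx r)]
  exact Continuous.intervalIntegrable (by fun_prop) _ _

/-- The trajectory of a single mode. -/
theorem isArc_exp (i : Fin N) (v : Plane) (a b : ℝ) :
    IsArc A (fun j _ => if j = i then 1 else 0)
      (fun t => NormedSpace.exp (t • A i) v) a b := by
  refine isArc_of_hasDerivAt (fun j => by split_ifs <;> norm_num) (by simp) (fun t => ?_) a b
  have h := hasDerivAt_exp_smul_const' (𝕂 := ℝ) (A i) t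
  have h3 := ((ContinuousLinearMap.apply ℂ Plane v).restrictScalars ℝ).hasFDerivAt.comp_hasDerivAt
    t h
  have e : ∑ j, (if j = i then (1 : ℝ) else 0) • A j (NormedSpace.exp (t • A i) v) =
      A i (NormedSpace.exp (t • A i) v) := by
    simp [ite_smul]
  rw [e]
  exact h3

end Modes

section Growth

variable {N : ℕ} {A : Fin N → Plane →L[ℂ] Plane} {u : Fin N → ℝ → ℝ} {x : ℝ → Plane} {a b : ℝ}

theorem Seminorm.map_real_smul (w : Seminorm ℂ Plane) (r : ℝ) (v : Plane) :
    w (r • v) = |r| * w v := by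
  have h := map_smul_eq_mul w (r : ℂ) v
  rw [Complex.norm_real, Real.norm_eq_abs] at h
  rw [← h]
  congr 1

theorem Seminorm.combination_le (w : Seminorm ℂ Plane) {p : Fin N → ℝ} (h0 : ∀ i, 0 ≤ p i)
    (f : Fin N → Plane) : w (∑ i, p i • f i) ≤ ∑ i, p i * w (f i) := by
  refine (Finset.le_sum_of_subadditive w (map_zero w).le (map_add_le_add w) _ _).trans (le_of_eq ?_)
  refine Finset.sum_congr rfl fun i _ => ?_
  rw [w.map_real_smul, abs_of_nonneg (h0 i)]

/-- A seminorm growing at infinitesimal rate `μ` along every mode grows at rate `μ` along every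
trajectory. -/
theorem IsArc.seminorm_le (h : IsArc A u x a b) (hab : a ≤ b) (w : Seminorm ℂ Plane) {C : ℝ}
    (hC : ∀ v, w v ≤ C * ‖v‖) {μ K k₀ : ℝ} (hk₀ : 0 < k₀)
    (hw : ∀ t ∈ Set.Ico a b, ∀ i, ∀ k ∈ Set.Ioc 0 k₀,
      w (x t + k • A i (x t)) ≤ (1 + μ * k) * w (x t) + K * k ^ 2) :
    w (x b) ≤ Real.exp (μ * (b - a)) * w (x a) := by
  obtain ⟨B, hB0, hB⟩ := h.exists_bound
  have hC' : ∀ v, w v ≤ |C| * ‖v‖ := fun v =>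
    (hC v).trans (mul_le_mul_of_nonneg_right (le_abs_self C) (norm_nonneg v))
  have hcont : ContinuousOn (fun t => w (x t)) (Set.Icc a b) := by
    have hwc : Continuous w := by
      refine continuous_iff_continuousAt.2 fun v => ?_
      have hlim : Tendsto (fun y => |C| * ‖y - v‖) (𝓝 v) (𝓝 0) := by
        have : ContinuousAt (fun y : Plane => |C| * ‖y - v‖) v := by fun_prop
        simpa [ContinuousAt] using this
      refine tendsto_iff_norm_sub_tendsto_zero.2 (squeeze_zero (fun _ => norm_nonneg _)
        (fun y => ?_) hlim)
      exact (w.norm_sub_map_le_sub y v).trans (hC' _)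
    exact hwc.comp_continuousOn h.cont
  have key := le_gronwallBound_of_liminf_deriv_right_le (f := fun t => w (x t))
    (f' := fun t => μ * w (x t)) (δ := w (x a)) (K := μ) (ε := 0) (a := a) (b := b) hcont ?_ le_rfl
    (fun t _ => by simp) b ⟨hab, le_rfl⟩
  · rw [gronwallBound_ε0, mul_comm] at key
    exact key
  intro t ht r hr
  set D : ℝ := modeBound A * (modeBound A * B)
  refine Eventually.frequently ?_
  have hsmall : ∀ᶠ z in 𝓝[>] t, (K + |C| * D) * (z - t) < r - μ * w (x t) := by
    have : ContinuousAt (fun z => (K + |C| * D) * (z - t)) t := by fun_prop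
    refine (this.mono_left nhdsWithin_le_nhds).eventually_lt_const ?_
    simpa using hr
  have hz1 : ∀ᶠ z in 𝓝[>] t, z < b := nhdsWithin_le_nhds (eventually_lt_nhds ht.2)
  have hz2 : ∀ᶠ z in 𝓝[>] t, z < t + k₀ := nhdsWithin_le_nhds (eventually_lt_nhds (by linarith))
  filter_upwards [hsmall, hz1, hz2, self_mem_nhdsWithin] with z h1 h2 h3 h4
  have hzt : 0 < z - t := sub_pos.2 h4
  have htm : t ∈ Set.Icc a b := ⟨ht.1, ht.2.le⟩
  have hzm : z ∈ Set.Icc a b := ⟨ht.1.trans (le_of_lt h4), h2.le⟩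
  have hest := h.norm_sub_sub_le hB htm hzm
  set p : Fin N → ℝ := fun i => (∫ s in t..z, u i s) / (z - t) with hp
  have hp0 : ∀ i, 0 ≤ p i := fun i => div_nonneg (h.law.integral_nonneg i (le_of_lt h4)) hzt.le
  have hp1 : ∑ i, p i = 1 := by
    rw [hp, ← Finset.sum_div, h.law.sum_integral, div_self hzt.ne']
  have hsum : x t + ∑ i, (∫ s in t..z, u i s) • A i (x t) =
      ∑ i, p i • (x t + (z - t) • A i (x t)) := by
    simp only [smul_add, Finset.sum_add_distrib, ← Finset.sum_smul, hp1, one_smul, smul_smul]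
    congr 1
    refine Finset.sum_congr rfl fun i _ => ?_
    rw [hp]
    simp only
    rw [div_mul_cancel₀ _ hzt.ne']
  have hmain : w (∑ i, p i • (x t + (z - t) • A i (x t))) ≤
      (1 + μ * (z - t)) * w (x t) + K * (z - t) ^ 2 := by
    refine (w.combination_le hp0 _).trans ?_
    calc ∑ i, p i * w (x t + (z - t) • A i (x t))
        ≤ ∑ i, p i * ((1 + μ * (z - t)) * w (x t) + K * (z - t) ^ 2) :=
          Finset.sum_le_sum fun i _ => mul_le_mul_of_nonneg_left
            (hw t ht i (z - t) ⟨hzt, by linarith⟩) (hp0 i)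
      _ = _ := by rw [← Finset.sum_mul, hp1, one_mul]
  have hrest : w (x z) ≤ w (∑ i, p i • (x t + (z - t) • A i (x t))) + |C| * (D * (z - t) ^ 2) := by
    have e : x z = (∑ i, p i • (x t + (z - t) • A i (x t))) +
        (x z - x t - ∑ i, (∫ s in t..z, u i s) • A i (x t)) := by
      rw [← hsum]
      abel
    calc w (x z) ≤ w (∑ i, p i • (x t + (z - t) • A i (x t))) +
        w (x z - x t - ∑ i, (∫ s in t..z, u i s) • A i (x t)) := by
          conv_lhs => rw [e]
          exact map_add_le_add w _ _
      _ ≤ _ := by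
          refine add_le_add le_rfl ((hC' _).trans (mul_le_mul_of_nonneg_left ?_ (abs_nonneg C)))
          rwa [sq_abs] at hest
  rw [inv_mul_lt_iff₀ hzt]
  nlinarith

theorem IsArc.norm_le (h : IsArc A u x a b) (hab : a ≤ b) :
    ‖x b‖ ≤ Real.exp (modeBound A * (b - a)) * ‖x a‖ := by
  refine h.seminorm_le hab (normSeminorm ℂ Plane) (C := 1) (fun v => by simp) (K := 0) one_pos ?_
  intro t _ i k hk
  rw [coe_normSeminorm, zero_mul, add_zero]
  refine (norm_add_le _ _).trans ?_
  rw [norm_smul_real, abs_of_pos hk.1]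
  nlinarith [norm_apply_le_modeBound (A := A) i (x t), hk.1]

theorem exp_zero_smul_apply (i : Fin N) (v : Plane) :
    NormedSpace.exp ((0 : ℝ) • A i) v = v := by
  rw [zero_smul ℝ (A i), NormedSpace.exp_zero]
  rfl

theorem norm_exp_smul_apply_le (i : Fin N) {k : ℝ} (hk : 0 ≤ k) (v : Plane) :
    ‖NormedSpace.exp (k • A i) v‖ ≤ Real.exp (modeBound A * k) * ‖v‖ := by
  have h := (isArc_exp (A := A) i v 0 k).norm_le hk
  rwa [exp_zero_smul_apply, sub_zero] at h

theorem norm_exp_smul_sub_sub_le (i : Fin N) {k : ℝ} (hk : k ∈ Set.Icc (0 : ℝ) 1) (v : Plane) :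
    ‖NormedSpace.exp (k • A i) v - v - k • A i v‖ ≤
      modeBound A * (modeBound A * (Real.exp (modeBound A) * ‖v‖)) * k ^ 2 := by
  have h := isArc_exp (A := A) i v 0 k
  have hB : ∀ t ∈ Set.Icc (0 : ℝ) k, ‖NormedSpace.exp (t • A i) v‖ ≤
      Real.exp (modeBound A) * ‖v‖ := by
    intro t ht
    refine (norm_exp_smul_apply_le i ht.1 v).trans ?_
    refine mul_le_mul_of_nonneg_right (Real.exp_le_exp.2 ?_) (norm_nonneg v)
    exact mul_le_of_le_one_right (modeBound_nonneg A) (ht.2.trans hk.2)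
  have := h.norm_sub_sub_le hB ⟨le_rfl, hk.1⟩ ⟨hk.1, le_rfl⟩
  rw [exp_zero_smul_apply] at this
  simpa [ite_smul, apply_ite] using this

/-- A seminorm growing at rate `μ` along the flow of every mode grows at rate `μ` along every
trajectory. -/
theorem IsArc.seminorm_le_of_exp (h : IsArc A u x a b) (hab : a ≤ b) (w : Seminorm ℂ Plane) {C : ℝ}
    (hC : ∀ v, w v ≤ C * ‖v‖) {μ : ℝ}
    (hw : ∀ i, ∀ k : ℝ, 0 ≤ k → ∀ v, w (NormedSpace.exp (k • A i) v) ≤ Real.exp (μ * k) * w v) :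
    w (x b) ≤ Real.exp (μ * (b - a)) * w (x a) := by
  obtain ⟨B, hB0, hB⟩ := h.exists_bound
  have hC' : ∀ v, w v ≤ |C| * ‖v‖ := fun v =>
    (hC v).trans (mul_le_mul_of_nonneg_right (le_abs_self C) (norm_nonneg v))
  have hk₀ : 0 < 1 / (1 + |μ|) := by positivity
  refine h.seminorm_le hab w hC hk₀ (μ := μ) (K := μ ^ 2 * (|C| * B) +
    |C| * (modeBound A * (modeBound A * (Real.exp (modeBound A) * B)))) ?_
  intro t ht i k hk
  have hkμ : k * (1 + |μ|) ≤ 1 := by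
    have := hk.2
    rwa [le_div_iff₀ (by positivity)] at this
  have hμ0 := abs_nonneg μ
  have hk1 : k ≤ 1 := by nlinarith [hk.1]
  have hμk : |μ * k| ≤ 1 := by
    rw [abs_mul, abs_of_pos hk.1]
    nlinarith [hk.1]
  have hexp : Real.exp (μ * k) ≤ 1 + μ * k + (μ * k) ^ 2 := by
    have := (abs_le.1 (Real.abs_exp_sub_one_sub_id_le hμk)).2
    linarith
  have hx := hB t ⟨ht.1, ht.2.le⟩
  have hwx : w (x t) ≤ |C| * B := (hC' _).trans (mul_le_mul_of_nonneg_left hx (abs_nonneg C))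
  have hest := norm_exp_smul_sub_sub_le (A := A) i ⟨hk.1.le, hk1⟩ (x t)
  have hM := modeBound_nonneg A
  have hest' : ‖NormedSpace.exp (k • A i) (x t) - x t - k • A i (x t)‖ ≤
      modeBound A * (modeBound A * (Real.exp (modeBound A) * B)) * k ^ 2 := by
    refine hest.trans ?_
    gcongr
  have e : x t + k • A i (x t) = NormedSpace.exp (k • A i) (x t) -
      (NormedSpace.exp (k • A i) (x t) - x t - k • A i (x t)) := by abel
  calc w (x t + k • A i (x t)) ≤ w (NormedSpace.exp (k • A i) (x t)) +
        w (NormedSpace.exp (k • A i) (x t) - x t - k • A i (x t)) := by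
        conv_lhs => rw [e]
        exact map_sub_le_add w _ _
    _ ≤ Real.exp (μ * k) * w (x t) + |C| *
        (modeBound A * (modeBound A * (Real.exp (modeBound A) * B)) * k ^ 2) :=
        add_le_add (hw i k hk.1.le _) ((hC' _).trans
          (mul_le_mul_of_nonneg_left hest' (abs_nonneg C)))
    _ ≤ (1 + μ * k + (μ * k) ^ 2) * w (x t) + |C| *
        (modeBound A * (modeBound A * (Real.exp (modeBound A) * B)) * k ^ 2) := by
        gcongr
    _ ≤ _ := by nlinarith [mul_le_mul_of_nonneg_left hwx (sq_nonneg (μ * k))]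

end Growth

/-- Every constant or periodic trajectory tends to zero. -/
def IsPAS {N : ℕ} (A : Fin N → Plane →L[ℂ] Plane) : Prop :=
  ∀ (u : Fin N → ℝ → ℝ) (x : ℝ≥0 → Plane), IsCLinTrajectoryWith A u x →
    (IsConstantLaw u ∨ IsPeriodicLaw u) → Tendsto x atTop (𝓝 0)

section Trajectories

variable {N : ℕ} {A : Fin N → Plane →L[ℂ] Plane} {u : Fin N → ℝ → ℝ}

theorem IsLaw.isSwitchingLaw (hu : IsLaw u) : IsSwitchingLaw u :=
  ⟨hu.measurable, ae_of_all _ fun s => ⟨fun i => ⟨hu.nonneg i s, hu.le_one i s⟩, hu.sum_eq_one s⟩⟩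

theorem isCLinTrajectoryWith_of_isArc {x : ℝ → Plane} (h : ∀ T, 0 ≤ T → IsArc A u x 0 T) :
    IsCLinTrajectoryWith A u fun t => x t := by
  refine ⟨?_, (h 0 le_rfl).law.isSwitchingLaw, fun t => ?_⟩
  · have hc : ContinuousOn x (Set.Ici 0) := by
      intro t ht
      have h1 := (h (t + 1) (add_nonneg ht zero_le_one)).cont t ⟨ht, by linarith⟩
      refine h1.mono_of_mem_nhdsWithin ?_
      rw [← Set.Ici_inter_Iic]
      exact inter_mem self_mem_nhdsWithin (nhdsWithin_le_nhds (Iic_mem_nhds (by linarith)))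
    exact hc.comp_continuous NNReal.continuous_coe fun t => t.2
  · have ht : (0 : ℝ) ≤ t := t.2
    have h1 := (h t ht).eq 0 ⟨le_rfl, ht⟩ t ⟨ht, le_rfl⟩
    rw [intervalIntegral.integral_of_le ht, sub_eq_iff_eq_add'] at h1
    simp only [NNReal.coe_zero]
    rw [h1]
    congr 1
    refine setIntegral_congr_fun measurableSet_Ioc fun s hs => ?_
    simp only [Real.coe_toNNReal s hs.1.le]

theorem IsCLinTrajectoryWith.exists_isArc {x : ℝ≥0 → Plane} (h : IsCLinTrajectoryWith A u x) :
    ∃ v, ∀ T, 0 ≤ T → IsArc A v (fun s => x s.toNNReal) 0 T := by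
  classical
  obtain ⟨hx, ⟨hm, hae⟩, heq⟩ := h
  have hne : Nonempty (Fin N) := by
    have : (ae (volume.restrict (Set.Ici (0 : ℝ)))).NeBot := by
      rw [ae_neBot, Ne, Measure.restrict_eq_zero]
      simp
    obtain ⟨s, -, hs⟩ := hae.exists
    by_contra hemp
    rw [not_nonempty_iff] at hemp
    simp at hs
  obtain ⟨j⟩ := hne
  set G : Set ℝ := {s | (∀ i, u i s ∈ Set.Icc (0 : ℝ) 1) ∧ ∑ i, u i s = 1} with hG
  have hGm : MeasurableSet G := by
    have e : G = (⋂ i, u i ⁻¹' Set.Icc 0 1) ∩ (fun s => ∑ i, u i s) ⁻¹' {1} := by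
      ext s
      simp [hG]
    rw [e]
    refine (MeasurableSet.iInter fun i => hm i measurableSet_Icc).inter ?_
    exact (Finset.measurable_fun_sum _ fun i _ => hm i) (measurableSet_singleton 1)
  set v : Fin N → ℝ → ℝ := fun i s => if s ∈ G then u i s else (if i = j then 1 else 0) with hv
  have hlaw : IsLaw v := by
    refine ⟨fun i => Measurable.ite hGm (hm i) measurable_const, fun i s => ?_, fun s => ?_⟩
    · simp only [hv]
      by_cases hs : s ∈ G
      · rw [if_pos hs]
        exact (hs.1 i).1
      · rw [if_neg hs]
        split_ifs <;> norm_num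
    · simp only [hv]
      by_cases hs : s ∈ G
      · simp only [if_pos hs]
        exact hs.2
      · simp [if_neg hs]
  have hcont : Continuous fun s : ℝ => x s.toNNReal := hx.comp continuous_real_toNNReal
  refine ⟨v, fun T hT => ⟨hlaw, hcont.continuousOn, ?_⟩⟩
  have key : ∀ t, 0 ≤ t → x t.toNNReal - x 0 = ∫ r in (0 : ℝ)..t, ∑ i, v i r • A i (x r.toNNReal) := by
    intro t ht
    rw [heq, add_sub_cancel_left, Real.coe_toNNReal t ht, intervalIntegral.integral_of_le ht]
    refine setIntegral_congr_ae measurableSet_Ioc ?_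
    rw [ae_restrict_iff' measurableSet_Ici] at hae
    filter_upwards [hae] with s hs hst
    have hsG : s ∈ G := hs hst.1.le
    simp only [hv, if_pos hsG]
  intro s hs t ht
  have hc0 : (0 : ℝ) ∈ Set.Icc 0 T := ⟨le_rfl, hT⟩
  rw [← intervalIntegral.integral_interval_sub_left (a := 0)
    (hlaw.field_intervalIntegrable hcont.continuousOn hc0 ht)
    (hlaw.field_intervalIntegrable hcont.continuousOn hc0 hs), ← key t ht.1, ← key s hs.1]
  abel

theorem ceil_div_eq {T s : ℝ} (hT : 0 < T) {n : ℤ} (h : s ∈ Set.Ioc (n * T) ((n + 1) * T)) :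
    ⌈s / T⌉ = n + 1 := by
  rw [Int.ceil_eq_iff, lt_div_iff₀ hT, div_le_iff₀ hT]
  push_cast
  exact ⟨by linarith [h.1], h.2⟩

/-- A periodically stable system has no trajectory multiplied by `k`, `1 ≤ ‖k‖`, after
some time. -/
theorem IsPAS.eq_zero_of_multiplier (hP : IsPAS A) {x : ℝ → Plane} {T : ℝ} (hT : 0 < T)
    (h : IsArc A u x 0 T) {k : ℂ} (hk : 1 ≤ ‖k‖) (hxT : x T = k • x 0) : x 0 = 0 := by
  have hk0 : k ≠ 0 := by
    rintro rfl
    simp at hk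
    linarith
  set f : ℝ → ℝ := fun s => s - (⌈s / T⌉ - 1 : ℤ) * T with hf
  have hfm : Measurable f := by
    have h1 : Measurable fun s : ℝ => (⌈s / T⌉ : ℤ) :=
      Int.measurable_ceil.comp (measurable_id.div_const T)
    have h2 : Measurable fun s : ℝ => ((⌈s / T⌉ - 1 : ℤ) : ℝ) :=
      (measurable_from_top (f := fun n : ℤ => ((n - 1 : ℤ) : ℝ))).comp h1
    exact measurable_id.sub (h2.mul_const T)
  set v : Fin N → ℝ → ℝ := fun i s => u i (f s) with hv
  have hvlaw : IsLaw v := h.law.comp hfm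
  set y : ℝ → Plane := fun s => k ^ (⌈s / T⌉ - 1) • x (f s) with hy
  have hyn : ∀ n : ℕ, y (n * T) = k ^ n • x 0 := by
    intro n
    have hc : ⌈(n * T : ℝ) / T⌉ = n := by
      rw [mul_div_cancel_right₀ _ hT.ne']
      simp
    simp only [hy, hf, hc]
    have e : (n * T : ℝ) - ((n - 1 : ℤ) : ℝ) * T = T := by
      push_cast
      ring
    rw [e, hxT, smul_smul, ← zpow_add_one₀ hk0]
    simp
  have hstep : ∀ n : ℕ, IsArc A v y (n * T) ((n + 1) * T) := by
    intro n
    have h1 := (h.const_smul (k ^ n)).shift (-(n * T))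
    have e1 : (0 : ℝ) - -(n * T) = n * T := by ring
    have e2 : T - -(n * T) = (n + 1) * T := by ring
    rw [e1, e2] at h1
    have hcr : ∀ r ∈ Set.Ioc (n * T : ℝ) ((n + 1) * T), ⌈r / T⌉ - 1 = (n : ℤ) := by
      intro r hr
      rw [ceil_div_eq hT (n := n) (by simpa using hr)]
      ring
    refine h1.congr hvlaw (fun i r hr => ?_) (fun r hr => ?_)
    · simp only [hv, hf, hcr r hr]
      simp [sub_eq_add_neg]
    · rcases hr.1.eq_or_lt with hr1 | hr1
      · rw [← hr1, hyn n]
        simp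
      · simp only [hy, hf, hcr r ⟨hr1, hr.2⟩]
        simp [sub_eq_add_neg]
  have harc : ∀ n : ℕ, IsArc A v y 0 (n * T) := by
    intro n
    induction n with
    | zero => exact (hstep 0).mono (by simp) (by simp [hT.le])
    | succ n ih =>
      push_cast
      exact ih.union (hstep n) (by positivity) (by nlinarith)
  have htraj : IsCLinTrajectoryWith A v fun t => y t := by
    refine isCLinTrajectoryWith_of_isArc fun t _ => ?_
    obtain ⟨n, hn⟩ := exists_nat_ge (t / T)
    exact (harc n).mono le_rfl ((div_le_iff₀ hT).1 hn)
  have hper : IsPeriodicLaw v := by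
    refine ⟨T, hT, fun i => ae_of_all _ fun s => ?_⟩
    have hc : ⌈(s + T) / T⌉ = ⌈s / T⌉ + 1 := by
      rw [add_div, div_self hT.ne', Int.ceil_add_one]
    simp only [hv, hf, hc]
    congr 1
    push_cast
    ring
  have hlim := (hP v _ htraj (Or.inr hper)).norm
  have hseq : Tendsto (fun n : ℕ => (n * T.toNNReal : ℝ≥0)) atTop atTop :=
    tendsto_natCast_atTop_atTop.atTop_mul_const (by simpa using hT)
  have hlim2 := hlim.comp hseq
  rw [norm_zero] at hlim2
  have hge : ‖x 0‖ ≤ 0 := by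
    refine ge_of_tendsto' hlim2 fun n => ?_
    simp only [Function.comp_apply, NNReal.coe_mul, NNReal.coe_natCast, Real.coe_toNNReal T hT.le]
    rw [hyn, norm_smul, norm_pow]
    exact le_mul_of_one_le_left (norm_nonneg _) (one_le_pow₀ hk)
  exact norm_le_zero_iff.1 hge

/-- Convex combinations of the modes of a periodically stable system are Hurwitz. -/
theorem IsPAS.re_eigenvalue_neg (hP : IsPAS A) {p : Fin N → ℝ} (h0 : ∀ i, 0 ≤ p i)
    (h1 : ∑ i, p i = 1) {v : Plane} (hv : v ≠ 0) {μ : ℂ} (h : ∑ i, p i • A i v = μ • v) :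
    μ.re < 0 := by
  by_contra! hμ
  have hd : ∀ t : ℝ, HasDerivAt (fun t : ℝ => Complex.exp (μ * t) • v)
      (∑ i, p i • A i (Complex.exp (μ * t) • v)) t := by
    intro t
    have e : ∑ i, p i • A i (Complex.exp (μ * t) • v) = (Complex.exp (μ * t) * μ) • v := by
      rw [mul_smul, ← h, Finset.smul_sum]
      refine Finset.sum_congr rfl fun i _ => ?_
      rw [map_smul, smul_comm]
    rw [e]
    have h2 : HasDerivAt (fun t : ℝ => μ * (t : ℂ)) μ t := by
      simpa using (Complex.ofRealCLM.hasDerivAt (x := t)).const_mul μ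
    exact h2.cexp.smul_const v
  have harc := isArc_of_hasDerivAt h0 h1 hd 0 1
  have := hP.eq_zero_of_multiplier one_pos harc (k := Complex.exp μ)
    (by rw [Complex.norm_exp]; exact Real.one_le_exp hμ) (by simp)
  simp at this
  exact hv this

end Trajectories

theorem Ultrafilter.exists_tendsto_of_mem_isCompact {ι X : Type*} [TopologicalSpace X]
    (F : Ultrafilter ι) {K : Set X} (hK : IsCompact K) {f : ι → X} (hf : ∀ᶠ k in F, f k ∈ K) :
    ∃ z ∈ K, Tendsto f F (𝓝 z) :=
  hK.ultrafilter_le_nhds (F.map f) (le_principal_iff.2 hf)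

theorem hasDerivAt_zero_of_norm_sub_le {f : ℝ → Plane} {s C : ℝ}
    (h : ∀ t ∈ Set.Icc (s - 1) (s + 1), ‖f t - f s‖ ≤ C * |t - s| ^ 2) : HasDerivAt f 0 s := by
  rw [hasDerivAt_iff_isLittleO]
  simp only [smul_zero, sub_zero]
  refine Asymptotics.IsBigO.trans_isLittleO (g := fun t => ‖t - s‖ ^ 2) ?_
    (Asymptotics.isLittleO_pow_sub_sub s one_lt_two)
  refine Asymptotics.IsBigO.of_bound C ?_
  filter_upwards [Icc_mem_nhds (sub_one_lt s) (lt_add_one s)] with t ht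
  simpa using h t ht

section Compactness

variable {N : ℕ} {A : Fin N → Plane →L[ℂ] Plane}

/-- A function whose increments are governed, up to a quadratic error, by monotone functions with
total increment equal to the increment of time, is a trajectory. -/
theorem exists_isArc_of_increments (hN : Nonempty (Fin N)) {U : Fin N → ℝ → ℝ} {y : ℝ → Plane}
    (hmono : ∀ i, Monotone (U i)) (hsum : ∀ s t, ∑ i, (U i t - U i s) = t - s)
    (hlip : ∀ a b, ∃ L, 0 ≤ L ∧ ∀ s ∈ Set.Icc a b, ∀ t ∈ Set.Icc a b, ‖y t - y s‖ ≤ L * |t - s|)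
    (hest : ∀ a b, ∃ C, ∀ s ∈ Set.Icc a b, ∀ t ∈ Set.Icc a b,
      ‖y t - y s - ∑ i, (U i t - U i s) • A i (y s)‖ ≤ C * |t - s| ^ 2) :
    ∃ v, ∀ a b, IsArc A v y a b := by
  classical
  obtain ⟨j⟩ := hN
  have hU1 : ∀ i, ∀ s t, s ≤ t → U i t - U i s ≤ t - s := by
    intro i s t hst
    rw [← hsum s t]
    exact Finset.single_le_sum (f := fun i => U i t - U i s)
      (fun k _ => sub_nonneg.2 (hmono k hst)) (Finset.mem_univ i)
  have hUlip : ∀ i, LipschitzWith 1 (U i) := by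
    intro i
    refine LipschitzWith.of_dist_le_mul fun s t => ?_
    rw [NNReal.coe_one, one_mul, Real.dist_eq, Real.dist_eq]
    rcases le_total s t with h | h
    · rw [abs_sub_comm, abs_of_nonneg (sub_nonneg.2 (hmono i h)), abs_sub_comm,
        abs_of_nonneg (sub_nonneg.2 h)]
      exact hU1 i s t h
    · rw [abs_of_nonneg (sub_nonneg.2 (hmono i h)), abs_of_nonneg (sub_nonneg.2 h)]
      exact hU1 i t s h
  have hdiff : ∀ᵐ s, ∀ i, DifferentiableAt ℝ (U i) s :=
    ae_all_iff.2 fun i => (hUlip i).ae_differentiableAt_of_real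
  set G : Set ℝ := {s | ∑ i, deriv (U i) s = 1} with hG
  have hGm : MeasurableSet G :=
    (Finset.measurable_fun_sum _ fun i _ => measurable_deriv (U i)) (measurableSet_singleton 1)
  have hGd : ∀ s, (∀ i, DifferentiableAt ℝ (U i) s) → s ∈ G := by
    intro s hs
    have h1 : HasDerivAt (fun t => ∑ i, U i t) (∑ i, deriv (U i) s) s :=
      HasDerivAt.fun_sum fun i _ => (hs i).hasDerivAt
    have h2 : (fun t => ∑ i, U i t) = fun t => t + ∑ i, U i 0 := by
      ext t
      have := hsum 0 t
      rw [Finset.sum_sub_distrib] at this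
      linarith
    rw [h2] at h1
    exact h1.unique ((hasDerivAt_id s).add_const _)
  set v : Fin N → ℝ → ℝ := fun i s => if s ∈ G then deriv (U i) s else (if i = j then 1 else 0)
    with hv
  have hlaw : IsLaw v := by
    refine ⟨fun i => Measurable.ite hGm (measurable_deriv _) measurable_const, fun i s => ?_,
      fun s => ?_⟩
    · simp only [hv]
      by_cases hs : s ∈ G
      · rw [if_pos hs]
        exact (hmono i).deriv_nonneg
      · rw [if_neg hs]
        split_ifs <;> norm_num
    · simp only [hv]
      by_cases hs : s ∈ G
      · simp only [if_pos hs]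
        exact hs
      · simp [if_neg hs]
  have hcont : Continuous y := by
    refine continuous_iff_continuousAt.2 fun s => ?_
    obtain ⟨L, hL, h⟩ := hlip (s - 1) (s + 1)
    have hlim : Tendsto (fun t => L * |t - s|) (𝓝 s) (𝓝 0) := by
      have : ContinuousAt (fun t : ℝ => L * |t - s|) s := by fun_prop
      simpa [ContinuousAt] using this
    refine tendsto_iff_norm_sub_tendsto_zero.2 (squeeze_zero' (Eventually.of_forall
      fun _ => norm_nonneg _) ?_ hlim)
    filter_upwards [Icc_mem_nhds (sub_one_lt s) (lt_add_one s)] with t ht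
    exact h s ⟨by linarith, by linarith⟩ t ht
  have hint : ∀ s t, IntervalIntegrable (fun r => ∑ i, v i r • A i (y r)) volume s t := by
    intro s t
    exact hlaw.field_intervalIntegrable (a := min s t) (b := max s t) hcont.continuousOn
      ⟨min_le_left _ _, le_max_left _ _⟩ ⟨min_le_right _ _, le_max_right _ _⟩
  have hderiv : ∀ᵐ s, HasDerivAt y (∑ i, v i s • A i (y s)) s := by
    filter_upwards [hdiff] with s hs
    have hsG := hGd s hs
    have h1 : HasDerivAt (fun t => ∑ i, (U i t - U i s) • A i (y s))
        (∑ i, v i s • A i (y s)) s := by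
      refine HasDerivAt.fun_sum fun i _ => HasDerivAt.smul_const (HasDerivAt.sub_const _ ?_) _
      simp only [hv, if_pos hsG]
      exact (hs i).hasDerivAt
    obtain ⟨C, hC⟩ := hest (s - 1) (s + 1)
    have h2 : HasDerivAt (fun t => y t - ∑ i, (U i t - U i s) • A i (y s)) 0 s := by
      refine hasDerivAt_zero_of_norm_sub_le (C := C) fun t ht => ?_
      have := hC s ⟨by linarith, by linarith⟩ t ht
      rw [sub_right_comm] at this
      simpa using this
    simpa using h2.fun_add h1
  refine ⟨v, fun a b => ⟨hlaw, hcont.continuousOn, fun s hs t ht => ?_⟩⟩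
  obtain ⟨L, hL0, hL⟩ := hlip a b
  obtain ⟨B, hB⟩ := (isCompact_Icc (a := a) (b := b)).exists_bound_of_continuousOn
    hcont.continuousOn
  have hB0 : 0 ≤ B := (norm_nonneg _).trans (hB s hs)
  have hsub : Set.uIcc s t ⊆ Set.Icc a b := (Set.ordConnected_Icc).uIcc_subset hs ht
  have hMB : 0 ≤ modeBound A * B := mul_nonneg (modeBound_nonneg A) hB0
  have hac : AbsolutelyContinuousOnInterval
      (fun r => y r - ∫ q in s..r, ∑ i, v i q • A i (y q)) s t := by
    refine LipschitzOnWith.absolutelyContinuousOnInterval (K := (L + modeBound A * B).toNNReal)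
      (LipschitzOnWith.of_dist_le_mul fun r hr q hq => ?_)
    rw [dist_eq_norm, dist_eq_norm, Real.coe_toNNReal _ (by positivity), Real.norm_eq_abs]
    have e : y r - (∫ p in s..r, ∑ i, v i p • A i (y p)) -
        (y q - ∫ p in s..q, ∑ i, v i p • A i (y p)) =
        (y r - y q) - ∫ p in q..r, ∑ i, v i p • A i (y p) := by
      rw [← intervalIntegral.integral_interval_sub_left (hint s r) (hint s q)]
      abel
    rw [e, add_mul]
    refine (norm_sub_le _ _).trans (add_le_add (hL q (hsub hq) r (hsub hr)) ?_)
    refine intervalIntegral.norm_integral_le_of_norm_le_const fun p hp => ?_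
    have hp' : p ∈ Set.Icc a b := (Set.ordConnected_Icc).uIcc_subset (hsub hq) (hsub hr)
      (Set.uIoc_subset_uIcc hp)
    exact (hlaw.norm_field_le p _).trans
      (mul_le_mul_of_nonneg_left (hB p hp') (modeBound_nonneg A))
  have hzero : ∀ᵐ r, r ∈ Set.uIcc s t →
      HasDerivAt (fun r => y r - ∫ q in s..r, ∑ i, v i q • A i (y q)) 0 r := by
    filter_upwards [hderiv, (hint s t).ae_hasDerivAt_integral] with r h1 h2 hr
    simpa using h1.fun_sub (h2 hr s Set.left_mem_uIcc)
  obtain ⟨C, hC⟩ := hac.const_of_ae_hasDerivAt_zero hzero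
  have h1 := hC s Set.left_mem_uIcc
  have h2 := hC t Set.right_mem_uIcc
  simp only [intervalIntegral.integral_same, sub_zero] at h1
  rw [h1]
  rw [← h2]
  abel

/-- Pointwise limits of locally bounded trajectories are trajectories. -/
theorem exists_isArc_of_tendsto {ι : Type*} (F : Ultrafilter ι) {u : ι → Fin N → ℝ → ℝ}
    {x : ι → ℝ → Plane} {y : ℝ → Plane} (harc : ∀ a b, ∀ᶠ k in F, IsArc A (u k) (x k) a b)
    (hbd : ∀ a b, ∃ B, ∀ᶠ k in F, ∀ t ∈ Set.Icc a b, ‖x k t‖ ≤ B)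
    (hlim : ∀ t, Tendsto (fun k => x k t) F (𝓝 (y t))) : ∃ v, ∀ a b, IsArc A v y a b := by
  have hlaw : ∀ᶠ k in F, IsLaw (u k) := (harc 0 0).mono fun k hk => hk.law
  have hN : Nonempty (Fin N) := by
    obtain ⟨k, hk⟩ := hlaw.exists
    by_contra hemp
    rw [not_nonempty_iff] at hemp
    simpa using hk.sum_eq_one 0
  have hU : ∀ i t, ∃ z, Tendsto (fun k => ∫ r in (0 : ℝ)..t, u k i r) F (𝓝 z) := by
    intro i t
    obtain ⟨z, -, hz⟩ := F.exists_tendsto_of_mem_isCompact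
      (isCompact_Icc (a := -|t|) (b := |t|)) (f := fun k => ∫ r in (0 : ℝ)..t, u k i r) (by
        filter_upwards [hlaw] with k hk
        rw [Set.mem_Icc, ← abs_le, ← Real.norm_eq_abs]
        have := intervalIntegral.norm_integral_le_of_norm_le_const (a := 0) (b := t)
          (fun r _ => hk.norm_le_one i r)
        simpa using this)
    exact ⟨z, hz⟩
  choose U hU using hU
  have hUd : ∀ i s t, Tendsto (fun k => ∫ r in s..t, u k i r) F (𝓝 (U i t - U i s)) := by
    intro i s t
    refine ((hU i t).sub (hU i s)).congr' ?_
    filter_upwards [hlaw] with k hk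
    exact intervalIntegral.integral_interval_sub_left (hk.intervalIntegrable i 0 t)
      (hk.intervalIntegrable i 0 s)
  have hyB : ∀ a b, ∃ B, 0 ≤ B ∧ ∀ᶠ k in F, ∀ t ∈ Set.Icc a b, ‖x k t‖ ≤ B := by
    intro a b
    obtain ⟨B, hB⟩ := hbd a b
    exact ⟨max B 0, le_max_right _ _, hB.mono fun k hk t ht => (hk t ht).trans (le_max_left _ _)⟩
  refine exists_isArc_of_increments hN (U := U) (fun i s t hst => ?_) (fun s t => ?_)
    (fun a b => ?_) (fun a b => ?_)
  · rw [← sub_nonneg]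
    exact ge_of_tendsto (hUd i s t) (hlaw.mono fun k hk => hk.integral_nonneg i hst)
  · refine tendsto_nhds_unique (tendsto_finsetSum _ fun i _ => hUd i s t) ?_
    refine tendsto_const_nhds.congr' ?_
    filter_upwards [hlaw] with k hk
    exact (hk.sum_integral s t).symm
  · obtain ⟨B, hB0, hB⟩ := hyB a b
    refine ⟨modeBound A * B, mul_nonneg (modeBound_nonneg A) hB0, fun s hs t ht => ?_⟩
    refine le_of_tendsto ((hlim t).sub (hlim s)).norm ?_
    filter_upwards [harc a b, hB] with k h1 h2
    exact h1.norm_sub_le h2 hs ht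
  · obtain ⟨B, hB0, hB⟩ := hyB a b
    refine ⟨modeBound A * (modeBound A * B), fun s hs t ht => ?_⟩
    have hl : Tendsto (fun k => ‖x k t - x k s - ∑ i, (∫ r in s..t, u k i r) • A i (x k s)‖) F
        (𝓝 ‖y t - y s - ∑ i, (U i t - U i s) • A i (y s)‖) :=
      (((hlim t).sub (hlim s)).sub (tendsto_finsetSum _ fun i _ =>
        (hUd i s t).smul (((A i).continuous.tendsto _).comp (hlim s)))).norm
    refine le_of_tendsto hl ?_
    filter_upwards [harc a b, hB] with k h1 h2
    exact h1.norm_sub_sub_le h2 hs ht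

end Compactness

theorem Plane.eq_sum (z : Plane) :
    z = z 0 • EuclideanSpace.single 0 (1 : ℂ) + z 1 • EuclideanSpace.single 1 (1 : ℂ) := by
  ext i
  fin_cases i <;> simp

theorem Plane.norm_apply_le (z : Plane) (i : Fin 2) : ‖z i‖ ≤ ‖z‖ := PiLp.norm_apply_le z i

/-- Two non-collinear vectors of the plane have coordinate functionals. -/
theorem Plane.exists_coordinates {v e : Plane} (hv : v ≠ 0) (he : ∀ c : ℂ, e ≠ c • v) :
    ∃ f g : Plane →L[ℂ] ℂ, (∀ z, z = f z • v + g z • e) ∧ f v = 1 ∧ g v = 0 ∧ f e = 0 ∧ g e = 1 := by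
  have hD : v 0 * e 1 - v 1 * e 0 ≠ 0 := by
    intro hD
    by_cases h0 : v 0 = 0
    · have h1 : v 1 ≠ 0 := by
        intro h1
        apply hv
        ext i
        fin_cases i <;> simp [h0, h1]
      have h2 : e 0 = 0 := by
        have : v 1 * e 0 = 0 := by
          rw [h0] at hD
          linear_combination -hD
        exact (mul_eq_zero.1 this).resolve_left h1
      apply he (e 1 / v 1)
      ext i
      fin_cases i
      · simp [h0, h2]
      · simp [h1]
    · apply he (e 0 / v 0)
      ext i
      fin_cases i
      · simp [h0]
      · simp only [Fin.mk_one, PiLp.smul_apply, smul_eq_mul]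
        field_simp
        linear_combination hD
  set D := v 0 * e 1 - v 1 * e 0
  let π : Fin 2 → (Plane →L[ℂ] ℂ) := fun i => EuclideanSpace.proj i
  have hπ : ∀ i z, π i z = z i := fun i z => rfl
  refine ⟨D⁻¹ • (e 1 • π 0 - e 0 • π 1), D⁻¹ • (v 0 • π 1 - v 1 • π 0), fun z => ?_, ?_, ?_, ?_, ?_⟩
  · ext i
    fin_cases i
    · simp [hπ]
      field_simp
      ring
    · simp [hπ]
      field_simp
      ring
  · simp [hπ]
    rw [inv_mul_eq_one₀ hD]
    ring
  · simp [hπ]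
    right
    ring
  · simp [hπ]
    right
    ring
  · simp [hπ]
    rw [inv_mul_eq_one₀ hD]

/-- Finite products of the flows of the modes, with their total duration. -/
inductive ModeFlow {N : ℕ} (A : Fin N → Plane →L[ℂ] Plane) : ℝ → (Plane →L[ℂ] Plane) → Prop
  | one : ModeFlow A 0 1
  | step {t : ℝ} {P : Plane →L[ℂ] Plane} (i : Fin N) {k : ℝ} (hk : 0 ≤ k) (h : ModeFlow A t P) :
    ModeFlow A (k + t) (P * NormedSpace.exp (k • A i))

/-- `μ` bounds the exponential growth rate of the flows. -/
def IsRate {N : ℕ} (A : Fin N → Plane →L[ℂ] Plane) (μ : ℝ) : Prop :=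
  ∃ C, ∀ t P, ModeFlow A t P → ∀ v, ‖P v‖ ≤ C * Real.exp (μ * t) * ‖v‖

/-- Uniform exponential decay of all trajectories. -/
def UniformDecay {N : ℕ} (A : Fin N → Plane →L[ℂ] Plane) : Prop :=
  ∃ C κ : ℝ, 0 < C ∧ 0 < κ ∧ ∀ (u : Fin N → ℝ → ℝ) (x : ℝ → Plane) (T : ℝ), 0 ≤ T →
    IsArc A u x 0 T → ‖x T‖ ≤ C * Real.exp (-κ * T) * ‖x 0‖

section Flows

variable {N : ℕ} {A : Fin N → Plane →L[ℂ] Plane} {u : Fin N → ℝ → ℝ} {x : ℝ → Plane} {a b : ℝ}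

theorem ModeFlow.nonneg {t : ℝ} {P : Plane →L[ℂ] Plane} (h : ModeFlow A t P) : 0 ≤ t := by
  induction h with
  | one => exact le_rfl
  | step i hk _ ih => exact add_nonneg hk ih

theorem ModeFlow.exists_isArc [Nonempty (Fin N)] {t : ℝ} {P : Plane →L[ℂ] Plane} (h : ModeFlow A t P) :
    ∀ v, ∃ u x, IsArc A u x 0 t ∧ x 0 = v ∧ x t = P v := by
  induction h with
  | one =>
    intro v
    exact ⟨_, _, isArc_exp (Classical.arbitrary (Fin N)) v 0 0, exp_zero_smul_apply _ v,
      exp_zero_smul_apply _ v⟩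
  | @step t P i k hk h ih =>
    intro v
    obtain ⟨u, x, hx, hx0, hxt⟩ := ih (NormedSpace.exp (k • A i) v)
    have h1 := hx.shift (-k)
    have e1 : (0 : ℝ) - -k = k := by ring
    have e2 : t - -k = k + t := by ring
    rw [e1, e2] at h1
    have ht := h.nonneg
    refine ⟨_, _, (isArc_exp i v 0 k).concat h1 ?_ hk (by linarith), ?_, ?_⟩
    · simp [hx0]
    · simp only [if_pos hk]
      exact exp_zero_smul_apply _ v
    · rcases ht.eq_or_lt with ht0 | ht0
      · subst ht0
        simp only [add_zero, le_refl, if_true]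
        exact hx0.symm.trans hxt
      · rw [if_neg (by linarith)]
        simp [hxt]

theorem isRate_modeBound [Nonempty (Fin N)] : IsRate A (modeBound A) := by
  refine ⟨1, fun t P h v => ?_⟩
  obtain ⟨u, x, hx, h0, h1⟩ := h.exists_isArc v
  rw [← h1, ← h0, one_mul]
  simpa using hx.norm_le h.nonneg

theorem uniformDecay_of_seminorm {w : Seminorm ℂ Plane} {m C μ : ℝ} (hm : 0 < m)
    (hmw : ∀ v, m * ‖v‖ ≤ w v) (hC : ∀ v, w v ≤ C * ‖v‖) (hμ : μ < 0)
    (h : ∀ (u : Fin N → ℝ → ℝ) (x : ℝ → Plane) (T : ℝ), 0 ≤ T → IsArc A u x 0 T →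
      w (x T) ≤ Real.exp (μ * T) * w (x 0)) : UniformDecay A := by
  refine ⟨(|C| + 1) / m, -μ, by positivity, by linarith, fun u x T hT hx => ?_⟩
  rw [neg_neg]
  have h1 := (hmw _).trans (h u x T hT hx)
  have h2 : w (x 0) ≤ (|C| + 1) * ‖x 0‖ := (hC _).trans
    (mul_le_mul_of_nonneg_right (by linarith [le_abs_self C]) (norm_nonneg _))
  have h3 : m * ‖x T‖ ≤ Real.exp (μ * T) * ((|C| + 1) * ‖x 0‖) :=
    h1.trans (mul_le_mul_of_nonneg_left h2 (Real.exp_pos _).le)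
  calc ‖x T‖ = (m * ‖x T‖) / m := by field_simp
    _ ≤ (Real.exp (μ * T) * ((|C| + 1) * ‖x 0‖)) / m := div_le_div_of_nonneg_right h3 hm.le
    _ = _ := by ring

/-- A growth rate is realised infinitesimally by an equivalent norm. -/
theorem IsRate.exists_seminorm {μ : ℝ} (h : IsRate A μ) :
    ∃ w : Seminorm ℂ Plane, ∃ C, (∀ v, ‖v‖ ≤ w v) ∧ (∀ v, w v ≤ C * ‖v‖) ∧
      ∀ i, ∀ k : ℝ, 0 ≤ k → ∀ v, w (NormedSpace.exp (k • A i) v) ≤ Real.exp (μ * k) * w v := by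
  obtain ⟨C, hC⟩ := h
  let ι := {p : ℝ × (Plane →L[ℂ] Plane) // ModeFlow A p.1 p.2}
  have hι : Nonempty ι := ⟨⟨(0, 1), ModeFlow.one⟩⟩
  let g : ι → Plane → ℝ := fun p v => Real.exp (-(μ * p.1.1)) * ‖p.1.2 v‖
  have hg : ∀ p v, g p v ≤ C * ‖v‖ := by
    intro p v
    calc g p v ≤ Real.exp (-(μ * p.1.1)) * (C * Real.exp (μ * p.1.1) * ‖v‖) :=
          mul_le_mul_of_nonneg_left (hC _ _ p.2 v) (Real.exp_pos _).le
      _ = C * ‖v‖ * (Real.exp (-(μ * p.1.1)) * Real.exp (μ * p.1.1)) := by ring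
      _ = C * ‖v‖ := by rw [← Real.exp_add]; simp
  have hbdd : ∀ v, BddAbove (Set.range fun p => g p v) := by
    rintro v
    refine ⟨C * ‖v‖, ?_⟩
    rintro _ ⟨p, rfl⟩
    exact hg p v
  let w : Seminorm ℂ Plane := Seminorm.of (fun v => ⨆ p, g p v) (fun v v' => by
      refine ciSup_le fun p => ?_
      refine le_trans ?_ (add_le_add (le_ciSup (hbdd v) p) (le_ciSup (hbdd v') p))
      simp only [g]
      rw [← mul_add, map_add]
      exact mul_le_mul_of_nonneg_left (norm_add_le _ _) (Real.exp_pos _).le) (fun c v => by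
      rw [Real.mul_iSup_of_nonneg (norm_nonneg c)]
      congr 1
      ext p
      simp only [g]
      rw [map_smul, norm_smul]
      ring)
  have hw : ∀ v, w v = ⨆ p, g p v := fun v => rfl
  refine ⟨w, C, fun v => ?_, fun v => ?_, fun i k hk v => ?_⟩
  · rw [hw]
    refine le_trans ?_ (le_ciSup (hbdd v) ⟨(0, 1), ModeFlow.one⟩)
    simp [g]
  · rw [hw]
    exact ciSup_le fun p => hg p v
  · rw [hw, hw]
    refine ciSup_le fun p => ?_
    have := le_ciSup (hbdd v) ⟨(k + p.1.1, p.1.2 * NormedSpace.exp (k • A i)), p.2.step i hk⟩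
    refine le_trans (le_of_eq ?_) (mul_le_mul_of_nonneg_left this (Real.exp_pos _).le)
    simp only [g]
    rw [← mul_assoc, ← Real.exp_add]
    congr 2
    ring

theorem IsRate.uniformDecay {μ : ℝ} (h : IsRate A μ) (hμ : μ < 0) : UniformDecay A := by
  obtain ⟨w, C, h1, h2, h3⟩ := h.exists_seminorm
  refine uniformDecay_of_seminorm one_pos (fun v => by simpa using h1 v) h2 hμ
    fun u x T hT hx => ?_
  simpa using hx.seminorm_le_of_exp hT w h2 h3

/-- At the infimum of the growth rates there is still a nonzero seminorm. -/
theorem exists_seminorm_of_forall_isRate {l : ℝ} (h : ∀ μ, l < μ → IsRate A μ) :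
    ∃ w : Seminorm ℂ Plane, (∃ v, w v ≠ 0) ∧ (∀ v, w v ≤ 1 * ‖v‖) ∧
      ∀ i, ∀ k : ℝ, 0 ≤ k → ∀ v, w (NormedSpace.exp (k • A i) v) ≤ Real.exp (l * k) * w v := by
  have hn : ∀ n : ℕ, l < l + 1 / ((n : ℝ) + 1) := fun n => by
    have : (0 : ℝ) < 1 / ((n : ℝ) + 1) := by positivity
    linarith
  choose w C h1 h2 h3 using fun n : ℕ => (h _ (hn n)).exists_seminorm
  let e : Fin 2 → Plane := fun i => EuclideanSpace.single i (1 : ℂ)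
  have he : ∀ i, ‖e i‖ = 1 := fun i => by simp [e]
  let s : ℕ → ℝ := fun n => w n (e 0) + w n (e 1)
  have hs : ∀ n, 0 < s n := fun n => by
    have h10 := h1 n (e 0)
    rw [he] at h10
    have : 0 ≤ w n (e 1) := apply_nonneg _ _
    simp only [s]
    linarith
  have hbd : ∀ n v, w n v / s n ∈ Set.Icc 0 ‖v‖ := by
    intro n v
    refine ⟨div_nonneg (apply_nonneg _ _) (hs n).le, ?_⟩
    rw [div_le_iff₀ (hs n)]
    calc w n v ≤ w n (v 0 • e 0) + w n (v 1 • e 1) := by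
          conv_lhs => rw [Plane.eq_sum v]
          exact map_add_le_add _ _ _
      _ = ‖v 0‖ * w n (e 0) + ‖v 1‖ * w n (e 1) := by
          rw [map_smul_eq_mul, map_smul_eq_mul]
      _ ≤ ‖v‖ * w n (e 0) + ‖v‖ * w n (e 1) := add_le_add
          (mul_le_mul_of_nonneg_right (v.norm_apply_le 0) (apply_nonneg _ _))
          (mul_le_mul_of_nonneg_right (v.norm_apply_le 1) (apply_nonneg _ _))
      _ = ‖v‖ * s n := by ring
  let F : Ultrafilter ℕ := hyperfilter ℕ
  have hF : (F : Filter ℕ) ≤ atTop := by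
    rw [← Nat.cofinite_eq_atTop]
    exact hyperfilter_le_cofinite
  choose z hz hzlim using fun v => F.exists_tendsto_of_mem_isCompact (isCompact_Icc (a := (0 : ℝ))
    (b := ‖v‖)) (f := fun n => w n v / s n) (Eventually.of_forall fun n => hbd n v)
  let W : Seminorm ℂ Plane := Seminorm.of z (fun v v' => by
      refine le_of_tendsto_of_tendsto' (hzlim (v + v')) ((hzlim v).add (hzlim v')) fun n => ?_
      rw [← add_div]
      exact div_le_div_of_nonneg_right (map_add_le_add _ _ _) (hs n).le) (fun c v => by
      refine tendsto_nhds_unique (hzlim (c • v)) (((hzlim v).const_mul ‖c‖).congr fun n => ?_)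
      rw [map_smul_eq_mul, mul_div_assoc])
  have hW : ∀ v, W v = z v := fun v => rfl
  refine ⟨W, ?_, fun v => ?_, fun i k hk v => ?_⟩
  · have h01 : z (e 0) + z (e 1) = 1 := by
      refine tendsto_nhds_unique ((hzlim (e 0)).add (hzlim (e 1))) ?_
      refine tendsto_const_nhds.congr fun n => ?_
      rw [← add_div]
      exact (div_self (hs n).ne').symm
    by_contra! h0
    have h00 := h0 (e 0)
    have h11 := h0 (e 1)
    rw [hW] at h00 h11
    linarith
  · rw [hW, one_mul]
    exact (hz v).2
  · rw [hW, hW]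
    have hexp : Tendsto (fun n : ℕ => Real.exp ((l + 1 / ((n : ℝ) + 1)) * k)) F
        (𝓝 (Real.exp (l * k))) := by
      have h4 : Tendsto (fun n : ℕ => l + 1 / ((n : ℝ) + 1)) atTop (𝓝 (l + 0)) :=
        tendsto_const_nhds.add tendsto_one_div_add_atTop_nhds_zero_nat
      rw [add_zero] at h4
      exact ((Real.continuous_exp.tendsto _).comp (h4.mul_const k)).mono_left hF
    refine le_of_tendsto_of_tendsto' (hzlim _) (hexp.mul (hzlim v)) fun n => ?_
    rw [← mul_div_assoc]
    exact div_le_div_of_nonneg_right (h3 n i k hk v) (hs n).le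

end Flows

theorem norm_one_add_mul_le (k : ℝ) (z : ℂ) :
    ‖1 + (k : ℂ) * z‖ ≤ 1 + k * z.re + k ^ 2 * ‖z‖ ^ 2 := by
  have h1 : ‖1 + (k : ℂ) * z‖ ^ 2 = 1 + 2 * (k * z.re) + k ^ 2 * ‖z‖ ^ 2 := by
    rw [Complex.sq_norm, Complex.sq_norm, Complex.normSq_apply, Complex.normSq_apply]
    simp
    ring
  have hre : |k * z.re| ≤ |k| * ‖z‖ := by
    rw [abs_mul]
    exact mul_le_mul_of_nonneg_left (Complex.abs_re_le_norm z) (abs_nonneg k)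
  have hk : k ^ 2 * ‖z‖ ^ 2 = (|k| * ‖z‖) ^ 2 := by rw [mul_pow, sq_abs]
  have h2 : 0 ≤ 1 + k * z.re + k ^ 2 * ‖z‖ ^ 2 := by
    rw [hk]
    nlinarith [(abs_le.1 hre).1, sq_nonneg (|k| * ‖z‖ - 1 / 2)]
  refine le_of_abs_le (abs_le_of_sq_le_sq ?_ h2)
  rw [h1]
  nlinarith [sq_nonneg (k * z.re + k ^ 2 * ‖z‖ ^ 2), sq_nonneg (k * ‖z‖)]

section Triangular

variable {N : ℕ} {A : Fin N → Plane →L[ℂ] Plane}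

theorem IsPAS.re_eigenvalue_mode_neg (hP : IsPAS A) (i : Fin N) {v : Plane} (hv : v ≠ 0) {μ : ℂ}
    (h : A i v = μ • v) : μ.re < 0 :=
  hP.re_eigenvalue_neg (p := fun j => if j = i then 1 else 0) (fun j => by split_ifs <;> norm_num)
    (by simp) hv (by simpa [ite_smul] using h)

/-- A seminorm vanishing at `v` and growing at a finite rate vanishes at `A i v`. -/
theorem Seminorm.map_mode_eq_zero {w : Seminorm ℂ Plane} {C l : ℝ} (hC : ∀ v, w v ≤ C * ‖v‖)
    (hw : ∀ i, ∀ k : ℝ, 0 ≤ k → ∀ v, w (NormedSpace.exp (k • A i) v) ≤ Real.exp (l * k) * w v)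
    {v : Plane} (hv : w v = 0) (i : Fin N) : w (A i v) = 0 := by
  set D : ℝ := |C| * (modeBound A * (modeBound A * (Real.exp (modeBound A) * ‖v‖))) with hD
  have key : ∀ k ∈ Set.Ioc (0 : ℝ) 1, w (A i v) ≤ D * k := by
    intro k hk
    have h1 : w (NormedSpace.exp (k • A i) v) ≤ 0 := by simpa [hv] using hw i k hk.1.le v
    have h2 : w (NormedSpace.exp (k • A i) v - v - k • A i v) ≤ D * k ^ 2 := by
      refine (hC _).trans ?_
      calc C * _ ≤ |C| * _ := mul_le_mul_of_nonneg_right (le_abs_self C) (norm_nonneg _)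
        _ ≤ |C| * _ := mul_le_mul_of_nonneg_left
          (norm_exp_smul_sub_sub_le (A := A) i ⟨hk.1.le, hk.2⟩ v) (abs_nonneg C)
        _ = _ := by rw [hD]; ring
    have h3 : w (k • A i v) ≤ w (NormedSpace.exp (k • A i) v) + w v +
        w (NormedSpace.exp (k • A i) v - v - k • A i v) := by
      have e : k • A i v = NormedSpace.exp (k • A i) v - v -
          (NormedSpace.exp (k • A i) v - v - k • A i v) := by abel
      conv_lhs => rw [e]
      exact (map_sub_le_add w _ _).trans (add_le_add (map_sub_le_add w _ _) le_rfl)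
    rw [w.map_real_smul, abs_of_pos hk.1, hv] at h3
    have h4 : k * w (A i v) ≤ k * (D * k) := by nlinarith
    exact le_of_mul_le_mul_left h4 hk.1
  refine le_antisymm ?_ (apply_nonneg _ _)
  have hlim : Tendsto (fun k : ℝ => D * k) (𝓝[>] 0) (𝓝 0) := by
    have : ContinuousAt (fun k : ℝ => D * k) 0 := by fun_prop
    simpa using this.tendsto.mono_left nhdsWithin_le_nhds
  refine ge_of_tendsto hlim ?_
  filter_upwards [Ioc_mem_nhdsGT (zero_lt_one' ℝ)] with k hk
  exact key k hk

/-- A periodically stable triangular system decays uniformly. -/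
theorem IsPAS.uniformDecay_of_triangular [Nonempty (Fin N)] (hP : IsPAS A) {v e : Plane}
    (hv : v ≠ 0) (he : ∀ c : ℂ, e ≠ c • v) {α β γ : Fin N → ℂ} (hα : ∀ i, A i v = α i • v)
    (hβ : ∀ i, A i e = β i • v + γ i • e) : UniformDecay A := by
  obtain ⟨f, g, hfg, hfv, hgv, hfe, hge⟩ := Plane.exists_coordinates hv he
  have hα0 : ∀ i, (α i).re < 0 := fun i => hP.re_eigenvalue_mode_neg i hv (hα i)
  have hγ0 : ∀ i, (γ i).re < 0 := by
    intro i
    by_cases hαγ : γ i = α i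
    · rw [hαγ]
      exact hα0 i
    · have hd : γ i - α i ≠ 0 := sub_ne_zero.2 hαγ
      refine hP.re_eigenvalue_mode_neg i (v := e + (β i / (γ i - α i)) • v) ?_ ?_
      · intro h0
        refine he (-(β i / (γ i - α i))) ?_
        rw [neg_smul]
        exact eq_neg_of_add_eq_zero_left h0
      · have h1 : β i + β i / (γ i - α i) * α i = γ i * (β i / (γ i - α i)) := by
          field_simp
          ring
        rw [map_add, map_smul, hα, hβ, smul_add, smul_smul, smul_smul, ← h1, add_smul]
        abel
  obtain ⟨i₁, hi₁⟩ := Finite.exists_max fun i => (α i).re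
  obtain ⟨i₂, hi₂⟩ := Finite.exists_max fun i => (γ i).re
  obtain ⟨c, hc0, hcα, hcγ⟩ : ∃ c : ℝ, 0 < c ∧ (∀ i, (α i).re ≤ -c) ∧ ∀ i, (γ i).re ≤ -c := by
    refine ⟨min (-(α i₁).re) (-(γ i₂).re), lt_min (by linarith [hα0 i₁]) (by linarith [hγ0 i₂]),
      fun i => ?_, fun i => ?_⟩
    · linarith [hi₁ i, min_le_left (-(α i₁).re) (-(γ i₂).re)]
    · linarith [hi₂ i, min_le_right (-(α i₁).re) (-(γ i₂).re)]
  set B : ℝ := ∑ i, (‖α i‖ + ‖β i‖ + ‖γ i‖) with hB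
  have hBi : ∀ i, ‖α i‖ + ‖β i‖ + ‖γ i‖ ≤ B := fun i =>
    Finset.single_le_sum (f := fun i => ‖α i‖ + ‖β i‖ + ‖γ i‖) (fun _ _ => by positivity)
      (Finset.mem_univ i)
  have hB0 : 0 ≤ B := Finset.sum_nonneg fun _ _ => by positivity
  obtain ⟨K, hK1, hKc⟩ : ∃ K : ℝ, 1 ≤ K ∧ B ≤ c / 2 * K := by
    refine ⟨2 * B / c + 1, le_add_of_nonneg_left (by positivity), ?_⟩
    field_simp
    linarith
  let w : Seminorm ℂ Plane := (normSeminorm ℂ ℂ).comp f.toLinearMap +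
    (K.toNNReal) • (normSeminorm ℂ ℂ).comp g.toLinearMap
  have hw : ∀ z, w z = ‖f z‖ + K * ‖g z‖ := by
    intro z
    change ‖f z‖ + (K.toNNReal : ℝ) * ‖g z‖ = _
    rw [Real.coe_toNNReal _ (by linarith)]
  have hwC : ∀ z, w z ≤ (‖f‖ + K * ‖g‖) * ‖z‖ := by
    intro z
    rw [hw, add_mul, mul_assoc]
    exact add_le_add (f.le_opNorm z) (mul_le_mul_of_nonneg_left (g.le_opNorm z) (by linarith))
  have hm : ∀ z, (‖v‖ + ‖e‖)⁻¹ * ‖z‖ ≤ w z := by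
    intro z
    have hve : 0 < ‖v‖ + ‖e‖ := add_pos_of_pos_of_nonneg (norm_pos_iff.2 hv) (norm_nonneg e)
    rw [inv_mul_le_iff₀ hve, hw]
    calc ‖z‖ = ‖f z • v + g z • e‖ := by rw [← hfg z]
      _ ≤ ‖f z‖ * ‖v‖ + ‖g z‖ * ‖e‖ := by
        rw [← norm_smul, ← norm_smul]
        exact norm_add_le _ _
      _ ≤ _ := by
        nlinarith [mul_nonneg (norm_nonneg (f z)) (norm_nonneg e),
          mul_nonneg (norm_nonneg (g z)) (norm_nonneg v),
          mul_nonneg (mul_nonneg (norm_nonneg (g z)) (norm_nonneg e)) (sub_nonneg.2 hK1),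
          mul_nonneg (mul_nonneg (norm_nonneg (g z)) (norm_nonneg v)) (sub_nonneg.2 hK1)]
  refine uniformDecay_of_seminorm (w := w) (m := (‖v‖ + ‖e‖)⁻¹)
    (inv_pos.2 (add_pos_of_pos_of_nonneg (norm_pos_iff.2 hv) (norm_nonneg e))) hm hwC
    (μ := -(c / 2)) (by linarith) fun u x T hT hx => ?_
  obtain ⟨R, hR0, hR⟩ := hx.exists_bound
  have key := hx.seminorm_le hT w hwC (μ := -(c / 2)) one_pos
    (K := B ^ 2 * ((‖f‖ + K * ‖g‖) * R)) ?_
  · simpa using key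
  intro t ht i k hk
  have hwx : w (x t) ≤ (‖f‖ + K * ‖g‖) * R := (hwC _).trans
    (mul_le_mul_of_nonneg_left (hR t ⟨ht.1, ht.2.le⟩) (by positivity))
  have hAx : A i (x t) = (f (x t) * α i + g (x t) * β i) • v + (g (x t) * γ i) • e := by
    conv_lhs => rw [hfg (x t)]
    rw [map_add, map_smul, map_smul, hα, hβ, smul_add, smul_smul, smul_smul, smul_smul, add_smul]
    abel
  have hreal : ∀ (F : Plane →L[ℂ] ℂ) (z : Plane), F (k • z) = (k : ℂ) * F z := by
    intro F z
    have := F.map_smul (k : ℂ) z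
    rw [smul_eq_mul] at this
    rw [← this]
    rfl
  have hf1 : f (x t + k • A i (x t)) = (1 + k * α i) * f (x t) + k * (g (x t) * β i) := by
    rw [map_add, hreal, hAx, map_add, map_smul, map_smul, hfv, hfe, smul_eq_mul, smul_eq_mul]
    ring
  have hg1 : g (x t + k • A i (x t)) = (1 + k * γ i) * g (x t) := by
    rw [map_add, hreal, hAx, map_add, map_smul, map_smul, hgv, hge, smul_eq_mul, smul_eq_mul]
    ring
  have hα1 : ‖1 + (k : ℂ) * α i‖ ≤ 1 - c * k + B ^ 2 * k ^ 2 := by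
    have h1 := norm_one_add_mul_le k (α i)
    have h2 : ‖α i‖ ≤ B := by linarith [hBi i, norm_nonneg (β i), norm_nonneg (γ i)]
    have h3 : ‖α i‖ ^ 2 ≤ B ^ 2 := pow_le_pow_left₀ (norm_nonneg _) h2 2
    nlinarith [mul_le_mul_of_nonneg_left (hcα i) hk.1.le,
      mul_le_mul_of_nonneg_left h3 (sq_nonneg k)]
  have hγ1 : ‖1 + (k : ℂ) * γ i‖ ≤ 1 - c * k + B ^ 2 * k ^ 2 := by
    have h1 := norm_one_add_mul_le k (γ i)
    have h2 : ‖γ i‖ ≤ B := by linarith [hBi i, norm_nonneg (β i), norm_nonneg (α i)]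
    have h3 : ‖γ i‖ ^ 2 ≤ B ^ 2 := pow_le_pow_left₀ (norm_nonneg _) h2 2
    nlinarith [mul_le_mul_of_nonneg_left (hcγ i) hk.1.le,
      mul_le_mul_of_nonneg_left h3 (sq_nonneg k)]
  have hβ1 : ‖β i‖ ≤ B := by linarith [hBi i, norm_nonneg (γ i), norm_nonneg (α i)]
  have hfn : ‖f (x t + k • A i (x t))‖ ≤
      (1 - c * k + B ^ 2 * k ^ 2) * ‖f (x t)‖ + k * (c / 2 * K) * ‖g (x t)‖ := by
    rw [hf1]
    refine (norm_add_le _ _).trans (add_le_add ?_ ?_)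
    · rw [norm_mul]
      exact mul_le_mul_of_nonneg_right hα1 (norm_nonneg _)
    · rw [norm_mul, norm_mul, Complex.norm_real, Real.norm_eq_abs, abs_of_pos hk.1]
      rw [mul_assoc k, mul_comm ‖g (x t)‖]
      exact mul_le_mul_of_nonneg_left (mul_le_mul_of_nonneg_right (hβ1.trans hKc)
        (norm_nonneg _)) hk.1.le
  have hgn : ‖g (x t + k • A i (x t))‖ ≤ (1 - c * k + B ^ 2 * k ^ 2) * ‖g (x t)‖ := by
    rw [hg1, norm_mul]
    exact mul_le_mul_of_nonneg_right hγ1 (norm_nonneg _)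
  rw [hw]
  have hgn' := mul_le_mul_of_nonneg_left hgn (by linarith : (0 : ℝ) ≤ K)
  have hfin := mul_le_mul_of_nonneg_left hwx (mul_nonneg (sq_nonneg B) (sq_nonneg k))
  rw [hw] at hfin ⊢
  have hff := mul_nonneg (mul_nonneg hc0.le hk.1.le) (norm_nonneg (f (x t)))
  nlinarith

/-- A periodically stable system with a degenerate extremal seminorm decays uniformly. -/
theorem IsPAS.uniformDecay_of_degenerate [Nonempty (Fin N)] (hP : IsPAS A)
    {w : Seminorm ℂ Plane} {C l : ℝ} (hne : ∃ v, w v ≠ 0) (hC : ∀ v, w v ≤ C * ‖v‖)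
    (hw : ∀ i, ∀ k : ℝ, 0 ≤ k → ∀ v, w (NormedSpace.exp (k • A i) v) ≤ Real.exp (l * k) * w v)
    {v : Plane} (hv : v ≠ 0) (hwv : w v = 0) : UniformDecay A := by
  obtain ⟨e, hwe⟩ := hne
  have he : ∀ c : ℂ, e ≠ c • v := by
    rintro c rfl
    rw [map_smul_eq_mul, hwv, mul_zero] at hwe
    exact hwe rfl
  obtain ⟨f, g, hfg, -⟩ := Plane.exists_coordinates hv he
  refine hP.uniformDecay_of_triangular hv he (α := fun i => f (A i v)) (β := fun i => f (A i e))
    (γ := fun i => g (A i e)) (fun i => ?_) fun i => hfg _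
  have h0 := Seminorm.map_mode_eq_zero hC hw hwv i
  have h1 : g (A i v) • e = A i v - f (A i v) • v := by
    conv_rhs => lhs; rw [hfg (A i v)]
    abel
  have h2 : ‖g (A i v)‖ * w e ≤ 0 := by
    rw [← map_smul_eq_mul w, h1]
    refine (map_sub_le_add w _ _).trans ?_
    rw [h0, map_smul_eq_mul, hwv]
    simp
  have h3 : 0 < w e := lt_of_le_of_ne (apply_nonneg _ _) hwe.symm
  have h4 : g (A i v) = 0 := norm_le_zero_iff.1 (by nlinarith)
  conv_lhs => rw [hfg (A i v), h4]
  simp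

theorem Seminorm.exists_mul_norm_le {w : Seminorm ℂ Plane} {C : ℝ} (hC : ∀ v, w v ≤ C * ‖v‖)
    (h0 : ∀ v, w v = 0 → v = 0) : ∃ m, 0 < m ∧ ∀ v, m * ‖v‖ ≤ w v := by
  have hcont : Continuous w := by
    refine Seminorm.continuous_of_le (q := C.toNNReal • normSeminorm ℂ Plane) ?_ fun v => ?_
    · exact continuous_const.mul continuous_norm
    · exact (hC v).trans (mul_le_mul_of_nonneg_right (Real.le_coe_toNNReal C) (norm_nonneg v))
  obtain ⟨z, hz, hmin⟩ := (isCompact_sphere (0 : Plane) 1).exists_isMinOn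
    (NormedSpace.sphere_nonempty.2 zero_le_one) hcont.continuousOn
  have hz1 : ‖z‖ = 1 := by simpa using hz
  refine ⟨w z, lt_of_le_of_ne (apply_nonneg _ _) fun h => ?_, fun v => ?_⟩
  · rw [h0 z h.symm, norm_zero] at hz1
    exact zero_ne_one hz1
  · by_cases hv : v = 0
    · simp [hv]
    · have hv' := norm_pos_iff.2 hv
      have h1 : w z ≤ w (((‖v‖⁻¹ : ℝ) : ℂ) • v) := hmin (by simp [norm_smul, hv'.ne'])
      rw [map_smul_eq_mul, Complex.norm_real, norm_inv, norm_norm, ← div_eq_inv_mul,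
        le_div_iff₀ hv'] at h1
      exact h1

end Triangular

/-- A norm, equivalent to the standard one, growing at most at rate `l` along trajectories. -/
structure GrowthNorm {N : ℕ} (A : Fin N → Plane →L[ℂ] Plane) (w : Seminorm ℂ Plane) (l m : ℝ) :
    Prop where
  m_pos : 0 < m
  le : ∀ v, m * ‖v‖ ≤ w v
  le_norm : ∀ v, w v ≤ 1 * ‖v‖
  growth : ∀ (u : Fin N → ℝ → ℝ) (x : ℝ → Plane) (a b : ℝ), a ≤ b → IsArc A u x a b →
    w (x b) ≤ Real.exp (l * (b - a)) * w (x a)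

/-- A complete trajectory growing exactly at rate `l`, renormalised to norm one. -/
structure IsExtremal {N : ℕ} (A : Fin N → Plane →L[ℂ] Plane) (w : Seminorm ℂ Plane) (l : ℝ)
    (y : ℝ → Plane) : Prop where
  norm_eq : ∀ t, w (y t) = 1
  arc : ∃ u, ∀ a b, IsArc A u (fun t => ((Real.exp (l * t) : ℝ) : ℂ) • y t) a b

section Extremal

variable {N : ℕ} {A : Fin N → Plane →L[ℂ] Plane} {w : Seminorm ℂ Plane} {l m : ℝ}

theorem Seminorm.map_ofReal_smul (w : Seminorm ℂ Plane) {r : ℝ} (hr : 0 ≤ r) (v : Plane) :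
    w ((r : ℂ) • v) = r * w v := by
  rw [map_smul_eq_mul, Complex.norm_real, Real.norm_of_nonneg hr]

theorem GrowthNorm.continuous (G : GrowthNorm A w l m) : Continuous w := by
  refine Seminorm.continuous_of_le (q := normSeminorm ℂ Plane) continuous_norm fun v => ?_
  simpa using G.le_norm v

theorem GrowthNorm.norm_le (G : GrowthNorm A w l m) {v : Plane} {B : ℝ} (h : w v ≤ B) :
    ‖v‖ ≤ B / m := by
  rw [le_div_iff₀ G.m_pos, mul_comm]
  exact (G.le v).trans h

theorem GrowthNorm.exists_long_arc [Nonempty (Fin N)] (G : GrowthNorm A w l m)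
    (h : ∀ μ < l, ¬ IsRate A μ) {T q : ℝ} (hT : 0 < T) (hq0 : 0 < q) (hq1 : q < 1) :
    ∃ u x, IsArc A u x 0 T ∧ w (x 0) = 1 ∧ q * Real.exp (l * T) < w (x T) := by
  by_contra! H
  have H1 : ∀ u x, IsArc A u x 0 T → w (x T) ≤ q * Real.exp (l * T) * w (x 0) := by
    intro u x hx
    rcases (apply_nonneg w (x 0)).eq_or_lt with h0 | h0
    · have := G.growth u x 0 T hT.le hx
      rw [← h0] at this ⊢
      simpa using this
    · have h1 := H u _ (hx.const_smul (((w (x 0))⁻¹ : ℝ) : ℂ)) (by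
        rw [w.map_ofReal_smul (inv_pos.2 h0).le, inv_mul_cancel₀ h0.ne'])
      rw [w.map_ofReal_smul (inv_pos.2 h0).le, ← div_eq_inv_mul, div_le_iff₀ h0] at h1
      exact h1
  have H2 : ∀ n : ℕ, ∀ u x t, n * T ≤ t → IsArc A u x 0 t →
      w (x t) ≤ q ^ n * Real.exp (l * t) * w (x 0) := by
    intro n
    induction n with
    | zero =>
      intro u x t ht hx
      simpa using G.growth u x 0 t (by simpa using ht) hx
    | succ n ih =>
      intro u x t ht hx
      push_cast at ht
      have hnT : 0 ≤ n * T := by positivity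
      have h1 := H1 u x (hx.mono le_rfl (by linarith))
      have h2 := hx.shift T
      have h3 := ih _ _ (t - T) (by linarith) (h2.mono (by linarith) le_rfl)
      simp only [sub_add_cancel, zero_add] at h3
      calc w (x t) ≤ q ^ n * Real.exp (l * (t - T)) * w (x T) := h3
        _ ≤ q ^ n * Real.exp (l * (t - T)) * (q * Real.exp (l * T) * w (x 0)) := by gcongr
        _ = q ^ (n + 1) * (Real.exp (l * (t - T)) * Real.exp (l * T)) * w (x 0) := by ring
        _ = _ := by rw [← Real.exp_add]; ring_nf
  have hlog : Real.log q < 0 := Real.log_neg hq0 hq1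
  refine h (l + Real.log q / T) (by have := div_neg_of_neg_of_pos hlog hT; linarith)
    ⟨q⁻¹ / m, fun t P hP v => ?_⟩
  obtain ⟨u, x, hx, hx0, hxt⟩ := hP.exists_isArc v
  have ht := hP.nonneg
  set n := ⌊t / T⌋₊
  have hn1 : (n : ℝ) ≤ t / T := Nat.floor_le (by positivity)
  have hn2 : t / T < n + 1 := Nat.lt_floor_add_one _
  have h2 := H2 n u x t (by rwa [le_div_iff₀ hT] at hn1) hx
  have hqn : q ^ n ≤ q⁻¹ * Real.exp (Real.log q / T * t) := by
    rw [← Real.exp_log hq0, ← Real.exp_nat_mul, ← Real.exp_neg, ← Real.exp_add, Real.exp_log hq0]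
    refine Real.exp_le_exp.2 ?_
    have : Real.log q / T * t = Real.log q * (t / T) := by ring
    rw [this]
    nlinarith
  rw [hx0, hxt] at h2
  have hv : w v ≤ ‖v‖ := by simpa using G.le_norm v
  have h3 : w (P v) ≤ q⁻¹ * Real.exp (Real.log q / T * t) * Real.exp (l * t) * ‖v‖ :=
    h2.trans (by gcongr)
  refine (G.norm_le h3).trans (le_of_eq ?_)
  rw [add_mul, Real.exp_add]
  ring

theorem GrowthNorm.exists_isExtremal [Nonempty (Fin N)] (G : GrowthNorm A w l m)
    (h : ∀ μ < l, ¬ IsRate A μ) : ∃ y, IsExtremal A w l y := by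
  have hq : ∀ n : ℕ, (0 : ℝ) < 1 - 1 / (n + 2) ∧ (1 : ℝ) - 1 / (n + 2) < 1 := fun n => by
    have h1 : (0 : ℝ) < 1 / (n + 2) := by positivity
    have h2 : (1 : ℝ) / (n + 2) < 1 := by
      rw [div_lt_one (by positivity)]
      have : (0 : ℝ) ≤ n := by positivity
      linarith
    constructor <;> linarith
  choose u x hx hx0 hxT using fun n : ℕ =>
    G.exists_long_arc h (T := 2 * ((n : ℝ) + 1)) (by positivity) (hq n).1 (hq n).2
  let z : ℕ → ℝ → Plane := fun n t =>
    ((Real.exp (-(l * (n + 1))) : ℝ) : ℂ) • x n (t + (n + 1))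
  have hz : ∀ n, IsArc A (fun i s => u n i (s + (n + 1))) (z n) (-((n : ℝ) + 1)) (n + 1) := by
    intro n
    have := ((hx n).shift ((n : ℝ) + 1)).const_smul ((Real.exp (-(l * (n + 1))) : ℝ) : ℂ)
    exact this.mono (by linarith) (by linarith)
  have hwz : ∀ n t, w (z n t) = Real.exp (-(l * (n + 1))) * w (x n (t + (n + 1))) := fun n t =>
    w.map_ofReal_smul (Real.exp_pos _).le _
  have hup : ∀ n : ℕ, ∀ t ∈ Set.Icc (-((n : ℝ) + 1)) (n + 1), w (z n t) ≤ Real.exp (l * t) := by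
    intro n t ht
    have h1 := G.growth _ _ 0 (t + (n + 1)) (by linarith [ht.1])
      ((hx n).mono le_rfl (by linarith [ht.2]))
    rw [hx0, mul_one] at h1
    rw [hwz]
    refine (mul_le_mul_of_nonneg_left h1 (Real.exp_pos _).le).trans (le_of_eq ?_)
    rw [← Real.exp_add]
    ring_nf
  have hlow : ∀ n : ℕ, ∀ t ∈ Set.Icc (-((n : ℝ) + 1)) (n + 1),
      (1 - 1 / ((n : ℝ) + 2)) * Real.exp (l * t) ≤ w (z n t) := by
    intro n t ht
    have h1 := G.growth _ _ (t + (n + 1)) (2 * ((n : ℝ) + 1)) (by linarith [ht.2])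
      ((hx n).mono (by linarith [ht.1]) le_rfl)
    have h2 := (hxT n).le.trans h1
    rw [hwz]
    have h3 := mul_le_mul_of_nonneg_left h2
      (Real.exp_pos (-(l * (n + 1)) - l * (2 * (n + 1) - (t + (n + 1))))).le
    rw [Real.exp_sub] at h3
    have e1 : ∀ a b c : ℝ, a / Real.exp b * (Real.exp b * c) = a * c := fun a b c => by
      have := Real.exp_pos b
      field_simp
    rw [e1] at h3
    refine le_trans (le_of_eq ?_) h3
    rw [← Real.exp_sub, mul_left_comm, ← Real.exp_add]
    ring_nf
  have hmem : ∀ a b : ℝ, ∀ᶠ n : ℕ in (hyperfilter ℕ : Filter ℕ), -((n : ℝ) + 1) ≤ a ∧ b ≤ n + 1 := by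
    intro a b
    refine Filter.Eventually.filter_mono Nat.hyperfilter_le_atTop ?_
    filter_upwards [(tendsto_natCast_atTop_atTop (R := ℝ)).eventually_ge_atTop (max (-a) b)] with n hn
    have h1 := le_max_left (-a) b
    have h2 := le_max_right (-a) b
    constructor <;> linarith
  have hlim : ∀ t, ∃ p, Tendsto (fun n => z n t) (hyperfilter ℕ : Filter ℕ) (𝓝 p) := by
    intro t
    obtain ⟨p, -, hp⟩ := (hyperfilter ℕ).exists_tendsto_of_mem_isCompact
      (isCompact_closedBall (0 : Plane) (Real.exp (l * t) / m)) (f := fun n => z n t) (by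
        filter_upwards [hmem t t] with n hn
        rw [mem_closedBall_zero_iff]
        exact G.norm_le (hup n t hn))
    exact ⟨p, hp⟩
  choose p hp using hlim
  obtain ⟨v, hv⟩ := exists_isArc_of_tendsto (A := A) (hyperfilter ℕ)
    (u := fun n i s => u n i (s + (n + 1))) (x := z) (y := p)
    (fun a b => (hmem a b).mono fun n hn => (hz n).mono hn.1 hn.2)
    (fun a b => ⟨Real.exp (|l| * max |a| |b|) / m, (hmem a b).mono fun n hn t ht =>
      G.norm_le ((hup n t ⟨hn.1.trans ht.1, ht.2.trans hn.2⟩).trans (Real.exp_le_exp.2 (by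
        refine (le_abs_self _).trans ?_
        rw [abs_mul]
        exact mul_le_mul_of_nonneg_left (abs_le_max_abs_abs ht.1 ht.2) (abs_nonneg l))))⟩) hp
  have hwp : ∀ t, w (p t) = Real.exp (l * t) := by
    intro t
    have h1 := (G.continuous.tendsto _).comp (hp t)
    have h2 : Tendsto (fun n : ℕ => (1 - 1 / ((n : ℝ) + 2)) * Real.exp (l * t))
        (hyperfilter ℕ : Filter ℕ) (𝓝 ((1 - 0) * Real.exp (l * t))) := by
      refine Tendsto.mono_left (Tendsto.mul_const _ (tendsto_const_nhds.sub ?_))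
        Nat.hyperfilter_le_atTop
      have := tendsto_atTop_add_const_right atTop (2 : ℝ) (tendsto_natCast_atTop_atTop (R := ℝ))
      simp only [one_div]
      exact this.inv_tendsto_atTop
    refine le_antisymm (le_of_tendsto h1 ((hmem t t).mono fun n hn => hup n t hn)) ?_
    refine le_of_eq_of_le (by ring) (le_of_tendsto_of_tendsto h2 h1
      ((hmem t t).mono fun n hn => hlow n t hn))
  refine ⟨fun t => ((Real.exp (-(l * t)) : ℝ) : ℂ) • p t, fun t => ?_, v, fun a b => ?_⟩
  · rw [w.map_ofReal_smul (Real.exp_pos _).le, hwp, ← Real.exp_add]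
    simp
  · refine (hv a b).congr (hv a b).law (fun _ _ _ => rfl) fun r _ => ?_
    rw [smul_smul, ← Complex.ofReal_mul, ← Real.exp_add]
    simp

end Extremal

section Recurrent

attribute [local instance] Ultrafilter.add Ultrafilter.addSemigroup

variable {N : ℕ} {A : Fin N → Plane →L[ℂ] Plane} {w : Seminorm ℂ Plane} {l m : ℝ} {y : ℝ → Plane}

theorem exists_idempotent_ultrafilter : ∃ p : Ultrafilter ℕ+, p + p = p ∧
    ∀ n : ℕ, ∀ᶠ k : ℕ+ in (p : Filter ℕ+), n ≤ (k : ℕ) := by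
  obtain ⟨p, hp⟩ := exists_idempotent_of_compact_t2_of_continuous_add_left
    (@Ultrafilter.continuous_add_left ℕ+ _)
  refine ⟨p, hp, fun n => ?_⟩
  induction n with
  | zero => exact Eventually.of_forall fun _ => Nat.zero_le _
  | succ n ih =>
    rw [← hp, Ultrafilter.eventually_add]
    refine Eventually.of_forall fun k => ih.mono fun k' hk' => ?_
    have := k.pos
    rw [PNat.add_coe]
    omega

theorem IsExtremal.norm_le (G : GrowthNorm A w l m) (hy : IsExtremal A w l y) (t : ℝ) :
    ‖y t‖ ≤ 1 / m := G.norm_le (hy.norm_eq t).le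

/-- Limits of translates of an extremal trajectory are extremal; along an idempotent ultrafilter
the limit is recurrent. -/
theorem IsExtremal.exists_recurrent (G : GrowthNorm A w l m) (hy : IsExtremal A w l y) :
    ∃ y', IsExtremal A w l y' ∧ ∃ p : Ultrafilter ℕ+,
      (∀ n : ℕ, ∀ᶠ k : ℕ+ in (p : Filter ℕ+), n ≤ (k : ℕ)) ∧
      ∀ t, Tendsto (fun k : ℕ+ => y' (t + (k : ℕ))) p (𝓝 (y' t)) := by
  obtain ⟨p, hpp, hp⟩ := exists_idempotent_ultrafilter
  have hlim : ∀ t, ∃ z, Tendsto (fun k : ℕ+ => y (t + (k : ℕ))) p (𝓝 z) := by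
    intro t
    obtain ⟨z, -, hz⟩ := p.exists_tendsto_of_mem_isCompact
      (isCompact_closedBall (0 : Plane) (1 / m)) (f := fun k : ℕ+ => y (t + (k : ℕ)))
      (Eventually.of_forall fun k => by
        rw [mem_closedBall_zero_iff]
        exact hy.norm_le G _)
    exact ⟨z, hz⟩
  choose y' hy' using hlim
  obtain ⟨u, hu⟩ := hy.arc
  have hshift : ∀ (k : ℕ+) a b, IsArc A (fun i s => u i (s + (k : ℕ)))
      (fun t => ((Real.exp (l * t) : ℝ) : ℂ) • y (t + (k : ℕ))) a b := by
    intro k a b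
    have h1 := ((hu (a + (k : ℕ)) (b + (k : ℕ))).shift (k : ℕ)).const_smul
      ((Real.exp (-(l * (k : ℕ))) : ℝ) : ℂ)
    simp only [add_sub_cancel_right] at h1
    refine h1.congr h1.law (fun _ _ _ => rfl) fun r _ => ?_
    rw [smul_smul, ← Complex.ofReal_mul, ← Real.exp_add]
    congr 4
    ring
  obtain ⟨v, hv⟩ := exists_isArc_of_tendsto (A := A) p
    (u := fun k i s => u i (s + (k : ℕ)))
    (x := fun k t => ((Real.exp (l * t) : ℝ) : ℂ) • y (t + (k : ℕ)))
    (y := fun t => ((Real.exp (l * t) : ℝ) : ℂ) • y' t)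
    (fun a b => Eventually.of_forall fun k => hshift k a b)
    (fun a b => ⟨Real.exp (|l| * max |a| |b|) * (1 / m), Eventually.of_forall fun k t ht => by
      rw [norm_smul, Complex.norm_real, Real.norm_of_nonneg (Real.exp_pos _).le]
      refine mul_le_mul (Real.exp_le_exp.2 ?_) (hy.norm_le G _) (norm_nonneg _)
        (Real.exp_pos _).le
      refine (le_abs_self _).trans ?_
      rw [abs_mul]
      exact mul_le_mul_of_nonneg_left (abs_le_max_abs_abs ht.1 ht.2) (abs_nonneg l)⟩)
    (fun t => (hy' t).const_smul _)
  refine ⟨y', ⟨fun t => ?_, v, hv⟩, p, hp, fun t => ?_⟩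
  · have := (G.continuous.tendsto _).comp (hy' t)
    refine tendsto_nhds_unique this ?_
    simp only [Function.comp_def, hy.norm_eq]
    exact tendsto_const_nhds
  · refine (Metric.nhds_basis_closedBall (x := y' t)).tendsto_right_iff.2 ?_
    intro η hη
    have h1 : ∀ᶠ k : ℕ+ in ((p + p : Ultrafilter ℕ+) : Filter ℕ+),
        y (t + (k : ℕ)) ∈ Metric.closedBall (y' t) η := by
      rw [hpp]
      exact (Metric.nhds_basis_closedBall (x := y' t)).tendsto_right_iff.1 (hy' t) η hη
    rw [Ultrafilter.eventually_add] at h1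
    filter_upwards [h1] with k hk
    refine Metric.isClosed_closedBall.mem_of_tendsto (hy' (t + (k : ℕ))) (hk.mono fun k' hk' => ?_)
    rw [PNat.add_coe] at hk'
    push_cast at hk'
    rwa [add_assoc]

end Recurrent

section Support

variable {N : ℕ} {A : Fin N → Plane →L[ℂ] Plane} {w : Seminorm ℂ Plane} {l m : ℝ} {y : ℝ → Plane}

/-- At a nonzero point, the shifted velocities of a periodically stable system point into a common
complex half-space. -/
theorem IsPAS.exists_functional (hP : IsPAS A) (hl : 0 ≤ l) {v : Plane} (hv : v ≠ 0) :
    ∃ L : Plane →L[ℂ] ℂ, ∃ κ > 0, L v = 1 ∧ ∀ i, (L (A i v)).re ≤ l - κ := by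
  let d : Option (Fin N) → Plane := fun o => o.elim (-v) fun i => A i v - (l : ℂ) • v
  let F := Fintype.linearCombination ℝ d
  have hF : ∀ p, F p = p none • (-v) + ∑ i, p (some i) • (A i v - (l : ℂ) • v) := fun p => by
    simp only [F, Fintype.linearCombination_apply, Fintype.sum_option]
    rfl
  have hFc : Continuous F := by
    refine F.continuous_of_finiteDimensional
  let Q : Set Plane := (fun c : ℂ => c • v) '' {c | 0 ≤ c.re}
  have hQ : IsClosed Q := (isClosedEmbedding_smul_left hv).isClosedMap _
    (isClosed_le continuous_const Complex.continuous_re)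
  have hQc : Convex ℝ Q := (convex_halfSpace_re_ge 0).is_linear_image
    ⟨fun a b => add_smul a b v, fun r a => smul_assoc r a v⟩
  have hdisj : Disjoint (F '' stdSimplex ℝ (Option (Fin N))) Q := by
    rw [Set.disjoint_left]
    rintro _ ⟨p, ⟨hp0, hp1⟩, rfl⟩ ⟨c, hc, hcF⟩
    rw [Fintype.sum_option] at hp1
    simp only [hF, smul_sub, Finset.sum_sub_distrib, ← Finset.sum_smul] at hcF
    set σ := ∑ i, p (some i) with hσ
    have hσ0 : 0 ≤ σ := Finset.sum_nonneg fun i _ => hp0 _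
    have hc' : (0 : ℝ) ≤ c.re := hc
    rcases hσ0.eq_or_lt with h0 | h0
    · have hz : ∀ i, p (some i) = 0 := fun i =>
        (Finset.sum_eq_zero_iff_of_nonneg fun i _ => hp0 _).1 (hσ.symm.trans h0.symm) i
          (Finset.mem_univ i)
      rw [← h0] at hcF hp1
      have hp1' : p none = 1 := by linarith
      simp only [hz, hp1', one_smul, zero_smul, Finset.sum_const_zero, sub_zero, add_zero] at hcF
      have h1 : (c + 1) • v = 0 := by
        rw [add_smul, hcF]
        simp
      have h2 := (smul_eq_zero.1 h1).resolve_right hv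
      have h3 := congrArg Complex.re h2
      simp at h3
      linarith
    · have hlt := hP.re_eigenvalue_neg (p := fun i => σ⁻¹ * p (some i))
        (fun i => mul_nonneg (inv_pos.2 h0).le (hp0 _)) (by
          rw [← Finset.mul_sum, ← hσ, inv_mul_cancel₀ h0.ne']) hv
        (μ := ((σ⁻¹ : ℝ) : ℂ) * (c + (p none : ℝ) + (σ : ℝ) * (l : ℝ))) (by
          simp only [mul_smul, ← Finset.smul_sum]
          have e : ∑ i, p (some i) • A i v = (c + (p none : ℝ) + (σ : ℝ) * (l : ℝ)) • v := by
            rw [add_smul, add_smul, mul_smul, hcF]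
            simp only [Complex.coe_smul, smul_neg]
            abel
          rw [e, Complex.coe_smul])
      rw [Complex.re_ofReal_mul] at hlt
      have : (0 : ℝ) ≤ (c + (p none : ℝ) + (σ : ℝ) * (l : ℝ) : ℂ).re := by
        simp
        have := hp0 none
        positivity
      have h4 := mul_nonneg (inv_pos.2 h0).le this
      linarith
  obtain ⟨f, a, b, hfa, hab, hfb⟩ := RCLike.geometric_hahn_banach_compact_closed (𝕜 := ℂ)
    ((convex_stdSimplex ℝ (Option (Fin N))).linear_image F)
    ((isCompact_stdSimplex ℝ (Option (Fin N))).image hFc) hQc hQ hdisj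
  have hb0 : b < 0 := by
    have := hfb 0 ⟨0, by simp, by simp⟩
    simpa using this
  have hfv0 : 0 < (f v).re := by
    have h1 := hfa _ ⟨Pi.single none 1, single_mem_stdSimplex ℝ none, rfl⟩
    simp [hF] at h1
    linarith
  have hfd : ∀ i, (f (A i v)).re - l * (f v).re < a := by
    intro i
    have h1 := hfa _ ⟨Pi.single (some i) 1, single_mem_stdSimplex ℝ (some i), rfl⟩
    rw [hF] at h1
    simp [Pi.single_apply] at h1
    exact h1
  have him : (f v).im = 0 := by
    have key : ∀ s : ℝ, b < -(s * (f v).im) := by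
      intro s
      have h1 := hfb _ ⟨(s : ℂ) * Complex.I, by simp, rfl⟩
      simpa using h1
    by_contra him
    have := key (-b / (f v).im)
    rw [div_mul_cancel₀ _ him] at this
    linarith
  have hfv : f v = ((f v).re : ℂ) := Complex.ext rfl (by simpa using him)
  refine ⟨(((f v).re⁻¹ : ℝ) : ℂ) • f, (f v).re⁻¹ * (-b),
    mul_pos (inv_pos.2 hfv0) (by linarith), ?_, fun i => ?_⟩
  · rw [smul_apply, hfv, smul_eq_mul, ← Complex.ofReal_mul]
    simp [hfv0.ne']
  · rw [smul_apply, smul_eq_mul, Complex.re_ofReal_mul]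
    have h1 := hfd i
    have h2 : (f v).re⁻¹ * ((f (A i v)).re - l * (f v).re) ≤ (f v).re⁻¹ * b :=
      mul_le_mul_of_nonneg_left (by linarith) (inv_pos.2 hfv0).le
    have h3 : (f v).re⁻¹ * (l * (f v).re) = l := by field_simp
    rw [mul_sub, h3] at h2
    linarith

/-- A functional decreases along an arc whose direction stays where the functional of the
velocities is small. -/
theorem IsArc.norm_functional_le {u : Fin N → ℝ → ℝ} {x : ℝ → Plane} {a b ρ μ : ℝ}
    (h : IsArc A u x a b) (hab : a ≤ b) {L : Plane →L[ℂ] ℂ} {v : Plane}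
    (hL : ∀ z, ‖z - v‖ ≤ ρ → ∀ i, (L (A i z)).re ≤ μ)
    (hx : ∀ t ∈ Set.Icc a b, L (x t) ≠ 0 ∧ ‖(L (x t))⁻¹ • x t - v‖ ≤ ρ) :
    ‖L (x b)‖ ≤ Real.exp (μ * (b - a)) * ‖L (x a)‖ := by
  obtain ⟨B, hB0, hB⟩ := h.exists_bound
  let q : Seminorm ℂ Plane := (normSeminorm ℂ ℂ).comp (L : Plane →ₗ[ℂ] ℂ)
  have hq : ∀ z, q z = ‖L z‖ := fun z => rfl
  set Z := ‖L‖ * (modeBound A * (‖v‖ + ρ))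
  have key := h.seminorm_le hab q (C := ‖L‖) (fun z => by rw [hq]; exact L.le_opNorm z)
    (μ := μ) (K := ‖L‖ * B * Z ^ 2) one_pos (fun t ht i k hk => by
      obtain ⟨h0, h1⟩ := hx t ⟨ht.1, ht.2.le⟩
      set z := (L (x t))⁻¹ • x t with hz
      have e1 : L (A i z) * L (x t) = L (A i (x t)) := by
        rw [hz, map_smul, map_smul, smul_eq_mul]
        field_simp
      have hzn : ‖z‖ ≤ ‖v‖ + ρ := by
        calc ‖z‖ = ‖v + (z - v)‖ := by congr 1; abel
          _ ≤ ‖v‖ + ‖z - v‖ := norm_add_le _ _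
          _ ≤ _ := by linarith
      have hζ : ‖L (A i z)‖ ≤ Z := (L.le_opNorm _).trans (mul_le_mul_of_nonneg_left
        ((norm_apply_le_modeBound i z).trans
          (mul_le_mul_of_nonneg_left hzn (modeBound_nonneg A))) (norm_nonneg L))
      have e2 : L (x t + k • A i (x t)) = (1 + (k : ℂ) * L (A i z)) * L (x t) := by
        rw [map_add, ← Complex.coe_smul, map_smul, ← e1, smul_eq_mul]
        ring
      have hLx : ‖L (x t)‖ ≤ ‖L‖ * B := (L.le_opNorm _).trans
        (mul_le_mul_of_nonneg_left (hB t ⟨ht.1, ht.2.le⟩) (norm_nonneg L))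
      rw [hq, hq, e2, norm_mul]
      have h2 := norm_one_add_mul_le k (L (A i z))
      have h3 : k * (L (A i z)).re ≤ k * μ := mul_le_mul_of_nonneg_left (hL z h1 i) hk.1.le
      have h4 : k ^ 2 * ‖L (A i z)‖ ^ 2 ≤ k ^ 2 * Z ^ 2 := by gcongr
      calc ‖1 + (k : ℂ) * L (A i z)‖ * ‖L (x t)‖ ≤ (1 + k * μ + k ^ 2 * Z ^ 2) * ‖L (x t)‖ := by
            gcongr
            linarith
        _ = (1 + μ * k) * ‖L (x t)‖ + ‖L (x t)‖ * (k ^ 2 * Z ^ 2) := by ring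
        _ ≤ (1 + μ * k) * ‖L (x t)‖ + (‖L‖ * B) * (k ^ 2 * Z ^ 2) := by gcongr
        _ = _ := by ring)
  exact key

theorem IsExtremal.ne_zero (hy : IsExtremal A w l y) (t : ℝ) : y t ≠ 0 := by
  intro h
  have := hy.norm_eq t
  rw [h, map_zero] at this
  exact zero_ne_one this

/-- An extremal trajectory of a periodically stable system never returns to the same complex
line. -/
theorem IsExtremal.ne_smul (hy : IsExtremal A w l y) (hP : IsPAS A) (hl : 0 ≤ l) {s t : ℝ}
    (hst : s < t) (k : ℂ) : y t ≠ k • y s := by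
  intro h
  have hk : ‖k‖ = 1 := by
    have := congrArg w h
    rw [map_smul_eq_mul, hy.norm_eq, hy.norm_eq, mul_one] at this
    exact this.symm
  obtain ⟨u, hu⟩ := hy.arc
  have h1 := (hu s t).shift s
  rw [sub_self] at h1
  have h2 := hP.eq_zero_of_multiplier (sub_pos.2 hst) h1
    (k := ((Real.exp (l * (t - s)) : ℝ) : ℂ) * k) (by
      rw [norm_mul, hk, mul_one, Complex.norm_real, Real.norm_of_nonneg (Real.exp_pos _).le]
      exact Real.one_le_exp (mul_nonneg hl (sub_pos.2 hst).le)) (by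
      simp only [sub_add_cancel, zero_add, h, smul_smul]
      rw [mul_right_comm, ← Complex.ofReal_mul, ← Real.exp_add]
      congr 5
      ring)
  simp only [zero_add, smul_eq_zero, Complex.ofReal_eq_zero, (Real.exp_pos _).ne', false_or] at h2
  exact hy.ne_zero s h2

theorem IsExtremal.exists_lipschitz (G : GrowthNorm A w l m) (hy : IsExtremal A w l y)
    (hl : 0 ≤ l) : ∃ Λ ε₀, 0 ≤ Λ ∧ 0 < ε₀ ∧ ∀ s h, |h| ≤ ε₀ → ‖y (s + h) - y s‖ ≤ Λ * |h| := by
  obtain ⟨u, hu⟩ := hy.arc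
  have hm := G.m_pos
  set E := Real.exp 1
  refine ⟨E * (modeBound A * (E * (1 / m))) + 2 * l * (1 / m), 1 / (l + 1),
    by have := modeBound_nonneg A; positivity, by positivity, fun s h hh => ?_⟩
  have hlh : |l * h| ≤ 1 := by
    rw [abs_mul, abs_of_nonneg hl]
    calc l * |h| ≤ l * (1 / (l + 1)) := by gcongr
      _ ≤ 1 := by rw [mul_one_div, div_le_one (by positivity)]; linarith
  have h1 := ((hu (s - |h|) (s + |h|)).shift s).const_smul ((Real.exp (-(l * s)) : ℝ) : ℂ)
  have h2 := h1.congr (y := fun t => ((Real.exp (l * t) : ℝ) : ℂ) • y (t + s)) h1.law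
    (fun _ _ _ => rfl) (fun r _ => by
      rw [smul_smul, ← Complex.ofReal_mul, ← Real.exp_add]
      congr 4
      ring)
  have hbd : ∀ t ∈ Set.Icc (s - |h| - s) (s + |h| - s),
      ‖((Real.exp (l * t) : ℝ) : ℂ) • y (t + s)‖ ≤ E * (1 / m) := by
    intro t ht
    rw [norm_smul, Complex.norm_real, Real.norm_of_nonneg (Real.exp_pos _).le]
    refine mul_le_mul (Real.exp_le_exp.2 ?_) (hy.norm_le G _) (norm_nonneg _) (Real.exp_pos _).le
    refine le_trans ?_ hlh
    rw [abs_mul, abs_of_nonneg hl]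
    exact mul_le_mul_of_nonneg_left (by linarith [ht.2]) hl
  have h3 := h2.norm_sub_le hbd (s := 0) (t := h)
    ⟨by linarith [abs_nonneg h], by linarith [abs_nonneg h]⟩
    ⟨by linarith [neg_abs_le h], by linarith [le_abs_self h]⟩
  simp only [mul_zero, Real.exp_zero, Complex.ofReal_one, one_smul, zero_add, sub_zero] at h3
  have e : y (s + h) - y s = ((Real.exp (-(l * h)) : ℝ) : ℂ) •
      (((Real.exp (l * h) : ℝ) : ℂ) • y (h + s) - y s) +
      ((Real.exp (-(l * h)) - 1 : ℝ) : ℂ) • y s := by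
    rw [smul_sub, smul_smul, ← Complex.ofReal_mul, ← Real.exp_add]
    simp [sub_smul, add_comm]
  have h4 : Real.exp (-(l * h)) ≤ E := Real.exp_le_exp.2 ((neg_le_abs _).trans hlh)
  have h5 := Real.abs_exp_sub_one_le (x := -(l * h)) (by rwa [abs_neg])
  rw [abs_neg, abs_mul, abs_of_nonneg hl] at h5
  rw [e]
  refine (norm_add_le _ _).trans ?_
  rw [norm_smul, norm_smul, Complex.norm_real, Complex.norm_real,
    Real.norm_of_nonneg (Real.exp_pos _).le, Real.norm_eq_abs]
  calc _ ≤ E * (modeBound A * (E * (1 / m)) * |h|) + 2 * (l * |h|) * (1 / m) := by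
        gcongr
        exact hy.norm_le G s
    _ = _ := by ring

end Support

section Box

variable {N : ℕ} {A : Fin N → Plane →L[ℂ] Plane} {w : Seminorm ℂ Plane} {l m : ℝ} {y : ℝ → Plane}

theorem IsExtremal.exists_equicontinuous (G : GrowthNorm A w l m) (hy : IsExtremal A w l y)
    (hl : 0 ≤ l) {η : ℝ} (hη : 0 < η) :
    ∃ ε > 0, ∀ s h, |h| ≤ ε → ‖y (s + h) - y s‖ ≤ η := by
  obtain ⟨Λ, ε₀, hΛ, hε₀, hy'⟩ := hy.exists_lipschitz G hl
  refine ⟨min ε₀ (η / (Λ + 1)), by positivity, fun s h hh => ?_⟩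
  refine (hy' s h (hh.trans (min_le_left _ _))).trans ?_
  calc Λ * |h| ≤ (Λ + 1) * (η / (Λ + 1)) := by
        gcongr
        · linarith
        · exact hh.trans (min_le_right _ _)
    _ = η := by field_simp

theorem IsExtremal.continuous (G : GrowthNorm A w l m) (hy : IsExtremal A w l y) (hl : 0 ≤ l) :
    Continuous y := by
  refine Metric.continuous_iff.2 fun s η hη => ?_
  obtain ⟨ε, hε, h⟩ := hy.exists_equicontinuous G hl (half_pos hη)
  refine ⟨ε, hε, fun t ht => ?_⟩
  rw [Real.dist_eq] at ht
  have := h s (t - s) ht.le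
  rw [add_sub_cancel] at this
  rw [dist_eq_norm]
  linarith

theorem norm_div_sub_div_le {c b c' b' : ℂ} {r k : ℝ} (hc : c ≠ 0) (hr : ‖b / c‖ ≤ r) (hk : 0 < k)
    (hk' : k ≤ ‖c'‖) : ‖b' / c' - b / c‖ ≤ (‖b' - b‖ + r * ‖c' - c‖) / k := by
  have hc' : c' ≠ 0 := norm_pos_iff.1 (hk.trans_le hk')
  have e : b' / c' - b / c = ((b' - b) - (b / c) * (c' - c)) / c' := by
    field_simp
    ring
  rw [e, norm_div]
  have h1 : ‖(b' - b) - (b / c) * (c' - c)‖ ≤ ‖b' - b‖ + r * ‖c' - c‖ := by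
    refine (norm_sub_le _ _).trans ?_
    rw [norm_mul]
    gcongr
  have hr0 : 0 ≤ r := (norm_nonneg _).trans hr
  gcongr

/-- The slope of the coordinates of an extremal trajectory is equicontinuous where it is small. -/
theorem IsExtremal.exists_slope_equicontinuous (G : GrowthNorm A w l m) (hy : IsExtremal A w l y)
    (hl : 0 ≤ l) {f g : Plane →L[ℂ] ℂ} {e : Plane}
    (hfg : ∀ z, z = f z • y 0 + g z • e) {r η : ℝ} (hη : 0 < η) :
    ∃ ε > 0, ∀ s h, f (y s) ≠ 0 → ‖g (y s) / f (y s)‖ ≤ r → |h| ≤ ε → f (y (s + h)) ≠ 0 ∧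
      ‖g (y (s + h)) / f (y (s + h)) - g (y s) / f (y s)‖ ≤ η := by
  set B := 1 + |r| * w e
  have hB : 0 < B := by have := apply_nonneg w e; positivity
  set k := 1 / B / 2 with hk
  have hk0 : 0 < k := by positivity
  set S := ‖g‖ + |r| * ‖f‖
  obtain ⟨ε, hε, h1⟩ := hy.exists_equicontinuous G hl
    (η := min (k / (‖f‖ + 1)) (η * k / (S + 1))) (by positivity)
  refine ⟨ε, hε, fun s h hc hr hh => ?_⟩
  have h2 := h1 s h hh
  have hr0 : 0 ≤ r := (norm_nonneg _).trans hr
  have hcB : 1 / B ≤ ‖f (y s)‖ := by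
    rw [div_le_iff₀ hB]
    calc 1 = w (y s) := (hy.norm_eq s).symm
      _ = w (f (y s) • y 0 + g (y s) • e) := by rw [← hfg]
      _ ≤ ‖f (y s)‖ * 1 + ‖g (y s)‖ * w e := by
          refine (map_add_le_add w _ _).trans ?_
          rw [map_smul_eq_mul, map_smul_eq_mul, hy.norm_eq]
      _ ≤ ‖f (y s)‖ * 1 + (|r| * ‖f (y s)‖) * w e := by
          rw [norm_div, div_le_iff₀ (norm_pos_iff.2 hc)] at hr
          rw [abs_of_nonneg hr0]
          gcongr
      _ = _ := by ring
  have hd : ∀ F : Plane →L[ℂ] ℂ, ‖F (y (s + h)) - F (y s)‖ ≤ ‖F‖ * ‖y (s + h) - y s‖ := fun F => by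
    rw [← map_sub]
    exact F.le_opNorm _
  have h3 : ‖f (y (s + h)) - f (y s)‖ ≤ k := by
    calc _ ≤ ‖f‖ * ‖y (s + h) - y s‖ := hd f
      _ ≤ (‖f‖ + 1) * (k / (‖f‖ + 1)) := by
        gcongr
        · linarith
        · exact h2.trans (min_le_left _ _)
      _ = k := by field_simp
  have h4 : k ≤ ‖f (y (s + h))‖ := by
    have := norm_sub_norm_le (f (y s)) (f (y (s + h)))
    rw [norm_sub_rev] at this
    linarith
  refine ⟨norm_pos_iff.1 (hk0.trans_le h4), (norm_div_sub_div_le hc hr hk0 h4).trans ?_⟩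
  rw [div_le_iff₀ hk0]
  calc _ ≤ ‖g‖ * ‖y (s + h) - y s‖ + r * (‖f‖ * ‖y (s + h) - y s‖) := by
        gcongr
        exacts [hd g, hd f]
    _ = S * ‖y (s + h) - y s‖ := by simp only [S, abs_of_nonneg hr0]; ring
    _ ≤ (S + 1) * (η * k / (S + 1)) := by
        gcongr
        · linarith
        · exact h2.trans (min_le_right _ _)
    _ = η * k := mul_div_cancel₀ _ (by positivity)

theorem IsExtremal.norm_functional_le (hy : IsExtremal A w l y) {L : Plane →L[ℂ] ℂ} {v : Plane}
    {ρ κ s t : ℝ} (hst : s ≤ t) (hL : ∀ z, ‖z - v‖ ≤ ρ → ∀ i, (L (A i z)).re ≤ l - κ)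
    (hx : ∀ r ∈ Set.Icc s t, L (y r) ≠ 0 ∧ ‖(L (y r))⁻¹ • y r - v‖ ≤ ρ) :
    ‖L (y t)‖ ≤ Real.exp (-κ * (t - s)) * ‖L (y s)‖ := by
  obtain ⟨u, hu⟩ := hy.arc
  have he : ∀ r, ((Real.exp (l * r) : ℝ) : ℂ) ≠ 0 := fun r => by
    rw [Ne, Complex.ofReal_eq_zero]
    exact (Real.exp_pos _).ne'
  have h1 := (hu s t).norm_functional_le hst hL (fun r hr => by
    obtain ⟨h2, h3⟩ := hx r hr
    rw [map_smul, smul_eq_mul]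
    refine ⟨mul_ne_zero (he r) h2, ?_⟩
    rw [smul_smul, mul_inv_rev, mul_assoc, inv_mul_cancel₀ (he r), mul_one]
    exact h3)
  simp only [map_smul, smul_eq_mul, norm_mul, Complex.norm_real,
    Real.norm_of_nonneg (Real.exp_pos _).le] at h1
  refine le_of_mul_le_mul_left (h1.trans (le_of_eq ?_)) (Real.exp_pos (l * t))
  rw [← mul_assoc, ← mul_assoc, ← Real.exp_add, ← Real.exp_add]
  ring_nf

theorem Seminorm.norm_level_sub_le (w : Seminorm ℂ Plane) (v e : Plane) (p q : ℂ) :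
    w (v + (p + q) • e) ≤ w (v + p • e) + ‖q‖ * w e := by
  rw [add_smul, ← add_assoc, ← map_smul_eq_mul w q e]
  exact map_add_le_add w _ _

/-- Convexity along a horizontal line turns a one-step increase into linear growth. -/
theorem Seminorm.level_add_mul_le (w : Seminorm ℂ Plane) {v e : Plane} {q : ℂ} {k κ : ℝ} (hk : 0 ≤ k)
    (h : w (v + (q - 1) • e) + κ ≤ w (v + q • e)) :
    w (v + q • e) + κ * k ≤ w (v + (q + k) • e) := by
  have e1 : ((k + 1 : ℝ) : ℂ) • (v + q • e) =
      (k : ℂ) • (v + (q - 1) • e) + (v + (q + k) • e) := by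
    push_cast
    module
  have h1 := map_add_le_add w ((k : ℂ) • (v + (q - 1) • e)) (v + (q + k) • e)
  rw [← e1, w.map_ofReal_smul hk, w.map_ofReal_smul (by linarith)] at h1
  nlinarith [mul_le_mul_of_nonneg_left h hk]

theorem Seminorm.level_segment_le (w : Seminorm ℂ Plane) {v e : Plane} {P : ℂ} (h0 : w v = 1)
    (hP : w (v + P • e) = 1) {k : ℝ} (hk : k ∈ Set.Icc (0 : ℝ) 1) :
    w (v + ((k : ℂ) * P) • e) ≤ 1 := by
  have e1 : v + ((k : ℂ) * P) • e = ((1 - k : ℝ) : ℂ) • v + (k : ℂ) • (v + P • e) := by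
    push_cast
    module
  rw [e1]
  refine (map_add_le_add w _ _).trans ?_
  rw [w.map_ofReal_smul hk.1, w.map_ofReal_smul (by linarith [hk.2]), h0, hP]
  linarith

/-- In suitable coordinates, an extremal trajectory of a periodically stable system has only short
decaying strands near its initial direction. -/
theorem IsExtremal.exists_strandBox (G : GrowthNorm A w l m) (hy : IsExtremal A w l y)
    (hP : IsPAS A) (hl : 0 ≤ l) :
    ∃ (f g : Plane →L[ℂ] ℂ) (V : ℂ → ℝ) (r R δ κ κ' ε : ℝ),
      StrandBox (fun t => f (y t)) (fun t => g (y t)) V r R δ κ κ' ε := by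
  set v := y 0 with hv
  have hv0 : v ≠ 0 := hy.ne_zero 0
  have hwv : w v = 1 := hy.norm_eq 0
  obtain ⟨L, κ₀, hκ₀, hLv, hLA⟩ := hP.exists_functional hl hv0
  set κ := κ₀ / 2 with hκ
  have hκ0 : 0 < κ := half_pos hκ₀
  set ρ := κ / (‖L‖ * modeBound A + 1) with hρ
  have hLM : 0 ≤ ‖L‖ * modeBound A := mul_nonneg (norm_nonneg L) (modeBound_nonneg A)
  have hρ0 : 0 < ρ := by positivity
  have hLz : ∀ z, ‖z - v‖ ≤ ρ → ∀ i, (L (A i z)).re ≤ l - κ := by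
    intro z hz i
    have e1 : L (A i z) = L (A i v) + L (A i (z - v)) := by
      rw [← map_add, ← map_add]
      congr 2
      abel
    have h1 : ‖L (A i (z - v))‖ ≤ κ := by
      calc ‖L (A i (z - v))‖ ≤ ‖L‖ * (modeBound A * ‖z - v‖) := (L.le_opNorm _).trans
            (mul_le_mul_of_nonneg_left (norm_apply_le_modeBound i _) (norm_nonneg L))
        _ = ‖L‖ * modeBound A * ‖z - v‖ := by ring
        _ ≤ (‖L‖ * modeBound A + 1) * ρ := by
          gcongr
          linarith
        _ = κ := by rw [hρ]; field_simp
    have h2 := (Complex.abs_re_le_norm _).trans h1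
    have h3 := le_abs_self (L (A i (z - v))).re
    have h4 := hLA i
    rw [e1, Complex.add_re]
    linarith
  have hyc := hy.continuous G hl
  have hnear : ∃ τ > 0, ∀ s, |s| ≤ τ → L (y s) ≠ 0 ∧ ‖(L (y s))⁻¹ • y s - v‖ ≤ ρ := by
    have hc0 : L (y 0) ≠ 0 := by rw [← hv, hLv]; exact one_ne_zero
    have hLy : ContinuousAt (fun s => L (y s)) 0 := (L.continuous.comp hyc).continuousAt
    have h1 : ContinuousAt (fun s => (L (y s))⁻¹ • y s - v) 0 :=
      ((hLy.inv₀ hc0).smul hyc.continuousAt).sub continuousAt_const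
    have h2 : ∀ᶠ s in 𝓝 (0 : ℝ), ‖(L (y s))⁻¹ • y s - v‖ < ρ := by
      refine h1.norm.eventually_lt continuousAt_const ?_
      simp only [← hv, hLv]
      simpa using hρ0
    obtain ⟨τ, hτ, h3⟩ := Metric.eventually_nhds_iff.1 ((hLy.eventually_ne hc0).and h2)
    refine ⟨τ / 2, half_pos hτ, fun s hs => ?_⟩
    have h4 := h3 (y := s) (by rw [Real.dist_eq, sub_zero]; linarith)
    exact ⟨h4.1, h4.2.le⟩
  obtain ⟨τ, hτ, hnear⟩ := hnear
  have hdec := hy.norm_functional_le (s := -τ) (t := 0) (by linarith) hLz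
    (fun r hr => hnear r (abs_le.2 ⟨hr.1, hr.2.trans hτ.le⟩))
  rw [← hv, hLv, norm_one] at hdec
  have hLτ := (hnear (-τ) (by rw [abs_neg, abs_of_pos hτ])).1
  have hcτ : 1 < ‖L (y (-τ))‖ := by
    have h1 : Real.exp (-κ * (0 - -τ)) < 1 := by
      rw [Real.exp_lt_one_iff]
      nlinarith
    have h2 := norm_pos_iff.2 hLτ
    nlinarith
  set e := v - (L (y (-τ)))⁻¹ • y (-τ) with he
  have hwe : w (v - e) < 1 := by
    rw [he, sub_sub_cancel, map_smul_eq_mul, hy.norm_eq, mul_one, norm_inv]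
    exact inv_lt_one_of_one_lt₀ hcτ
  have hLe : L e = 0 := by
    rw [he, map_sub, map_smul, hLv, smul_eq_mul, inv_mul_cancel₀ hLτ, sub_self]
  have hev : ∀ c : ℂ, e ≠ c • v := by
    intro c hc
    have h1 := congrArg L hc
    rw [hLe, map_smul, hLv, smul_eq_mul, mul_one] at h1
    rw [← h1, zero_smul] at hc
    rw [hc, sub_zero, hwv] at hwe
    exact lt_irrefl _ hwe
  obtain ⟨f, g, hfg, hfv, hgv, hfe, hge⟩ := Plane.exists_coordinates hv0 hev
  have hLf : ∀ z, L z = f z := fun z => by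
    conv_lhs => rw [hfg z]
    simp [hLv, hLe]
  simp only [hLf] at hLz
  set V : ℂ → ℝ := fun q => w (v + q • e) with hV
  have hV0 : V 0 = 1 := by simp [hV, hwv]
  have hVc : Continuous V := G.continuous.comp (by fun_prop)
  set κ' := (1 - w (v - e)) / 2 with hκ'
  have hκ'0 : 0 < κ' := half_pos (sub_pos.2 hwe)
  have hwe0 : 0 ≤ w e := apply_nonneg w e
  set r := min (κ' / (2 * (w e + 1))) (ρ / (‖e‖ + 1)) with hr
  have hr0 : 0 < r := by positivity
  have hrw : r * w e ≤ κ' / 2 := by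
    calc r * w e ≤ (κ' / (2 * (w e + 1))) * (w e + 1) := by
          gcongr
          · exact min_le_left _ _
          · linarith
      _ = κ' / 2 := by field_simp
  have hre : r * ‖e‖ ≤ ρ := by
    calc r * ‖e‖ ≤ (ρ / (‖e‖ + 1)) * (‖e‖ + 1) := by
          gcongr
          · exact min_le_right _ _
          · linarith
      _ = ρ := by field_simp
  have hmono : ∀ (q : ℂ) (k : ℝ), ‖q‖ ≤ r → 0 ≤ k → V q + κ' * k ≤ V (q + k) := by
    intro q k hq hk
    refine w.level_add_mul_le hk ?_
    have h1 := w.norm_level_sub_le v e (-1) q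
    have h2 := w.norm_level_sub_le v e q (-q)
    have h3 : v + (-1 : ℂ) • e = v - e := by module
    have h4 : ‖q‖ * w e ≤ κ' / 2 := (mul_le_mul_of_nonneg_right hq hwe0).trans hrw
    rw [h3, neg_add_eq_sub] at h1
    rw [add_neg_cancel, zero_smul, add_zero, hwv, norm_neg] at h2
    linarith
  obtain ⟨ε, hε, hstrand⟩ := hy.exists_slope_equicontinuous G hl hfg (r := r) (half_pos hr0)
  have hVnear : ∀ᶠ q in 𝓝 (0 : ℂ), Real.exp (-(κ * ε / 4)) < V q ∧ V q < Real.exp (κ * ε / 4) := by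
    refine (continuousAt_const.eventually_lt hVc.continuousAt ?_).and
      (hVc.continuousAt.eventually_lt continuousAt_const ?_)
    · rw [hV0, Real.exp_lt_one_iff]
      have : 0 < κ * ε / 4 := by positivity
      linarith
    · rw [hV0, Real.one_lt_exp_iff]
      positivity
  obtain ⟨R₀, hR₀, hVR⟩ := Metric.eventually_nhds_iff.1 hVnear
  set R := min (R₀ / 2) (r / 2) with hR
  have hR0 : 0 < R := by positivity
  have hRr : R ≤ r / 2 := min_le_right _ _
  have hδ : ∀ᶠ q in 𝓝 (0 : ℂ), 1 - κ' * R / 2 < V q := by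
    refine continuousAt_const.eventually_lt hVc.continuousAt ?_
    rw [hV0]
    have : 0 < κ' * R / 2 := by positivity
    linarith
  obtain ⟨δ₀, hδ₀, hVδ⟩ := Metric.eventually_nhds_iff.1 hδ
  have hstrand' : ∀ u h, f (y u) ≠ 0 → ‖g (y u) / f (y u)‖ ≤ R → |h| ≤ ε →
      f (y (u + h)) ≠ 0 ∧ ‖g (y (u + h)) / f (y (u + h))‖ ≤ r := by
    intro u h hc hq hh
    obtain ⟨h1, h2⟩ := hstrand u h hc (hq.trans (hRr.trans (by linarith))) hh
    refine ⟨h1, ?_⟩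
    have := norm_sub_norm_le (g (y (u + h)) / f (y (u + h))) (g (y u) / f (y u))
    linarith
  have hslope : ∀ s, f (y s) ≠ 0 → (f (y s))⁻¹ • y s = v + (g (y s) / f (y s)) • e := by
    intro s hs
    refine (congrArg ((f (y s))⁻¹ • ·) (hfg (y s))).trans ?_
    simp only [smul_add, smul_smul, inv_mul_cancel₀ hs, one_smul, div_eq_inv_mul]
  refine ⟨f, g, V, r, R, min (δ₀ / 2) (R / 2), κ, κ', ε, ?_⟩
  exact
  { continuous_c := f.continuous.comp hyc
    continuous_b := g.continuous.comp hyc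
    c_zero := hfv
    b_zero := hgv
    det_ne_zero := by
      intro s t hst hD
      by_cases hs : f (y s) = 0
      · have hgs : g (y s) ≠ 0 := by
          intro hgs
          apply hy.ne_zero s
          rw [hfg (y s), hs, hgs]
          simp
        have hft : f (y t) = 0 := by
          have : g (y s) * f (y t) = 0 := by
            rw [hs] at hD
            linear_combination -hD
          exact (mul_eq_zero.1 this).resolve_left hgs
        apply hy.ne_smul hP hl hst (g (y t) / g (y s))
        have h1 := hfg (y t)
        rw [hft, zero_smul, zero_add] at h1
        have h2 := hfg (y s)
        rw [hs, zero_smul, zero_add] at h2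
        refine h1.trans (Eq.trans ?_ (congrArg ((g (y t) / g (y s)) • ·) h2).symm)
        simp only [smul_smul, div_mul_cancel₀ _ hgs]
      · apply hy.ne_smul hP hl hst (f (y t) / f (y s))
        refine (hfg (y t)).trans
          (Eq.trans ?_ (congrArg ((f (y t) / f (y s)) • ·) (hfg (y s))).symm)
        simp only [smul_add, smul_smul, div_mul_cancel₀ _ hs]
        congr 2
        field_simp
        linear_combination hD
    level := by
      intro t ht
      rw [hV]
      simp only
      rw [← hslope t ht, map_smul_eq_mul, hy.norm_eq, norm_inv, mul_one,
        inv_mul_cancel₀ (norm_ne_zero_iff.2 ht)]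
    level_zero := hV0
    segment_le := fun P hP k hk => w.level_segment_le hwv hP hk
    mono := hmono
    R_pos := hR0
    R_le := by linarith
    δ_pos := by positivity
    δ_le := min_le_right _ _
    κ_pos := hκ0
    κ'_pos := hκ'0
    ε_pos := hε
    lt_of_le_δ := fun q hq => hVδ (by
      rw [dist_zero_right]
      have := min_le_left (δ₀ / 2) (R / 2)
      linarith)
    le_of_le_R := fun q hq => hVR (by
      rw [dist_zero_right]
      have := min_le_left (R₀ / 2) (r / 2)
      linarith)
    strand := hstrand'
    decay := by
      intro u s t hc hq hs hst ht
      refine hy.norm_functional_le hst hLz fun r' hr' => ?_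
      obtain ⟨h1, h2⟩ := hstrand' u (r' - u) hc hq
        (abs_le.2 ⟨by linarith [hr'.1], by linarith [hr'.2]⟩)
      rw [add_sub_cancel] at h1 h2
      refine ⟨h1, ?_⟩
      rw [hslope r' h1, add_sub_cancel_left, norm_smul]
      exact (mul_le_mul_of_nonneg_right h2 (norm_nonneg e)).trans hre
    equicontinuous := by
      intro η hη
      obtain ⟨ε', hε', h1⟩ := hy.exists_slope_equicontinuous G hl hfg (r := R) hη
      exact ⟨ε', hε', fun u h hc hq hh => (h1 u h hc hq hh).2⟩ }

/-- A periodically stable system has no complete trajectory of constant extremal norm growing at a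
nonnegative rate. -/
theorem IsExtremal.false (G : GrowthNorm A w l m) (hy : IsExtremal A w l y) (hP : IsPAS A)
    (hl : 0 ≤ l) : False := by
  obtain ⟨y', hy', p, hp, hrec⟩ := hy.exists_recurrent G
  obtain ⟨f, g, V, r, R, δ, κ, κ', ε, S⟩ := hy'.exists_strandBox G hP hl
  refine S.false_of_recurrent fun T₁ T₂ η M hη => ?_
  have hF : ∀ F : Plane →L[ℂ] ℂ, ∀ s, ∀ᶠ k : ℕ+ in (p : Filter ℕ+),
      ‖F (y' (((k : ℕ) : ℝ) + s)) - F (y' s)‖ ≤ η := by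
    intro F s
    filter_upwards [((F.continuous.tendsto _).comp (hrec s)).eventually
      (Metric.closedBall_mem_nhds _ hη)] with k hk
    rw [add_comm]
    simpa only [Function.comp_apply, Metric.mem_closedBall, dist_eq_norm] using hk
  have hall : ∀ s, ∀ᶠ k : ℕ+ in (p : Filter ℕ+), ‖f (y' (((k : ℕ) : ℝ) + s)) - f (y' s)‖ ≤ η ∧
      ‖g (y' (((k : ℕ) : ℝ) + s)) - g (y' s)‖ ≤ η := fun s => (hF f s).and (hF g s)
  obtain ⟨k, hk, h0, h1, h2⟩ :=
    ((hp ⌈M⌉₊).and ((hall 0).and ((hall T₁).and (hall T₂)))).exists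
  refine ⟨(k : ℕ), (Nat.le_ceil M).trans (by exact_mod_cast hk), ?_⟩
  rintro s (rfl | rfl | rfl)
  exacts [h0, h1, h2]

theorem IsPAS.uniformDecay (hP : IsPAS A) : UniformDecay A := by
  rcases isEmpty_or_nonempty (Fin N) with hN | hN
  · refine ⟨1, 1, one_pos, one_pos, fun u x T _ hx => ?_⟩
    have := hx.law.sum_eq_one 0
    simp at this
  by_cases hneg : ∃ μ < 0, IsRate A μ
  · obtain ⟨μ, hμ, h⟩ := hneg
    exact h.uniformDecay hμ
  push Not at hneg
  set l := sInf {μ | IsRate A μ} with hl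
  have hne : {μ | IsRate A μ}.Nonempty := ⟨_, isRate_modeBound⟩
  have hlow : ∀ μ ∈ {μ | IsRate A μ}, 0 ≤ μ := fun μ hμ => by
    by_contra! h
    exact hneg μ h hμ
  have hl0 : 0 ≤ l := le_csInf hne hlow
  obtain ⟨w, hwne, hwC, hwexp⟩ := exists_seminorm_of_forall_isRate (A := A) (l := l) (by
    intro μ hμ
    obtain ⟨μ', ⟨C, hC⟩, hμ'⟩ := exists_lt_of_csInf_lt hne hμ
    refine ⟨|C|, fun t P hP v => (hC t P hP v).trans ?_⟩
    have := hP.nonneg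
    gcongr
    exact le_abs_self C)
  by_cases hdeg : ∃ v, v ≠ 0 ∧ w v = 0
  · obtain ⟨v, hv, hwv⟩ := hdeg
    exact hP.uniformDecay_of_degenerate hwne hwC hwexp hv hwv
  push Not at hdeg
  obtain ⟨m, hm, hmw⟩ := Seminorm.exists_mul_norm_le hwC
    (fun v hv => by_contra fun h => hdeg v h hv)
  have G : GrowthNorm A w l m := ⟨hm, hmw, hwC, fun u x a b hab hx =>
    hx.seminorm_le_of_exp hab w hwC hwexp⟩
  obtain ⟨y, hy⟩ := G.exists_isExtremal fun μ hμ h =>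
    not_le.2 hμ (csInf_le ⟨0, hlow⟩ h)
  exact (hy.false G hP hl0).elim

end Box

/-- A periodically asymptotically stable linear switched system on `ℂ²` is globally
uniformly exponentially stable. -/
theorem complex_linear_periodic_stability_implies_GUES
    (N : ℕ) (A : Fin N → EuclideanSpace ℂ (Fin 2) →L[ℂ] EuclideanSpace ℂ (Fin 2))
    (hPAS : ∀ (u : Fin N → ℝ → ℝ) (x : ℝ≥0 → EuclideanSpace ℂ (Fin 2)),
      IsCLinTrajectoryWith A u x → (IsConstantLaw u ∨ IsPeriodicLaw u) →
      Tendsto x atTop (𝓝 0)) :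
    ∃ C κ : ℝ, 0 < C ∧ 0 < κ ∧
      ∀ (u : Fin N → ℝ → ℝ) (x : ℝ≥0 → EuclideanSpace ℂ (Fin 2)),
        IsCLinTrajectoryWith A u x →
        ∀ t : ℝ≥0, ‖x t‖ ≤ C * Real.exp (-κ * (t : ℝ)) * ‖x 0‖ := by
  obtain ⟨C, κ, hC, hκ, h⟩ := IsPAS.uniformDecay (A := A) hPAS
  refine ⟨C, κ, hC, hκ, fun u x hx t => ?_⟩
  obtain ⟨v, hv⟩ := hx.exists_isArc
  simpa using h v _ t t.2 (hv t t.2)
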